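/- Let p ≥ 1 and let u₀ ∈ C⁰(ℝⁿ) be positive and satisfy u₀(x) ≤ c₀·exp(−α·exp(β|x|^γ)) for all x ∈ ℝⁿ, with positive constants c₀, α, β, γ. Then for any δ > 0 there exist t₀ > e and C > 0 such that the minimal solution u of the Cauchy problem (0) satisfies ‖u(·,t)‖_{L^∞(ℝⁿ)} ≤ C · t^{−1/p} · (ln ln t)^{2/(pγ)+δ} for all t ≥ t₀. -/

import Mathlib

open Real Set MeasureTheory Metric Filter

/-- The Laplacian of a function on `ℝⁿ`, written via iterated Fréchet derivatives
in the coordinate directions. -/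
noncomputable def lap {n : ℕ} (f : EuclideanSpace ℝ (Fin n) → ℝ)
    (x : EuclideanSpace ℝ (Fin n)) : ℝ :=
  ∑ i : Fin n, fderiv ℝ (fun y => fderiv ℝ f y (EuclideanSpace.single i 1)) x
    (EuclideanSpace.single i 1)

/-- `u` is a positive classical solution of the Cauchy problem `u_t = u^p Δu`,
`u(·,0) = u₀`, on `ℝⁿ × (0,T)`: it is continuous on `ℝⁿ × [0,T)`, attains the initial
data, is positive and spatially `C²` for `0 < t < T`, and satisfies the PDE pointwise. -/
def IsSolOn (n : ℕ) (p : ℝ) (u₀ : EuclideanSpace ℝ (Fin n) → ℝ)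
    (u : EuclideanSpace ℝ (Fin n) → ℝ → ℝ) (T : ℝ) : Prop :=
  ContinuousOn (fun z : (EuclideanSpace ℝ (Fin n)) × ℝ => u z.1 z.2) {z | 0 ≤ z.2 ∧ z.2 < T} ∧
  (∀ x, u x 0 = u₀ x) ∧
  (∀ x, ∀ t, 0 < t → t < T → 0 < u x t) ∧
  (∀ t, 0 < t → t < T → ContDiff ℝ 2 (fun y => u y t)) ∧
  (∀ x, ∀ t, 0 < t → t < T →
    HasDerivAt (fun s => u x s) (u x t ^ p * lap (fun y => u y t) x) t)

/-- `u` is a global positive classical solution of the Cauchy problem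
`u_t = u^p Δu` on `ℝⁿ × (0,∞)`, `u(·,0) = u₀`. -/
def IsSol (n : ℕ) (p : ℝ) (u₀ : EuclideanSpace ℝ (Fin n) → ℝ)
    (u : EuclideanSpace ℝ (Fin n) → ℝ → ℝ) : Prop :=
  ContinuousOn (fun z : (EuclideanSpace ℝ (Fin n)) × ℝ => u z.1 z.2) {z | 0 ≤ z.2} ∧
  (∀ x, u x 0 = u₀ x) ∧
  (∀ x, ∀ t, 0 < t → 0 < u x t) ∧
  (∀ t, 0 < t → ContDiff ℝ 2 (fun y => u y t)) ∧
  (∀ x, ∀ t, 0 < t →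
    HasDerivAt (fun s => u x s) (u x t ^ p * lap (fun y => u y t) x) t)

/-- `u` is the minimal global positive classical solution of the Cauchy problem:
whenever `T ∈ (0,∞]` and `v` is a positive classical solution on `ℝⁿ × (0,T)`, then
`u ≤ v` there.  (Quantifying over all finite `T > 0` covers `T = ∞`, since the
restriction of a global solution solves the problem on every `(0,T)`.) -/
def IsMinimalSol (n : ℕ) (p : ℝ) (u₀ : EuclideanSpace ℝ (Fin n) → ℝ)
    (u : EuclideanSpace ℝ (Fin n) → ℝ → ℝ) : Prop :=
  IsSol n p u₀ u ∧
  ∀ T > (0:ℝ), ∀ v, IsSolOn n p u₀ v T → ∀ x, ∀ t, 0 ≤ t → t < T → u x t ≤ v x t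

set_option linter.unusedSectionVars false
set_option linter.unusedVariables false
set_option linter.unusedSimpArgs false
set_option linter.style.haveILetI false
set_option maxHeartbeats 2000000

namespace FW

/-- Touching lemma. -/
theorem mp_touch {κ : Type*} (S : Finset κ) (F : κ → ℝ → ℝ) (T : ℝ)
    (hc : ∀ k ∈ S, ContinuousOn (F k) (Icc 0 T))
    (h0 : ∀ k ∈ S, 0 < F k 0)
    (hd : ∀ t, 0 < t → t ≤ T → (∀ k ∈ S, 0 ≤ F k t) → ∀ k ∈ S, F k t = 0 →
      ∃ f', 0 < f' ∧ HasDerivAt (F k) f' t) :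
    ∀ t, 0 ≤ t → t ≤ T → ∀ k ∈ S, 0 < F k t := by
  by_contra hcon
  push Not at hcon
  obtain ⟨t1, ht1, ht1T, k1, hk1, hF1⟩ := hcon
  set A : Set ℝ := {t | t ∈ Icc 0 T ∧ ∃ k ∈ S, F k t ≤ 0} with hA
  have hAc : IsClosed A := by
    have : A = ⋃ k ∈ S, (Icc 0 T ∩ (F k) ⁻¹' (Iic 0)) := by
      ext t; simp only [hA, mem_ofPred_eq, mem_iUnion, mem_inter_iff, mem_preimage, mem_Iic]
      constructor
      · rintro ⟨h, k, hk, hf⟩; exact ⟨k, hk, h, hf⟩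
      · rintro ⟨k, hk, h, hf⟩; exact ⟨h, k, hk, hf⟩
    rw [this]
    exact isClosed_biUnion_finset fun k hk => (hc k hk).preimage_isClosed_of_isClosed isClosed_Icc isClosed_Iic
  have hAne : A.Nonempty := ⟨t1, ⟨ht1, ht1T⟩, k1, hk1, hF1⟩
  have hAb : BddBelow A := ⟨0, fun t ht => ht.1.1⟩
  have hmem := hAc.csInf_mem hAne hAb
  set s := sInf A with hs
  obtain ⟨hsI, k, hk, hFk⟩ := hmem
  have hs0 : 0 < s := by
    rcases lt_or_eq_of_le hsI.1 with h | h
    · exact h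
    · rw [← h] at hFk; exact absurd (h0 k hk) (not_lt.mpr hFk)
  have hbefore : ∀ t, 0 ≤ t → t < s → ∀ j ∈ S, 0 < F j t := by
    intro t ht hts j hj
    by_contra hneg
    have : t ∈ A := ⟨⟨ht, hts.le.trans hsI.2⟩, j, hj, not_lt.mp hneg⟩
    exact absurd (csInf_le hAb this) (not_le.mpr hts)
  have hge : ∀ j ∈ S, 0 ≤ F j s := by
    intro j hj
    have h1 : ContinuousWithinAt (F j) (Ico 0 s) s :=
      ((hc j hj) s hsI).mono (fun t ht => ⟨ht.1, ht.2.le.trans hsI.2⟩)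
    have h2 : s ∈ closure (Ico 0 s) := by
      rw [closure_Ico hs0.ne]; exact ⟨hs0.le, le_rfl⟩
    have : (nhdsWithin s (Ico 0 s)).NeBot := mem_closure_iff_nhdsWithin_neBot.mp h2
    refine ge_of_tendsto h1 ?_
    filter_upwards [self_mem_nhdsWithin] with t ht using (hbefore t ht.1 ht.2 j hj).le
  have hz : F k s = 0 := le_antisymm hFk (hge k hk)
  obtain ⟨f', hf', hder⟩ := hd s hs0 hsI.2 hge k hk hz
  have hsl := hasDerivAt_iff_tendsto_slope.mp hder
  have hev : ∀ᶠ t in nhdsWithin s {s}ᶜ, 0 < slope (F k) s t := hsl.eventually (lt_mem_nhds hf')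
  have hev2 : ∀ᶠ t in nhdsWithin s (Iio s), 0 < slope (F k) s t :=
    hev.filter_mono (nhdsWithin_mono _ (fun t ht => ne_of_lt ht))
  have hev3 : ∀ᶠ t in nhdsWithin s (Iio s), 0 < t := by
    exact nhdsWithin_le_nhds (lt_mem_nhds hs0)
  obtain ⟨t, ⟨hslt, ht0⟩, hts⟩ := ((hev2.and hev3).and self_mem_nhdsWithin).exists
  have hpos := hbefore t ht0.le hts k hk
  rw [slope_def_field, hz] at hslt
  have : (F k t - 0) / (t - s) ≤ 0 := div_nonpos_of_nonneg_of_nonpos (by linarith) (by linarith [show t < s from hts])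
  linarith

variable {ι : Type*} [Fintype ι] [DecidableEq ι]

/-- Lattice directions. -/
def dir (e : ι × Bool) : ι → ℤ := if e.2 then Pi.single e.1 1 else - Pi.single e.1 1

/-- Difference quotient. -/
noncomputable def Dq (h : ℝ) (e : ι × Bool) (f : (ι → ℤ) → ℝ) (k : ι → ℤ) : ℝ :=
  (f (k + dir e) - f k) / h

/-- Discrete Laplacian. -/
noncomputable def Lp (h : ℝ) (f : (ι → ℤ) → ℝ) (k : ι → ℤ) : ℝ :=
  (∑ e : ι × Bool, (f (k + dir e) - f k)) / h ^ 2

/-- Sum of squares of difference quotients. -/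
noncomputable def Gm (h : ℝ) (f : (ι → ℤ) → ℝ) (k : ι → ℤ) : ℝ :=
  ∑ e : ι × Bool, (Dq h e f k) ^ 2

theorem Lp_nonneg_of_min (h : ℝ) (f : (ι → ℤ) → ℝ) (k : ι → ℤ)
    (hf : ∀ e, f k ≤ f (k + dir e)) : 0 ≤ Lp h f k := by
  unfold Lp
  exact div_nonneg (Finset.sum_nonneg fun e _ => by linarith [hf e]) (sq_nonneg h)

theorem Lp_add (h : ℝ) (f g : (ι → ℤ) → ℝ) (k : ι → ℤ) :
    Lp h (fun j => f j + g j) k = Lp h f k + Lp h g k := by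
  unfold Lp; rw [← add_div, ← Finset.sum_add_distrib]; congr 1
  exact Finset.sum_congr rfl fun e _ => by ring

theorem Lp_sub (h : ℝ) (f g : (ι → ℤ) → ℝ) (k : ι → ℤ) :
    Lp h (fun j => f j - g j) k = Lp h f k - Lp h g k := by
  unfold Lp; rw [← sub_div, ← Finset.sum_sub_distrib]; congr 1
  exact Finset.sum_congr rfl fun e _ => by ring

theorem Lp_const_mul (h c : ℝ) (f : (ι → ℤ) → ℝ) (k : ι → ℤ) :
    Lp h (fun j => c * f j) k = c * Lp h f k := by
  unfold Lp; rw [mul_div_assoc', Finset.mul_sum]; congr 1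
  exact Finset.sum_congr rfl fun e _ => by ring

theorem Lp_const (h c : ℝ) (k : ι → ℤ) : Lp h (fun _ => c) k = 0 := by
  unfold Lp; simp

theorem Lp_neg (h : ℝ) (f : (ι → ℤ) → ℝ) (k : ι → ℤ) :
    Lp h (fun j => - f j) k = - Lp h f k := by
  have := Lp_const_mul h (-1) f k
  simpa using this

theorem Lp_sum {α : Type*} (s : Finset α) (h : ℝ) (f : α → (ι → ℤ) → ℝ) (k : ι → ℤ) :
    Lp h (fun j => ∑ a ∈ s, f a j) k = ∑ a ∈ s, Lp h (f a) k := by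
  unfold Lp; rw [← Finset.sum_div]; congr 1
  rw [Finset.sum_comm]
  exact Finset.sum_congr rfl fun e _ => by rw [Finset.sum_sub_distrib]

theorem Lp_mul (h : ℝ) (hh : h ≠ 0) (f g : (ι → ℤ) → ℝ) (k : ι → ℤ) :
    Lp h (fun j => f j * g j) k = f k * Lp h g k + g k * Lp h f k
      + ∑ e, Dq h e f k * Dq h e g k := by
  unfold Lp Dq
  rw [mul_div_assoc', mul_div_assoc', Finset.mul_sum, Finset.mul_sum, ← add_div,
    ← Finset.sum_add_distrib]
  have : ∀ e : ι × Bool, (f (k + dir e) - f k) / h * ((g (k + dir e) - g k) / h)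
    = ((f (k + dir e) - f k) * (g (k + dir e) - g k)) / h ^ 2 := fun e => by
      field_simp
  simp_rw [this]
  rw [← Finset.sum_div, ← add_div, ← Finset.sum_add_distrib]
  congr 1
  exact Finset.sum_congr rfl fun e _ => by ring

theorem Lp_Dq (h : ℝ) (e : ι × Bool) (f : (ι → ℤ) → ℝ) (k : ι → ℤ) :
    Lp h (Dq h e f) k = Dq h e (Lp h f) k := by
  unfold Lp Dq
  rw [← sub_div, ← Finset.sum_sub_distrib, div_right_comm]
  congr 1
  rw [Finset.sum_div]
  refine Finset.sum_congr rfl fun e' _ => ?_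
  rw [add_right_comm]; ring

/-- Comparison principle on a finite set of lattice points. -/
theorem cmp (S : Finset (ι → ℤ)) (h T K η : ℝ) (hη : 0 < η) (hT : 0 ≤ T) (hK : 0 ≤ K)
    (G : (ι → ℤ) → ℝ → ℝ)
    (hc : ∀ k ∈ S, ContinuousOn (G k) (Icc 0 T))
    (h0 : ∀ k ∈ S, 0 ≤ G k 0)
    (hb : ∀ k ∈ S, ∀ e, k + dir e ∉ S → ∀ t, 0 < t → t ≤ T → 0 ≤ G (k + dir e) t)
    (hd : ∀ k ∈ S, ∀ t, 0 < t → t ≤ T → -η ≤ G k t → G k t ≤ 0 →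
      ∃ g a b, HasDerivAt (G k) g t ∧ 0 ≤ a ∧ |b| ≤ K ∧ a * Lp h (fun j => G j t) k + b * G k t ≤ g) :
    ∀ k ∈ S, ∀ t, 0 ≤ t → t ≤ T → 0 ≤ G k t := by
  have main : ∀ ε, 0 < ε → ε * Real.exp ((K+1)*T) ≤ η → ∀ t, 0 ≤ t → t ≤ T → ∀ k ∈ S,
      0 < G k t + ε * Real.exp ((K+1)*t) := by
    intro ε hε hεη
    apply mp_touch S (fun k t => G k t + ε * Real.exp ((K+1)*t)) T
    · intro k hk
      exact (hc k hk).add (by fun_prop)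
    · intro k hk
      have := h0 k hk
      simp; linarith
    · intro t ht htT hall k hk hz
      have hexp := Real.exp_pos ((K+1)*t)
      have hG : G k t = - (ε * Real.exp ((K+1)*t)) := by linarith
      have hle : Real.exp ((K+1)*t) ≤ Real.exp ((K+1)*T) :=
        Real.exp_le_exp.mpr (mul_le_mul_of_nonneg_left htT (by linarith))
      have hle2 := mul_le_mul_of_nonneg_left hle hε.le
      have hpos := mul_pos hε hexp
      obtain ⟨g, a, b, hg, ha, hbK, hineq⟩ := hd k hk t ht htT (by linarith) (by linarith)
      refine ⟨g + ε * (Real.exp ((K+1)*t) * (K+1)), ?_, ?_⟩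
      · have hL : 0 ≤ Lp h (fun j => G j t) k := by
          apply Lp_nonneg_of_min
          intro e
          by_cases he : k + dir e ∈ S
          · have := hall _ he; rw [hG]; linarith
          · have := hb k hk e he t ht htT; rw [hG]; linarith
        have := mul_nonneg ha hL
        rw [hG] at hineq
        have hb2 := (abs_le.mp hbK).2
        nlinarith
      · have h1 : HasDerivAt (fun t => Real.exp ((K+1)*t)) (Real.exp ((K+1)*t) * (K+1)) t := by
          have := ((hasDerivAt_id t).const_mul (K+1)).exp
          simpa using this
        exact hg.add (h1.const_mul ε)
  intro k hk t ht htT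
  by_contra hneg
  push Not at hneg
  have hE := Real.exp_pos ((K+1)*T)
  have hle : Real.exp ((K+1)*t) ≤ Real.exp ((K+1)*T) :=
        Real.exp_le_exp.mpr (mul_le_mul_of_nonneg_left htT (by linarith))
  set ε := min (η / Real.exp ((K+1)*T)) ((-G k t) / Real.exp ((K+1)*T)) with hεd
  have hε : 0 < ε := lt_min (div_pos hη hE) (div_pos (by linarith) hE)
  have h1 := main ε hε ((le_div_iff₀ hE).mp (min_le_left _ _)) t ht htT k hk
  have h2 : ε * Real.exp ((K+1)*T) ≤ - G k t := (le_div_iff₀ hE).mp (min_le_right _ _)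
  have := mul_le_mul_of_nonneg_left hle hε.le
  linarith

end FW

namespace FW
variable {ι : Type*} [Fintype ι] [DecidableEq ι]

theorem Lp_eq (h : ℝ) (f : (ι → ℤ) → ℝ) (k : ι → ℤ) :
    Lp h f k = (∑ i, (f (k + Pi.single i 1) + f (k - Pi.single i 1) - 2 * f k)) / h ^ 2 := by
  unfold Lp
  rw [Fintype.sum_prod_type]
  congr 1
  refine Finset.sum_congr rfl fun i _ => ?_
  rw [Fintype.sum_bool]
  simp [dir, sub_eq_add_neg]; ring

theorem Lp_coord (h : ℝ) (φ : ℤ → ℝ) (i : ι) (k : ι → ℤ) :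
    Lp h (fun j => φ (j i)) k = (φ (k i + 1) + φ (k i - 1) - 2 * φ (k i)) / h ^ 2 := by
  rw [Lp_eq]
  congr 1
  rw [Finset.sum_eq_single i]
  · simp
  · intro b _ hb
    simp [Pi.single_eq_of_ne (Ne.symm hb)]; ring
  · simp

theorem Lp_diff (h : ℝ) (φ : ℤ → ℝ) (i j : ι) (hij : i ≠ j) (k : ι → ℤ) :
    Lp h (fun m => φ (m i - m j)) k
      = 2 * ((φ (k i - k j + 1) + φ (k i - k j - 1) - 2 * φ (k i - k j)) / h ^ 2) := by
  rw [Lp_eq, mul_div_assoc']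
  congr 1
  have hs : ∀ b, b ≠ i ∧ b ≠ j → (φ ((k + Pi.single b 1 : ι → ℤ) i - (k + Pi.single b 1 : ι → ℤ) j)
      + φ ((k - Pi.single b 1 : ι → ℤ) i - (k - Pi.single b 1 : ι → ℤ) j) - 2 * φ (k i - k j)) = 0 := by
    intro b hb
    simp [Pi.single_eq_of_ne (Ne.symm hb.1), Pi.single_eq_of_ne (Ne.symm hb.2)]; ring
  rw [Fintype.sum_eq_add i j hij (fun b hb => hs b hb)]
  have e1 : k i + 1 - k j = k i - k j + 1 := by ring
  have e2 : k i - 1 - k j = k i - k j - 1 := by ring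
  have e3 : k i - (k j + 1) = k i - k j - 1 := by ring
  have e4 : k i - (k j - 1) = k i - k j + 1 := by ring
  simp [Pi.single_eq_of_ne hij, Pi.single_eq_of_ne (Ne.symm hij), e1, e2, e3, e4]; ring

theorem Lp_prod (h c : ℝ) (φ : ℤ → ℝ) (hφ : ∀ a, φ (a + 1) + φ (a - 1) = 2 * c * φ a)
    (k : ι → ℤ) :
    Lp h (fun j => ∏ m, φ (j m)) k = (Fintype.card ι : ℝ) * (2 * (c - 1) / h ^ 2) * ∏ m, φ (k m) := by
  rw [Lp_eq]
  have : ∀ i, ((∏ m, φ ((k + Pi.single i 1 : ι → ℤ) m)) + (∏ m, φ ((k - Pi.single i 1 : ι → ℤ) m)) - 2 * ∏ m, φ (k m))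
      = 2 * (c - 1) * ∏ m, φ (k m) := by
    intro i
    have hp := fun g : ι → ℝ => (Finset.mul_prod_erase Finset.univ g (Finset.mem_univ i)).symm
    simp only [hp]
    have h1 : ∏ m ∈ Finset.univ.erase i, φ ((k + Pi.single i 1 : ι → ℤ) m) = ∏ m ∈ Finset.univ.erase i, φ (k m) := by
      refine Finset.prod_congr rfl fun m hm => ?_
      have := Finset.ne_of_mem_erase hm
      simp [Pi.single_eq_of_ne this]
    have h2 : ∏ m ∈ Finset.univ.erase i, φ ((k - Pi.single i 1 : ι → ℤ) m) = ∏ m ∈ Finset.univ.erase i, φ (k m) := by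
      refine Finset.prod_congr rfl fun m hm => ?_
      have := Finset.ne_of_mem_erase hm
      simp [Pi.single_eq_of_ne this]
    rw [h1, h2]
    simp
    linear_combination (∏ m ∈ Finset.univ.erase i, φ (k m)) * hφ (k i)
  simp_rw [this]
  simp; ring

theorem cos_rec (θ : ℝ) (a : ℤ) :
    Real.cos (θ * ((a + 1 : ℤ) : ℝ)) + Real.cos (θ * ((a - 1 : ℤ) : ℝ))
      = 2 * Real.cos θ * Real.cos (θ * (a : ℝ)) := by
  push_cast
  rw [mul_add, mul_sub, Real.cos_add, Real.cos_sub]; ring_nf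

theorem one_sub_cos_le (x : ℝ) : 1 - Real.cos x ≤ x ^ 2 / 2 := by
  linarith [Real.one_sub_sq_div_two_le_cos (x := x)]

theorem le_one_sub_cos {x : ℝ} (hx : |x| ≤ 1) : x ^ 2 / 4 ≤ 1 - Real.cos x := by
  have h1 := (abs_le.mp (Real.cos_bound hx)).2
  have h2 : |x| ^ 4 = x ^ 2 * x ^ 2 := by
    rw [show |x|^4 = (|x|^2)^2 by ring, sq_abs]; ring
  have h3 : x ^ 2 ≤ 1 := by rw [← sq_abs]; nlinarith [abs_nonneg x]
  rw [h2] at h1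
  nlinarith [sq_nonneg x]

/-- squared euclidean norm of the lattice point `h k` -/
noncomputable def nsq (h : ℝ) (k : ι → ℤ) : ℝ := ∑ i, (h * (k i : ℝ)) ^ 2

theorem nsq_nonneg (h : ℝ) (k : ι → ℤ) : 0 ≤ nsq h k := Finset.sum_nonneg fun _ _ => sq_nonneg _

theorem le_nsq (h : ℝ) (k : ι → ℤ) (i : ι) : (h * (k i : ℝ)) ^ 2 ≤ nsq h k :=
  Finset.single_le_sum (f := fun i => (h * (k i : ℝ)) ^ 2) (fun _ _ => sq_nonneg _) (Finset.mem_univ i)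

theorem Lp_nsq_shift (h : ℝ) (hh : h ≠ 0) (x : ι → ℝ) (k : ι → ℤ) :
    Lp h (fun k => ∑ i, (h * (k i : ℝ) - x i) ^ 2) k = 2 * Fintype.card ι := by
  rw [Lp_sum]
  have : ∀ i ∈ Finset.univ, Lp h (fun k : ι → ℤ => (h * (k i : ℝ) - x i) ^ 2) k = 2 := by
    intro i _
    rw [Lp_coord h (fun a => (h * (a : ℝ) - x i) ^ 2)]
    push_cast
    field_simp; ring
  rw [Finset.sum_congr rfl this]; simp; ring

theorem Lp_nsq (h : ℝ) (hh : h ≠ 0) (k : ι → ℤ) :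
    Lp h (nsq h) k = 2 * Fintype.card ι := by
  have := Lp_nsq_shift h hh (fun _ => 0) k
  have e : (nsq h : (ι → ℤ) → ℝ) = fun k => ∑ i, (h * (k i : ℝ) - 0) ^ 2 := by
    funext k; simp [nsq]
  rw [e]; exact this

/-- The box of lattice points. -/
noncomputable def box (ι : Type*) [Fintype ι] [DecidableEq ι] (N : ℕ) : Finset (ι → ℤ) :=
  Fintype.piFinset fun _ => Finset.Icc (-(N:ℤ)) N

theorem mem_box {N : ℕ} {k : ι → ℤ} : k ∈ box ι N ↔ ∀ i, |k i| ≤ N := by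
  simp [box, abs_le]

/-- The open cube of radius r -/
theorem exists_cube (h r : ℝ) (hh : 0 < h) :
    ∃ S : Finset (ι → ℤ), ∀ k, k ∈ S ↔ ∀ i, |h * (k i : ℝ)| < r := by
  classical
  refine ⟨(box ι ⌈r / h⌉₊).filter (fun k => ∀ i, |h * (k i : ℝ)| < r), fun k => ?_⟩
  rw [Finset.mem_filter, and_iff_right_iff_imp, mem_box]
  intro hk i
  have h1 := hk i
  rw [abs_mul, abs_of_pos hh, mul_comm, ← lt_div_iff₀ hh] at h1
  have h2 : |(k i : ℝ)| ≤ (⌈r / h⌉₊ : ℝ) := h1.le.trans (Nat.le_ceil _)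
  exact_mod_cast h2

theorem dir_bound (e : ι × Bool) (i : ι) : |dir e i| ≤ 1 := by
  unfold dir
  by_cases h : i = e.1
  · subst h; split_ifs <;> simp
  · split_ifs <;> simp [Pi.single_eq_of_ne h]

theorem dir_apply (e : ι × Bool) (i : ι) :
    dir e i = if i = e.1 then (if e.2 then 1 else -1) else 0 := by
  unfold dir
  by_cases h : i = e.1
  · subst h; simp; split_ifs <;> simp
  · split_ifs <;> simp [Pi.single_eq_of_ne h]

theorem abs_add_dir (h : ℝ) (hh : 0 < h) (k : ι → ℤ) (e : ι × Bool) (i : ι) :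
    |h * ((k + dir e) i : ℝ)| ≤ |h * (k i : ℝ)| + h := by
  have h1 : h * (((k + dir e) i : ℤ) : ℝ) = h * (k i : ℝ) + h * (dir e i : ℝ) := by
    simp [mul_add]
  rw [h1]
  refine (abs_add_le _ _).trans ?_
  have : |h * (dir e i : ℝ)| ≤ h := by
    rw [abs_mul, abs_of_pos hh]
    have h2 : |(dir e i : ℝ)| ≤ 1 := by exact_mod_cast dir_bound e i
    nlinarith
  linarith

/-- Product-cosine lower barrier. -/
theorem pc_barrier (h r T Lam c : ℝ) (hh : 0 < h) (hr : 0 < r) (hhr : h ≤ r) (hT : 0 ≤ T) (hLam : 0 ≤ Lam)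
    (hc : 0 ≤ c) (v a : (ι → ℤ) → ℝ → ℝ)
    (hcont : ∀ k, (∀ i, |h * (k i : ℝ)| < r) → ContinuousOn (v k) (Icc 0 T))
    (hv0 : ∀ k, (∀ i, |h * (k i : ℝ)| < r) → c ≤ v k 0)
    (hvn : ∀ k, (∀ i, |h * (k i : ℝ)| < r + h) → ∀ t, 0 < t → t ≤ T → 0 ≤ v k t)
    (ha : ∀ k, (∀ i, |h * (k i : ℝ)| < r) → ∀ t, 0 < t → t ≤ T → 0 ≤ a k t ∧ a k t ≤ Lam)
    (hd : ∀ k, (∀ i, |h * (k i : ℝ)| < r) → ∀ t, 0 < t → t ≤ T →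
      HasDerivAt (v k) (a k t * Lp h (fun j => v j t) k) t) :
    ∀ k, (∀ i, |h * (k i : ℝ)| < r) → ∀ t, 0 ≤ t → t ≤ T →
      c * Real.exp (-(Lam * Fintype.card ι * (π / (2 * r)) ^ 2) * t)
        * ∏ i, Real.cos (π / (2 * r) * h * (k i : ℝ)) ≤ v k t := by
  obtain ⟨S, hS⟩ := exists_cube (ι := ι) h r hh
  set θ := π / (2 * r) * h with hθ
  set Kc := Lam * Fintype.card ι * (π / (2 * r)) ^ 2 with hKc
  set ψ : (ι → ℤ) → ℝ := fun k => ∏ i, Real.cos (θ * (k i : ℝ)) with hψ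
  have harg : ∀ a : ℤ, |θ * (a : ℝ)| = π / (2 * r) * |h * (a : ℝ)| := by
    intro a
    rw [hθ, mul_assoc, abs_mul, abs_of_pos (by positivity : 0 < π / (2 * r))]
  have hlt : ∀ a : ℤ, |h * (a : ℝ)| < r → |θ * (a : ℝ)| < π / 2 := by
    intro a h1
    rw [harg]
    calc π / (2 * r) * |h * (a : ℝ)| < π / (2 * r) * r := mul_lt_mul_of_pos_left h1 (by positivity)
      _ = π / 2 := by field_simp
  have hψpos : ∀ k ∈ S, 0 < ψ k := by
    intro k hk
    refine Finset.prod_pos fun i _ => ?_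
    have := abs_lt.mp (hlt _ ((hS k).1 hk i))
    exact Real.cos_pos_of_mem_Ioo ⟨this.1, this.2⟩
  have hψb : ∀ k ∈ S, ∀ e, k + dir e ∉ S → ψ (k + dir e) ≤ 0 := by
    intro k hk e he
    have hkS := (hS k).1 hk
    have hother : ∀ i, i ≠ e.1 → (k + dir e) i = k i := by
      intro i hi; simp [dir_apply, hi]
    have hbad : r ≤ |h * ((k + dir e) e.1 : ℝ)| := by
      by_contra hlt'
      push Not at hlt'
      apply he
      rw [hS]
      intro i
      by_cases hi : i = e.1
      · rw [hi]; exact hlt'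
      · rw [hother i hi]; exact hkS i
    have hup : |h * ((k + dir e) e.1 : ℝ)| ≤ r + h := by
      have := abs_add_dir h hh k e e.1
      linarith [hkS e.1]
    simp only [hψ]
    rw [← Finset.mul_prod_erase Finset.univ _ (Finset.mem_univ e.1)]
    apply mul_nonpos_of_nonpos_of_nonneg
    · rw [← Real.cos_abs, harg]
      apply Real.cos_nonpos_of_pi_div_two_le_of_le
      · calc π / 2 = π / (2 * r) * r := by field_simp
          _ ≤ _ := mul_le_mul_of_nonneg_left hbad (by positivity)
      · calc π / (2 * r) * |h * ((k + dir e) e.1 : ℝ)| ≤ π / (2 * r) * (r + r) :=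
            mul_le_mul_of_nonneg_left (by linarith) (by positivity)
          _ = π := by field_simp; ring
          _ ≤ π + π / 2 := by linarith [Real.pi_pos]
    · refine Finset.prod_nonneg fun i hi => ?_
      rw [hother i (Finset.ne_of_mem_erase hi)]
      have := abs_lt.mp (hlt _ (hkS i))
      exact (Real.cos_pos_of_mem_Ioo ⟨this.1, this.2⟩).le
  have hLψ : ∀ k ∈ S, -(Fintype.card ι * (π / (2 * r)) ^ 2) * ψ k ≤ Lp h ψ k := by
    intro k hk
    have h1 := Lp_prod (ι := ι) h (Real.cos θ) (fun a : ℤ => Real.cos (θ * (a : ℝ))) (cos_rec θ) k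
    have h1' : Lp h ψ k = _ := h1
    rw [h1']
    have h2 := one_sub_cos_le θ
    have h3 : -((π / (2 * r)) ^ 2) ≤ 2 * (Real.cos θ - 1) / h ^ 2 := by
      rw [le_div_iff₀ (by positivity)]
      have : θ ^ 2 = (π / (2 * r)) ^ 2 * h ^ 2 := by rw [hθ]; ring
      nlinarith
    have h4 := mul_le_mul_of_nonneg_left h3 (Nat.cast_nonneg (α := ℝ) (Fintype.card ι))
    have h5 := mul_le_mul_of_nonneg_right h4 (hψpos k hk).le
    calc _ = _ := by ring
      _ ≤ _ := h5
  have key := cmp S h T 0 1 one_pos hT le_rfl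
    (fun k t => v k t - c * Real.exp (-Kc * t) * ψ k)
    (fun k hk => (hcont k ((hS k).1 hk)).sub (by fun_prop))
    (fun k hk => by
      have h1 := hv0 k ((hS k).1 hk)
      have h2 : ψ k ≤ 1 := by
        refine Finset.prod_le_one (fun i _ => ?_) (fun i _ => Real.cos_le_one _)
        have := abs_lt.mp (hlt _ ((hS k).1 hk i))
        exact (Real.cos_pos_of_mem_Ioo ⟨this.1, this.2⟩).le
      simp; nlinarith)
    (fun k hk e he t ht htT => by
      have h1 := hψb k hk e he
      have h2 := hvn (k + dir e) (fun i => by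
        have := abs_add_dir h hh k e i
        linarith [(hS k).1 hk i]) t ht htT
      have h3 : c * Real.exp (-Kc * t) * ψ (k + dir e) ≤ 0 :=
        mul_nonpos_of_nonneg_of_nonpos (by positivity) h1
      linarith)
    (fun k hk t ht htT _ _ => by
      refine ⟨_, a k t, 0, (hd k ((hS k).1 hk) t ht htT).sub
        ((((hasDerivAt_id t).const_mul (-Kc)).exp.const_mul c).mul_const (ψ k)), (ha k ((hS k).1 hk) t ht htT).1, by simp, ?_⟩
      rw [Lp_sub, Lp_const_mul]
      have h1 := hLψ k hk
      have h2 := (ha k ((hS k).1 hk) t ht htT)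
      have h3 := hψpos k hk
      have h4 : -Kc * ψ k ≤ a k t * Lp h ψ k := by
        have h5 : a k t * (-(Fintype.card ι * (π / (2 * r)) ^ 2) * ψ k) ≤ a k t * Lp h ψ k :=
          mul_le_mul_of_nonneg_left h1 h2.1
        have h6 : a k t * ((Fintype.card ι * (π / (2 * r)) ^ 2) * ψ k) ≤ Lam * ((Fintype.card ι * (π / (2 * r)) ^ 2) * ψ k) :=
          mul_le_mul_of_nonneg_right h2.2 (by positivity)
        rw [hKc]; linarith
      have h7 := mul_le_mul_of_nonneg_left h4 (by positivity : 0 ≤ c * Real.exp (-Kc * t))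
      simp only [id, mul_one, zero_mul, add_zero]
      linarith)
  intro k hk t ht htT
  have := key k ((hS k).2 hk) t ht htT
  linarith

end FW

namespace FW
variable {ι : Type*} [Fintype ι] [DecidableEq ι]

theorem cos_ge_half {x : ℝ} (hx : |x| ≤ 1) : 1 / 2 ≤ Real.cos x := by
  have := Real.one_sub_sq_div_two_le_cos (x := x)
  have h3 : x ^ 2 ≤ 1 := by rw [← sq_abs]; nlinarith [abs_nonneg x]
  linarith

/-- Doubling lemma. -/
theorem dd (i j : ι) (hij : i ≠ j) (h ℓ ρ T lam ω C1 C3 : ℝ) (hh : 0 < h) (hℓ : 2 * h ≤ ℓ)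
    (hρ : 0 < ρ) (hT : 0 ≤ T) (hlam : 0 < lam) (hω : 0 ≤ ω) (hC1 : 0 ≤ C1) (hC3 : 0 ≤ C3)
    (W : (ι → ℤ) → ℝ → ℝ)
    (hcont : ∀ k, (∀ m, |h * (k m : ℝ)| < ρ) → ContinuousOn (W k) (Icc 0 T))
    (hlow : ∀ k, (∀ m, |h * (k m : ℝ)| < ρ + h) → ∀ t, 0 ≤ t → t ≤ T → -ω ≤ W k t)
    (hdiag : ∀ k, (∀ m, |h * (k m : ℝ)| < ρ + h) → k i = k j → ∀ t, 0 ≤ t → t ≤ T → -(C1 * t) ≤ W k t)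
    (hder : ∀ k, (∀ m, |h * (k m : ℝ)| < ρ) → ∀ t, 0 < t → t ≤ T →
      ∃ w, HasDerivAt (W k) w t ∧ lam * Lp h (fun m => W m t) k - C3 ≤ w)
    (k : ι → ℤ) (hk : ∀ m, |h * (k m : ℝ)| < ρ) (hd0 : 0 < k i - k j)
    (hd1 : h * ((k i - k j : ℤ) : ℝ) < ℓ) (t : ℝ) (ht : 0 ≤ t) (htT : t ≤ T) :
    -(2 * ω * Real.exp (-(lam / ℓ ^ 2) * t) + ω / ℓ * (h * ((k i - k j : ℤ) : ℝ)) + ω / ρ ^ 2 * nsq h k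
      + 2 * ((ω * (2 * Fintype.card ι) / ρ ^ 2 + C3 / lam) / 4) * ℓ * (h * ((k i - k j : ℤ) : ℝ)) + C1 * t) ≤ W k t := by
  classical
  obtain ⟨S0, hS0⟩ := exists_cube (ι := ι) h ρ hh
  set S := S0.filter (fun k => 0 < k i - k j ∧ h * ((k i - k j : ℤ) : ℝ) < ℓ) with hSdef
  have hS : ∀ k, k ∈ S ↔ (∀ m, |h * (k m : ℝ)| < ρ) ∧ 0 < k i - k j ∧ h * ((k i - k j : ℤ) : ℝ) < ℓ := by
    intro k; rw [hSdef, Finset.mem_filter, hS0]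
  have hℓ0 : 0 < ℓ := by linarith
  set K4 := (ω * (2 * Fintype.card ι) / ρ ^ 2 + C3 / lam) / 4 with hK4
  have hK40 : 0 ≤ K4 := by positivity
  set θ := h / ℓ with hθ
  have hθ0 : 0 < θ := by positivity
  have hθ1 : θ ≤ 1 / 2 := by rw [hθ, div_le_iff₀ hℓ0]; linarith
  set φ : ℤ → ℝ := fun d => ω / ℓ * (h * (d : ℝ)) + K4 * (h * (d : ℝ)) * (2 * ℓ - h * (d : ℝ)) with hφ
  set cs : ℤ → ℝ := fun d => Real.cos (θ * (d : ℝ)) with hcs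
  set Bar : (ι → ℤ) → ℝ → ℝ := fun k t => 2 * ω * Real.exp (-(lam / ℓ ^ 2) * t) * cs (k i - k j)
    + φ (k i - k j) + ω / ρ ^ 2 * nsq h k + C1 * t with hBar
  have hθd : ∀ d : ℤ, θ * (d : ℝ) = (h * (d : ℝ)) / ℓ := by intro d; rw [hθ]; ring
  -- non negativity of pieces
  have hcs0 : ∀ d : ℤ, 0 ≤ d → h * (d : ℝ) ≤ ℓ + h → 0 ≤ cs d := by
    intro d hd hd2
    have hd' : (0 : ℝ) ≤ d := by exact_mod_cast hd
    have h1 : θ * (d : ℝ) ≤ 3 / 2 := by rw [hθd, div_le_iff₀ hℓ0]; linarith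
    refine Real.cos_nonneg_of_mem_Icc ⟨?_, ?_⟩
    · linarith [Real.pi_pos, mul_nonneg hθ0.le hd']
    · linarith [Real.pi_gt_three]
  have hφ0 : ∀ d : ℤ, 0 ≤ d → h * (d : ℝ) ≤ ℓ + h → ω / ℓ * (h * (d : ℝ)) ≤ φ d := by
    intro d hd hd2
    have hd' : (0 : ℝ) ≤ d := by exact_mod_cast hd
    have : 0 ≤ K4 * (h * (d : ℝ)) * (2 * ℓ - h * (d : ℝ)) :=
      mul_nonneg (by positivity) (by linarith)
    simp only [hφ]; linarith
  have hLcs : ∀ k ∈ S, Lp h (fun m => cs (m i - m j)) k ≤ -(1 / ℓ ^ 2) * cs (k i - k j) := by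
    intro k hk
    obtain ⟨_, h0, h1⟩ := (hS k).1 hk
    rw [Lp_diff h cs i j hij]
    have hr := cos_rec θ (k i - k j)
    have h2 := le_one_sub_cos (x := θ) (by rw [abs_of_pos hθ0]; linarith)
    have h3 := hcs0 (k i - k j) h0.le (by linarith)
    have e : cs (k i - k j + 1) + cs (k i - k j - 1) - 2 * cs (k i - k j)
        = -(2 * (1 - Real.cos θ)) * cs (k i - k j) := by
      simp only [hcs]; rw [hr]; ring
    rw [e, mul_div_assoc', div_le_iff₀ (by positivity)]
    have e2 : 1 / ℓ ^ 2 * h ^ 2 = θ ^ 2 := by rw [hθ]; field_simp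
    have e3 : -(1 / ℓ ^ 2) * cs (k i - k j) * h ^ 2 = - (θ ^ 2 * cs (k i - k j)) := by rw [← e2]; ring
    rw [e3]
    nlinarith
  have hLφ : ∀ k, Lp h (fun m => φ (m i - m j)) k = - (4 * K4) := by
    intro k
    rw [Lp_diff h φ i j hij]
    simp only [hφ]; push_cast; field_simp; ring
  have hLBar : ∀ k ∈ S, ∀ t, Lp h (fun m => Bar m t) k
      ≤ -(1 / ℓ ^ 2) * (2 * ω * Real.exp (-(lam / ℓ ^ 2) * t) * cs (k i - k j)) - C3 / lam := by
    intro k hk t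
    simp only [hBar]
    rw [Lp_add, Lp_add, Lp_add, Lp_const, Lp_const_mul, Lp_const_mul, hLφ, Lp_nsq h hh.ne']
    have h1 := mul_le_mul_of_nonneg_left (hLcs k hk) (by positivity : 0 ≤ 2 * ω * Real.exp (-(lam / ℓ ^ 2) * t))
    have h2 : ω / ρ ^ 2 * (2 * (Fintype.card ι : ℝ)) = ω * (2 * Fintype.card ι) / ρ ^ 2 := by ring
    rw [h2, hK4]
    linarith
  have key := cmp S h T 0 1 one_pos hT le_rfl
    (fun k t => W k t + Bar k t)
    (fun k hk => (hcont k ((hS k).1 hk).1).add (by simp only [hBar]; fun_prop))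
    (fun k hk => by
      obtain ⟨hc, h0, h1⟩ := (hS k).1 hk
      have h2 := hlow k (fun m => by linarith [hc m]) 0 le_rfl hT
      have hd' : (0 : ℝ) ≤ ((k i - k j : ℤ) : ℝ) := by exact_mod_cast h0.le
      have h3 : 1 / 2 ≤ cs (k i - k j) := by
        apply cos_ge_half
        rw [abs_of_nonneg (by positivity), hθd, div_le_one hℓ0]; exact h1.le
      have h4 := hφ0 _ h0.le (by linarith)
      have h5 : 0 ≤ ω / ρ ^ 2 * nsq h k := mul_nonneg (by positivity) (nsq_nonneg h k)
      have h6 : 0 ≤ ω / ℓ * (h * ((k i - k j : ℤ) : ℝ)) := by positivity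
      simp only [hBar, mul_zero, Real.exp_zero, mul_one, add_zero]
      nlinarith)
    (fun k hk e he t ht htT => by
      obtain ⟨hc, h0, h1⟩ := (hS k).1 hk
      have hc' : ∀ m, |h * ((k + dir e) m : ℝ)| < ρ + h := fun m => by
        have := abs_add_dir h hh k e m
        linarith [hc m]
      have hdd : (k + dir e) i - (k + dir e) j ≤ k i - k j + 1 ∧ k i - k j - 1 ≤ (k + dir e) i - (k + dir e) j := by
        simp only [Pi.add_apply, dir_apply]
        by_cases hi : i = e.1
        · by_cases hj : j = e.1
          · exact absurd (hi.trans hj.symm) hij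
          · simp only [hi, hj, if_true, if_false]
            split_ifs <;> omega
        · by_cases hj : j = e.1
          · simp only [hi, hj, if_true, if_false]
            split_ifs <;> omega
          · simp only [hi, hj, if_false]; omega
      have hd0' : 0 ≤ (k + dir e) i - (k + dir e) j := by omega
      have hdR : ((((k + dir e) i - (k + dir e) j : ℤ)) : ℝ) ≤ ((k i - k j : ℤ) : ℝ) + 1 := by exact_mod_cast hdd.1
      have hd1' : h * (((k + dir e) i - (k + dir e) j : ℤ) : ℝ) ≤ ℓ + h := by nlinarith
      have hd0R : (0 : ℝ) ≤ (((k + dir e) i - (k + dir e) j : ℤ) : ℝ) := by exact_mod_cast hd0'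
      have b1 : 0 ≤ 2 * ω * Real.exp (-(lam / ℓ ^ 2) * t) * cs ((k + dir e) i - (k + dir e) j) :=
        mul_nonneg (by positivity) (hcs0 _ hd0' hd1')
      have b2 := hφ0 _ hd0' hd1'
      have b3 : 0 ≤ ω / ℓ * (h * (((k + dir e) i - (k + dir e) j : ℤ) : ℝ)) := by positivity
      have b4 : 0 ≤ ω / ρ ^ 2 * nsq h (k + dir e) := mul_nonneg (by positivity) (nsq_nonneg h _)
      have b5 : 0 ≤ C1 * t := by positivity
      simp only [hBar]
      by_cases hz : (k + dir e) i = (k + dir e) j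
      · have := hdiag _ hc' hz t ht.le htT
        linarith
      · have hW := hlow _ hc' t ht.le htT
        have hdp : 0 < (k + dir e) i - (k + dir e) j := by omega
        by_cases hcl : h * (((k + dir e) i - (k + dir e) j : ℤ) : ℝ) < ℓ
        · have hex : ∃ m, ρ ≤ |h * ((k + dir e) m : ℝ)| := by
            by_contra hcon
            push Not at hcon
            exact he ((hS _).2 ⟨hcon, hdp, hcl⟩)
          obtain ⟨m, hm⟩ := hex
          have h7 := le_nsq h (k + dir e) m
          have h8 : ρ ^ 2 ≤ nsq h (k + dir e) := by
            rw [← sq_abs] at h7; nlinarith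
          have h9 : ω ≤ ω / ρ ^ 2 * nsq h (k + dir e) := by
            calc ω = ω / ρ ^ 2 * ρ ^ 2 := by field_simp
              _ ≤ _ := mul_le_mul_of_nonneg_left h8 (by positivity)
          linarith
        · push Not at hcl
          have h9 : ω ≤ ω / ℓ * (h * (((k + dir e) i - (k + dir e) j : ℤ) : ℝ)) := by
            calc ω = ω / ℓ * ℓ := by field_simp
              _ ≤ _ := mul_le_mul_of_nonneg_left hcl (by positivity)
          linarith)
    (fun k hk t ht htT _ _ => by
      obtain ⟨w, hw, hwi⟩ := hder k ((hS k).1 hk).1 t ht htT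
      have hB : HasDerivAt (Bar k) (2 * ω * (Real.exp (-(lam / ℓ ^ 2) * t) * (-(lam / ℓ ^ 2))) * cs (k i - k j) + C1) t := by
        have h1 : HasDerivAt (fun t => Real.exp (-(lam / ℓ ^ 2) * t)) (Real.exp (-(lam / ℓ ^ 2) * t) * (-(lam / ℓ ^ 2))) t := by
          simpa using ((hasDerivAt_id t).const_mul (-(lam / ℓ ^ 2))).exp
        have h2 : HasDerivAt (fun t => C1 * t) C1 t := by simpa using (hasDerivAt_id t).const_mul C1
        exact (((h1.const_mul (2 * ω)).mul_const _).add_const _ |>.add_const _).add h2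
      refine ⟨_, lam, 0, hw.add hB, hlam.le, by simp, ?_⟩
      rw [Lp_add]
      have h1 := mul_le_mul_of_nonneg_left (hLBar k hk t) hlam.le
      have h2 : lam * (-(1 / ℓ ^ 2) * (2 * ω * Real.exp (-(lam / ℓ ^ 2) * t) * cs (k i - k j)) - C3 / lam)
        = 2 * ω * (Real.exp (-(lam / ℓ ^ 2) * t) * (-(lam / ℓ ^ 2))) * cs (k i - k j) - C3 := by
        field_simp
      rw [h2] at h1
      linarith)
  have hkS : k ∈ S := (hS k).2 ⟨hk, hd0, hd1⟩
  have hfin := key k hkS t ht htT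
  have hd' : (0 : ℝ) ≤ ((k i - k j : ℤ) : ℝ) := by exact_mod_cast hd0.le
  have c1 : cs (k i - k j) ≤ 1 := Real.cos_le_one _
  have c2 : 2 * ω * Real.exp (-(lam / ℓ ^ 2) * t) * cs (k i - k j) ≤ 2 * ω * Real.exp (-(lam / ℓ ^ 2) * t) * 1 :=
    mul_le_mul_of_nonneg_left c1 (by positivity)
  have c3 : φ (k i - k j) ≤ ω / ℓ * (h * ((k i - k j : ℤ) : ℝ)) + 2 * K4 * ℓ * (h * ((k i - k j : ℤ) : ℝ)) := by
    simp only [hφ]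
    have : 0 ≤ K4 * (h * ((k i - k j : ℤ) : ℝ)) ^ 2 := by positivity
    nlinarith
  simp only [hBar] at hfin
  linarith

end FW

namespace FW
variable {ι : Type*} [Fintype ι] [DecidableEq ι]

theorem Lp_option (i : ι) (h : ℝ) (f g : (ι → ℤ) → ℝ) (k : Option ι → ℤ) :
    Lp h (fun k : Option ι → ℤ => f (fun m => k (some m)) -
      g (Function.update (fun m => k (some m)) i (k none))) k
    = Lp h f (fun m => k (some m)) - Lp h g (Function.update (fun m => k (some m)) i (k none)) := by
  rw [Lp_eq, Lp_eq, Lp_eq, ← sub_div]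
  congr 1
  set x : ι → ℤ := fun m => k (some m) with hx
  set y : ι → ℤ := Function.update x i (k none) with hy
  rw [Fintype.sum_option]
  have e1 : ∀ m : ι, (fun l => (k + Pi.single (some m) 1 : Option ι → ℤ) (some l)) = x + Pi.single m 1 := by
    intro m; funext l
    by_cases hl : l = m
    · subst hl; simp [hx]
    · simp [hx, Pi.single_eq_of_ne hl, Pi.single_eq_of_ne (show some l ≠ some m from fun hh => hl (Option.some.inj hh))]
  have e2 : ∀ m : ι, (fun l => (k - Pi.single (some m) 1 : Option ι → ℤ) (some l)) = x - Pi.single m 1 := by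
    intro m; funext l
    by_cases hl : l = m
    · subst hl; simp [hx]
    · simp [hx, Pi.single_eq_of_ne hl, Pi.single_eq_of_ne (show some l ≠ some m from fun hh => hl (Option.some.inj hh))]
  have e3 : (fun l => (k + Pi.single none 1 : Option ι → ℤ) (some l)) = x := by
    funext l; simp [hx]
  have e4 : (fun l => (k - Pi.single none 1 : Option ι → ℤ) (some l)) = x := by
    funext l; simp [hx]
  have n1 : ∀ m : ι, (k + Pi.single (some m) 1 : Option ι → ℤ) none = k none := by intro m; simp
  have n2 : ∀ m : ι, (k - Pi.single (some m) 1 : Option ι → ℤ) none = k none := by intro m; simp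
  have n3 : (k + Pi.single none 1 : Option ι → ℤ) none = k none + 1 := by simp
  have n4 : (k - Pi.single none 1 : Option ι → ℤ) none = k none - 1 := by simp
  simp only [e1, e2, e3, e4, n1, n2, n3, n4]
  have u1 : Function.update x i (k none + 1) = y + Pi.single i 1 := by
    funext l; by_cases hl : l = i
    · subst hl; simp [hy]
    · simp [hy, hl]
  have u2 : Function.update x i (k none - 1) = y - Pi.single i 1 := by
    funext l; by_cases hl : l = i
    · subst hl; simp [hy]
    · simp [hy, hl]
  have u3 : Function.update (x + Pi.single i 1) i (k none) = y := by
    funext l; by_cases hl : l = i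
    · subst hl; simp [hy]
    · simp [hy, hl]
  have u4 : Function.update (x - Pi.single i 1) i (k none) = y := by
    funext l; by_cases hl : l = i
    · subst hl; simp [hy]
    · simp [hy, hl]
  have u5 : ∀ m, m ≠ i → Function.update (x + Pi.single m 1) i (k none) = y + Pi.single m 1 := by
    intro m hm; funext l; by_cases hl : l = i
    · subst hl; simp [hy, Pi.single_eq_of_ne (Ne.symm hm)]
    · simp [hy, hl]
  have u6 : ∀ m, m ≠ i → Function.update (x - Pi.single m 1) i (k none) = y - Pi.single m 1 := by
    intro m hm; funext l; by_cases hl : l = i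
    · subst hl; simp [hy, Pi.single_eq_of_ne (Ne.symm hm)]
    · simp [hy, hl]
  have hp := fun F : ι → ℝ => (Finset.add_sum_erase Finset.univ F (Finset.mem_univ i)).symm
  rw [hp (fun m => _ - _), hp (fun m => f _ + _ - _), hp (fun m => g _ + _ - _), u1, u2, u3, u4]
  have hs : ∑ m ∈ Finset.univ.erase i, (f (x + Pi.single m 1) - g (Function.update (x + Pi.single m 1) i (k none))
        + (f (x - Pi.single m 1) - g (Function.update (x - Pi.single m 1) i (k none))) - 2 * (f x - g y))
      = ∑ m ∈ Finset.univ.erase i, (f (x + Pi.single m 1) + f (x - Pi.single m 1) - 2 * f x)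
       - ∑ m ∈ Finset.univ.erase i, (g (y + Pi.single m 1) + g (y - Pi.single m 1) - 2 * g y) := by
    rw [← Finset.sum_sub_distrib]
    refine Finset.sum_congr rfl fun m hm => ?_
    rw [u5 m (Finset.ne_of_mem_erase hm), u6 m (Finset.ne_of_mem_erase hm)]; ring
  rw [hs]; ring

theorem dd_u (i : ι) (h ℓ ρ T lam ω C1 C3 : ℝ) (hh : 0 < h) (hℓ : 2 * h ≤ ℓ)
    (hρ : 0 < ρ) (hT : 0 ≤ T) (hlam : 0 < lam) (hω : 0 ≤ ω) (hC1 : 0 ≤ C1) (hC3 : 0 ≤ C3)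
    (f : (ι → ℤ) → ℝ → ℝ) (g : (ι → ℤ) → ℝ)
    (hcont : ∀ k, (∀ m, |h * (k m : ℝ)| < ρ) → ContinuousOn (f k) (Icc 0 T))
    (hlow : ∀ x y, (∀ m, |h * (x m : ℝ)| < ρ + h) → (∀ m, |h * (y m : ℝ)| < ρ + h) →
      ∀ t, 0 ≤ t → t ≤ T → -ω ≤ f x t - g y)
    (hdiag : ∀ x, (∀ m, |h * (x m : ℝ)| < ρ + h) → ∀ t, 0 ≤ t → t ≤ T → -(C1 * t) ≤ f x t - g x)
    (hder : ∀ x y, (∀ m, |h * (x m : ℝ)| < ρ) → (∀ m, |h * (y m : ℝ)| < ρ) → ∀ t, 0 < t → t ≤ T →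
      ∃ w, HasDerivAt (f x) w t ∧ lam * (Lp h (fun m => f m t) x - Lp h g y) - C3 ≤ w)
    (x : ι → ℤ) (b : ℤ) (hx : ∀ m, |h * (x m : ℝ)| < ρ) (hb : |h * (b : ℝ)| < ρ)
    (hd1 : h * |(x i : ℝ) - b| < ℓ) (t : ℝ) (ht : 0 ≤ t) (htT : t ≤ T) :
    g (Function.update x i b) - (2 * ω * Real.exp (-(lam / ℓ ^ 2) * t) + ω / ℓ * (h * |(x i : ℝ) - b|)
      + ω / ρ ^ 2 * (nsq h x + (h * (b : ℝ)) ^ 2)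
      + 2 * ((ω * (2 * (Fintype.card ι + 1)) / ρ ^ 2 + C3 / lam) / 4) * ℓ * (h * |(x i : ℝ) - b|) + C1 * t)
      ≤ f x t := by
  have hℓ0 : 0 < ℓ := by linarith
  set k : Option ι → ℤ := fun o => o.elim b x with hk
  have kx : (fun m => k (some m)) = x := by funext m; simp [hk]
  have kn : k none = b := by simp [hk]
  set W : (Option ι → ℤ) → ℝ → ℝ := fun k t => f (fun m => k (some m)) t -
      g (Function.update (fun m => k (some m)) i (k none)) with hW
  have hupd : ∀ (r : ℝ) (k : Option ι → ℤ), (∀ m, |h * (k m : ℝ)| < r) →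
      ∀ m, |h * ((Function.update (fun m => k (some m)) i (k none)) m : ℝ)| < r := by
    intro r k hk m
    by_cases hm : m = i
    · subst hm; simpa using hk none
    · simpa [hm] using hk (some m)
  have hnsq : nsq h k = nsq h x + (h * (b : ℝ)) ^ 2 := by
    unfold nsq
    rw [Fintype.sum_option]; simp [hk]; ring
  have hkc : ∀ m, |h * (k m : ℝ)| < ρ := by
    intro m; cases m with
    | none => simpa [hk] using hb
    | some m => simpa [hk] using hx m
  have hgen := fun (i' j' : Option ι) (hij : i' ≠ j') (hsame : ∀ k : Option ι → ℤ, k i' = k j' → k (some i) = k none) =>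
    dd i' j' hij h ℓ ρ T lam ω C1 C3 hh hℓ hρ hT hlam hω hC1 hC3 W
    (fun k hk => (hcont _ (fun m => hk (some m))).sub continuousOn_const)
    (fun k hk t ht htT => hlow _ _ (fun m => hk (some m)) (hupd _ k hk) t ht htT)
    (fun k hk he t ht htT => by
      have h1 := hdiag _ (fun m => hk (some m)) t ht htT
      have h2 : Function.update (fun m => k (some m)) i (k none) = fun m => k (some m) := by
        rw [← hsame k he]; exact Function.update_eq_self i (fun m => k (some m))
      simp only [hW]; rw [h2]; exact h1)
    (fun k hk t ht htT => by
      obtain ⟨w, hw, hi⟩ := hder _ _ (fun m => hk (some m)) (hupd _ k hk) t ht htT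
      refine ⟨w, hw.sub_const _, ?_⟩
      have := Lp_option i h (fun m => f m t) g k
      simp only [hW]; rw [this]; exact hi)
    k hkc
  have hcard : (Fintype.card (Option ι) : ℝ) = Fintype.card ι + 1 := by simp
  have hWk : W k t = f x t - g (Function.update x i b) := by simp only [hW, kx, kn]
  rcases lt_trichotomy (x i) b with hlt | heq | hgt
  · have e : |(x i : ℝ) - b| = ((k none - k (some i) : ℤ) : ℝ) := by
      have : (x i : ℝ) < b := by exact_mod_cast hlt
      rw [abs_of_neg (by linarith)]; simp [hk]
    rw [e] at hd1 ⊢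
    have := hgen none (some i) (by simp) (fun k hk => hk.symm) (by simp [hk]; exact hlt) hd1 t ht htT
    rw [hcard, hnsq, hWk] at this
    linarith
  · subst heq
    have h1 := hdiag x (fun m => by linarith [hx m]) t ht htT
    simp only [Function.update_eq_self, sub_self, abs_zero, mul_zero, add_zero]
    have : 0 ≤ 2 * ω * Real.exp (-(lam / ℓ ^ 2) * t) := by positivity
    have : 0 ≤ ω / ρ ^ 2 * (nsq h x + (h * (x i : ℝ)) ^ 2) :=
      mul_nonneg (by positivity) (add_nonneg (nsq_nonneg h x) (sq_nonneg _))
    linarith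
  · have e : |(x i : ℝ) - b| = ((k (some i) - k none : ℤ) : ℝ) := by
      have : (b : ℝ) < x i := by exact_mod_cast hgt
      rw [abs_of_pos (by linarith)]; simp [hk]
    rw [e] at hd1 ⊢
    have := hgen (some i) none (by simp) (fun k hk => hk) (by simp [hk]; exact hgt) hd1 t ht htT
    rw [hcard, hnsq, hWk] at this
    linarith

/-- Elliptic gradient estimate. -/
theorem elliptic_grad (h r M N : ℝ) (hh : 0 < h) (hhr : 4 * h ≤ r) (hM : 0 ≤ M) (hN : 0 ≤ N)
    (v : (ι → ℤ) → ℝ) (hv : ∀ k, (∀ m, |h * (k m : ℝ)| < r) → |v k| ≤ M)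
    (hL : ∀ k, (∀ m, |h * (k m : ℝ)| < r) → |Lp h v k| ≤ N) (e : ι × Bool) :
    |Dq h e v 0| ≤ (8 * Fintype.card ι + 20) * M / r + r * N := by
  have hr : 0 < r := by linarith
  set ℓ := r / 2 with hℓ
  set ρ := r / 2 with hρ
  have hρ0 : 0 < ρ := by positivity
  set nn : ℝ := (Fintype.card ι : ℝ) with hnn
  have hnn0 : 0 ≤ nn := by positivity
  have gen : ∀ (x : ι → ℤ) (b : ℤ), (∀ m, |h * (x m : ℝ)| < ρ) → |h * (b : ℝ)| < ρ →
      nsq h x + (h * (b : ℝ)) ^ 2 ≤ h ^ 2 → |(x e.1 : ℝ) - b| = 1 →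
      v (Function.update x e.1 b) - v x ≤ h * ((8 * nn + 20) * M / r + r * N) := by
    intro x b hx hb hsq hdist
    have key := fun T (hT : 0 ≤ T) => dd_u e.1 h ℓ ρ T 1 (2 * M) 0 (2 * N) hh (by linarith) hρ0 hT one_pos (by linarith) le_rfl
      (by linarith) (fun k _ => v k) v (fun k _ => continuousOn_const)
      (fun x y hx hy t _ _ => by
        have h1 := abs_le.mp (hv x (fun m => by linarith [hx m]))
        have h2 := abs_le.mp (hv y (fun m => by linarith [hy m]))
        linarith)
      (fun x hx t _ _ => by simp)
      (fun x y hx hy t _ _ => ⟨0, hasDerivAt_const _ _, by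
        have h1 := abs_le.mp (hL x (fun m => by linarith [hx m]))
        have h2 := abs_le.mp (hL y (fun m => by linarith [hy m]))
        linarith⟩) x b hx hb (by rw [hdist]; linarith) T hT le_rfl
    have lim : Tendsto (fun T : ℝ => 2 * (2 * M) * Real.exp (-(1 / ℓ ^ 2) * T)) atTop (nhds (2 * (2 * M) * 0)) := by
      apply Tendsto.const_mul
      apply Real.tendsto_exp_atBot.comp
      apply Filter.Tendsto.const_mul_atTop_of_neg _ tendsto_id
      have : 0 < 1 / ℓ ^ 2 := by positivity
      linarith
    have key2 : v (Function.update x e.1 b) - v x - (2 * M / ℓ * h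
      + 2 * M / ρ ^ 2 * (nsq h x + (h * (b : ℝ)) ^ 2)
      + 2 * ((2 * M * (2 * (nn + 1)) / ρ ^ 2 + 2 * N / 1) / 4) * ℓ * h) ≤ 2 * (2 * M) * 0 := by
      refine ge_of_tendsto lim ?_
      filter_upwards [eventually_ge_atTop 0] with T hT
      have := key T hT
      rw [hdist, mul_one] at this
      linarith
    have h1 : 2 * M / ρ ^ 2 * (nsq h x + (h * (b : ℝ)) ^ 2) ≤ 2 * M / ρ ^ 2 * h ^ 2 :=
      mul_le_mul_of_nonneg_left hsq (by positivity)
    have h2 : 2 * M / ρ ^ 2 * h ^ 2 ≤ 2 * M / r * h := by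
      rw [hρ]
      have : 2 * M / (r / 2) ^ 2 * h ^ 2 = (8 * M * h / r ^ 2) * h := by field_simp; ring
      rw [this]
      apply mul_le_mul_of_nonneg_right _ hh.le
      rw [div_le_div_iff₀ (by positivity) hr]
      nlinarith [mul_nonneg hM hr.le]
    have h3 : 2 * M / ℓ * h = 4 * M / r * h := by rw [hℓ]; field_simp; ring
    have h4 : 2 * ((2 * M * (2 * (nn + 1)) / ρ ^ 2 + 2 * N / 1) / 4) * ℓ * h
        = (4 * (nn + 1) * M / r + r * N / 2) * h := by rw [hρ]; field_simp; ring
    have h5 : 0 ≤ M / r := by positivity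
    have h6 : h * ((8 * nn + 20) * M / r + r * N) = ((8 * nn + 20) * (M / r) + r * N) * h := by ring
    rw [h6]
    have h7 : (2 * M / r + 4 * M / r + (4 * (nn + 1) * M / r + r * N / 2)) * h ≤ ((8 * nn + 20) * (M / r) + r * N) * h := by
      apply mul_le_mul_of_nonneg_right _ hh.le
      have : 0 ≤ r * N := by positivity
      have e1 : 2 * M / r + 4 * M / r + (4 * (nn + 1) * M / r + r * N / 2) = (4 * nn + 10) * (M / r) + r * N / 2 := by ring
      rw [e1]; nlinarith
    linarith
  have hdirn : ∀ m, |h * ((dir e) m : ℝ)| ≤ h := by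
    intro m
    rw [abs_mul, abs_of_pos hh]
    have h2 : |(dir e m : ℝ)| ≤ 1 := by exact_mod_cast dir_bound e m
    nlinarith
  have hdire : |(dir e e.1 : ℝ)| = 1 := by
    rw [dir_apply]; simp; split_ifs <;> simp
  have hnsqd : nsq h (dir e) = h ^ 2 := by
    unfold nsq
    rw [Finset.sum_eq_single e.1]
    · rw [← sq_abs, abs_mul, hdire, mul_one, sq_abs]
    · intro m _ hm; simp [dir_apply, hm]
    · simp
  have hu1 : Function.update (0 : ι → ℤ) e.1 (dir e e.1) = dir e := by
    funext m; by_cases hm : m = e.1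
    · subst hm; simp
    · simp [hm, dir_apply]
  have hu2 : Function.update (dir e) e.1 0 = 0 := by
    funext m; by_cases hm : m = e.1
    · subst hm; simp
    · simp [hm, dir_apply]
  have g1 := gen 0 (dir e e.1) (fun m => by simpa using hρ0) (by linarith [hdirn e.1])
    (by
      have : nsq h (0 : ι → ℤ) = 0 := by simp [nsq]
      rw [this, ← hnsqd]; simpa using le_nsq h (dir e) e.1) (by simpa using hdire)
  have g2 := gen (dir e) 0 (fun m => by linarith [hdirn m]) (by simpa using hρ0)
    (by rw [hnsqd]; simp) (by simpa using hdire)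
  rw [hu1] at g1
  rw [hu2] at g2
  unfold Dq
  rw [zero_add, abs_div, abs_of_pos hh, div_le_iff₀ hh, abs_le]
  constructor <;> linarith

end FW

namespace FW
variable {ι : Type*} [Fintype ι] [DecidableEq ι]

/-- One-coordinate step of the weak-Harnack chain, on the unit cylinder. -/
theorem osc_chain_step (alo ahi C h ω mm ℓ ε N θ : ℝ) (halo : 0 < alo) (hah : alo ≤ ahi) (hC : 0 ≤ C)
    (hω : 0 ≤ ω) (hN : N = (Fintype.card ι : ℝ) + 1) (hθ : θ = 1 / (2 * N))
    (hℓ0 : 0 < ℓ) (hℓ1 : ℓ ≤ 1) (hℓ2 : 64 * N ^ 2 * ℓ ^ 2 ≤ alo) (hε : ε = ℓ / (128 * N ^ 2))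
    (hh : 0 < h) (hh1 : h ≤ ε / 4) (u a : (ι → ℤ) → ℝ → ℝ)
    (hd : ∀ k, (∀ i, |h * (k i : ℝ)| < 1) → ∀ t, 0 ≤ t → t ≤ 1 →
      HasDerivAt (u k) (a k t * Lp h (fun j => u j t) k) t)
    (ha : ∀ k, (∀ i, |h * (k i : ℝ)| < 1) → ∀ t, 0 ≤ t → t ≤ 1 → alo ≤ a k t ∧ a k t ≤ ahi)
    (hL : ∀ k, (∀ i, |h * (k i : ℝ)| < 1) → ∀ t, 0 ≤ t → t ≤ 1 → -C ≤ Lp h (fun j => u j t) k)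
    (hu : ∀ k, (∀ i, |h * (k i : ℝ)| < 1) → ∀ t, 0 ≤ t → t ≤ 1 → mm ≤ u k t ∧ u k t ≤ mm + ω)
    (i : ι) (x : ι → ℤ) (b : ℤ) (hx : ∀ m, |h * (x m : ℝ)| < ε) (hb : |h * (b : ℝ)| < ε)
    (t : ℝ) (ht : θ ≤ t) (ht1 : t ≤ 1) :
    u (Function.update x i b) (t - θ) - (ω / (4 * N) + ahi * C * (1 + 1 / alo)) ≤ u x t := by
  have hN1 : 1 ≤ N := by rw [hN]; linarith [Nat.cast_nonneg (α := ℝ) (Fintype.card ι)]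
  have hN0 : 0 < N := by linarith
  have hahi : 0 < ahi := by linarith
  have hθ0 : 0 < θ := by rw [hθ]; positivity
  have hθ1 : θ ≤ 1 := by rw [hθ, div_le_one (by positivity)]; linarith
  have hε0 : 0 < ε := by rw [hε]; positivity
  have hεℓ : ε * (128 * N ^ 2) = ℓ := by rw [hε]; field_simp
  have hN2 : N ≤ N ^ 2 := by nlinarith
  have hε2 : ε ≤ ℓ / 128 := by
    have : 128 * ε ≤ ε * (128 * N ^ 2) := by nlinarith
    linarith
  have hmono : ∀ k, (∀ m, |h * (k m : ℝ)| < 1) → ∀ s r, 0 ≤ s → 0 ≤ r → s + r ≤ 1 →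
      -(ahi * C * r) ≤ u k (s + r) - u k s := by
    intro k hk s r hs hr hsr
    rcases eq_or_lt_of_le hr with h0 | h0
    · rw [← h0]; simp
    have hcont : ContinuousOn (u k) (Icc s (s + r)) := fun τ hτ =>
      (hd k hk τ (by linarith [hτ.1]) (by linarith [hτ.2])).continuousAt.continuousWithinAt
    obtain ⟨ξ, hξ, hξe⟩ := exists_hasDerivAt_eq_slope (u k) (fun τ => a k τ * Lp h (fun j => u j τ) k)
      (by linarith : s < s + r) hcont
      (fun τ hτ => hd k hk τ (by linarith [hτ.1]) (by linarith [hτ.2]))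
    have h1 := ha k hk ξ (by linarith [hξ.1]) (by linarith [hξ.2])
    have h2 := hL k hk ξ (by linarith [hξ.1]) (by linarith [hξ.2])
    have h3 : -(ahi * C) ≤ a k ξ * Lp h (fun j => u j ξ) k := by nlinarith
    rw [hξe, le_div_iff₀ (by linarith)] at h3
    nlinarith
  have key := dd_u i h ℓ (1/2) θ alo ω (ahi * C) (ahi * C) hh (by linarith) (by norm_num) hθ0.le halo hω
    (by positivity) (by positivity) (fun k r => u k (t - θ + r)) (fun k => u k (t - θ))
    (fun k hk r hr => by
      have h1 := hd k (fun m => by linarith [hk m]) (t - θ + r) (by linarith [hr.1]) (by linarith [hr.2])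
      exact (h1.comp_const_add (t - θ) r).continuousAt.continuousWithinAt)
    (fun x y hx hy r hr hr' => by
      have h1 := hu x (fun m => by linarith [hx m]) (t - θ + r) (by linarith) (by linarith)
      have h2 := hu y (fun m => by linarith [hy m]) (t - θ) (by linarith) (by linarith)
      linarith)
    (fun x hx r hr hr' => hmono x (fun m => by linarith [hx m]) (t - θ) r (by linarith) hr (by linarith))
    (fun x y hx hy r hr hr' => by
      have hx' : ∀ m, |h * (x m : ℝ)| < 1 := fun m => by linarith [hx m]
      have hy' : ∀ m, |h * (y m : ℝ)| < 1 := fun m => by linarith [hy m]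
      refine ⟨_, (hd x hx' (t - θ + r) (by linarith) (by linarith)).comp_const_add (t - θ) r, ?_⟩
      have h1 := ha x hx' (t - θ + r) (by linarith) (by linarith)
      have h2 := hL x hx' (t - θ + r) (by linarith) (by linarith)
      have h3 := hL y hy' (t - θ) (by linarith) (by linarith)
      nlinarith)
    x b (fun m => by linarith [hx m]) (by linarith)
    (by
      have h1 := hx i
      have h2 : h * |(x i : ℝ) - b| = |h * (x i : ℝ) - h * b| := by
        rw [← mul_sub, abs_mul, abs_of_pos hh]
      rw [h2]
      have := abs_sub (h * (x i : ℝ)) (h * b)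
      linarith) θ hθ0.le le_rfl
  simp only [sub_add_cancel] at key
  have hdist : h * |(x i : ℝ) - b| ≤ 2 * ε := by
    have h1 := hx i
    have h2 : h * |(x i : ℝ) - b| = |h * (x i : ℝ) - h * b| := by
      rw [← mul_sub, abs_mul, abs_of_pos hh]
    rw [h2]
    have := abs_sub (h * (x i : ℝ)) (h * b)
    linarith
  have hdist0 : 0 ≤ h * |(x i : ℝ) - b| := by positivity
  have e1 : 2 * ω * Real.exp (-(alo / ℓ ^ 2) * θ) ≤ ω / (16 * N) := by
    have h1 : 32 * N ≤ alo / ℓ ^ 2 * θ := by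
      rw [hθ, div_mul_div_comm, le_div_iff₀ (by positivity)]
      nlinarith
    have h2 : Real.exp (-(alo / ℓ ^ 2) * θ) ≤ 1 / (32 * N) := by
      rw [neg_mul, Real.exp_neg, ← one_div]
      apply one_div_le_one_div_of_le (by positivity)
      linarith [Real.add_one_le_exp (alo / ℓ ^ 2 * θ)]
    calc 2 * ω * Real.exp (-(alo / ℓ ^ 2) * θ) ≤ 2 * ω * (1 / (32 * N)) := mul_le_mul_of_nonneg_left h2 (by positivity)
      _ = ω / (16 * N) := by field_simp; ring
  have e2 : ω / ℓ * (h * |(x i : ℝ) - b|) ≤ ω / (16 * N) := by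
    have h1 : (h * |(x i : ℝ) - b|) / ℓ ≤ 1 / (16 * N) := by
      rw [div_le_div_iff₀ hℓ0 (by positivity)]
      nlinarith
    calc ω / ℓ * (h * |(x i : ℝ) - b|) = ω * ((h * |(x i : ℝ) - b|) / ℓ) := by ring
      _ ≤ ω * (1 / (16 * N)) := mul_le_mul_of_nonneg_left h1 hω
      _ = _ := by ring
  have hεN : ε * N ≤ 1 / 128 := by nlinarith
  have e3 : ω / (1/2) ^ 2 * (nsq h x + (h * (b : ℝ)) ^ 2) ≤ ω / (16 * N) := by
    have h1 : nsq h x ≤ (N - 1) * ε ^ 2 := by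
      unfold nsq
      calc ∑ i, (h * (x i : ℝ)) ^ 2 ≤ ∑ i : ι, ε ^ 2 := Finset.sum_le_sum fun i _ => by
            rw [← sq_abs]; exact pow_le_pow_left₀ (abs_nonneg _) (hx i).le 2
        _ = (N - 1) * ε ^ 2 := by rw [hN]; simp
    have h2 : (h * (b : ℝ)) ^ 2 ≤ ε ^ 2 := by
      rw [← sq_abs]; exact pow_le_pow_left₀ (abs_nonneg _) hb.le 2
    have h3 : 4 * (nsq h x + (h * (b : ℝ)) ^ 2) ≤ 1 / (16 * N) := by
      rw [le_div_iff₀ (by positivity)]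
      have : 4 * (nsq h x + (h * (b : ℝ)) ^ 2) * (16 * N) ≤ 64 * (ε * N) ^ 2 := by nlinarith
      nlinarith [mul_pos hε0 hN0]
    calc ω / (1/2) ^ 2 * (nsq h x + (h * (b : ℝ)) ^ 2) = ω * (4 * (nsq h x + (h * (b : ℝ)) ^ 2)) := by ring
      _ ≤ ω * (1 / (16 * N)) := mul_le_mul_of_nonneg_left h3 hω
      _ = _ := by ring
  have e4 : 2 * ((ω * (2 * (Fintype.card ι + 1)) / (1/2) ^ 2 + ahi * C / alo) / 4) * ℓ * (h * |(x i : ℝ) - b|)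
      ≤ ω / (16 * N) + ahi * C * (1 / alo) := by
    rw [← hN]
    have h0 : ℓ * (h * |(x i : ℝ) - b|) ≤ 2 * ε := by nlinarith
    have h1 : 0 ≤ ω * N * 4 + ahi * C / alo / 2 := by positivity
    have h2 : 2 * ((ω * (2 * N) / (1/2) ^ 2 + ahi * C / alo) / 4) * ℓ * (h * |(x i : ℝ) - b|)
      = (ω * N * 4 + ahi * C / alo / 2) * (ℓ * (h * |(x i : ℝ) - b|)) := by ring
    rw [h2]
    have h3 := mul_le_mul_of_nonneg_left h0 h1
    have h4 : ω * N * 4 * (2 * ε) ≤ ω / (16 * N) := by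
      rw [le_div_iff₀ (by positivity)]
      have : ε * N ^ 2 * 128 ≤ 1 := by linarith
      nlinarith
    have h5 : ahi * C / alo / 2 * (2 * ε) ≤ ahi * C * (1 / alo) := by
      have : 0 ≤ ahi * C * (1 / alo) := by positivity
      have e : ahi * C / alo / 2 * (2 * ε) = ahi * C * (1 / alo) * ε := by ring
      rw [e]; nlinarith
    nlinarith
  have e5 : ahi * C * θ ≤ ahi * C := by
    have : 0 ≤ ahi * C := by positivity
    nlinarith
  have e6 : ω / (4 * N) = ω / (16 * N) + ω / (16 * N) + ω / (16 * N) + ω / (16 * N) := by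
    field_simp; ring
  rw [e6]
  linarith

theorem osc_unit (alo ahi : ℝ) (halo : 0 < alo) (hah : alo ≤ ahi) :
    ∃ c κ C' : ℝ, 0 < c ∧ c < 1 ∧ 0 < κ ∧ κ ≤ 1 / 2 ∧ 0 ≤ C' ∧
    ∀ (C h ω mm : ℝ) (u a : (ι → ℤ) → ℝ → ℝ), 0 ≤ C → 0 ≤ ω → 0 < h → h ≤ κ / 2 →
    (∀ k, (∀ i, |h * (k i : ℝ)| < 1) → ∀ t, 0 ≤ t → t ≤ 1 →
      HasDerivAt (u k) (a k t * Lp h (fun j => u j t) k) t) →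
    (∀ k, (∀ i, |h * (k i : ℝ)| < 1) → ∀ t, 0 ≤ t → t ≤ 1 → alo ≤ a k t ∧ a k t ≤ ahi) →
    (∀ k, (∀ i, |h * (k i : ℝ)| < 1) → ∀ t, 0 ≤ t → t ≤ 1 → -C ≤ Lp h (fun j => u j t) k) →
    (∀ k, (∀ i, |h * (k i : ℝ)| < 1) → ∀ t, 0 ≤ t → t ≤ 1 → mm ≤ u k t ∧ u k t ≤ mm + ω) →
    ∃ m', ∀ k, (∀ i, |h * (k i : ℝ)| < κ) → ∀ t, 1 - κ ^ 2 ≤ t → t ≤ 1 →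
      m' ≤ u k t ∧ u k t ≤ m' + ((1 - c) * ω + C' * C) := by
  set N : ℝ := (Fintype.card ι : ℝ) + 1 with hN
  have hN1 : 1 ≤ N := by rw [hN]; linarith [Nat.cast_nonneg (α := ℝ) (Fintype.card ι)]
  have hN0 : 0 < N := by linarith
  have hahi : 0 < ahi := by linarith
  set ℓ := min 1 (Real.sqrt alo / (8 * N)) with hℓ
  have hℓ0 : 0 < ℓ := lt_min one_pos (by positivity)
  have hℓ1 : ℓ ≤ 1 := min_le_left _ _
  have hℓ2 : 64 * N ^ 2 * ℓ ^ 2 ≤ alo := by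
    have h1 : ℓ * (8 * N) ≤ Real.sqrt alo := (le_div_iff₀ (by positivity)).mp (min_le_right _ _)
    calc 64 * N ^ 2 * ℓ ^ 2 = (ℓ * (8 * N)) ^ 2 := by ring
      _ ≤ (Real.sqrt alo) ^ 2 := pow_le_pow_left₀ (by positivity) h1 2
      _ = alo := Real.sq_sqrt halo.le
  set ε := ℓ / (128 * N ^ 2) with hε
  have hε0 : 0 < ε := by positivity
  have hε1 : ε ≤ 1 / 128 := by
    rw [hε, div_le_iff₀ (by positivity)]; nlinarith
  set θ := 1 / (2 * N) with hθ
  have hθ0 : 0 < θ := by positivity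
  have hθ1 : θ ≤ 1 / 2 := by rw [hθ, div_le_div_iff₀ (by positivity) (by norm_num)]; linarith
  set K := ahi * Fintype.card ι * (π / (2 * ε)) ^ 2 with hK
  set c := (1 / 4) * Real.exp (-K) * (1 / 2) ^ (Fintype.card ι) with hc
  have hK0 : 0 ≤ K := by positivity
  have hc0 : 0 < c := by positivity
  have hc1 : c ≤ 1 / 4 := by
    have h1 : Real.exp (-K) ≤ 1 := Real.exp_le_one_iff.mpr (by linarith)
    have h2 : (1 / 2 : ℝ) ^ (Fintype.card ι) ≤ 1 := pow_le_one₀ (by norm_num) (by norm_num)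
    have h3 : 0 < Real.exp (-K) := Real.exp_pos _
    have h4 : (0 : ℝ) < (1 / 2 : ℝ) ^ (Fintype.card ι) := by positivity
    rw [hc]; nlinarith [mul_le_one₀ h1 h4.le h2]
  refine ⟨c, ε / 2, N * (ahi * (1 + 1 / alo)), hc0, by linarith, by linarith, by linarith, by positivity, ?_⟩
  intro C h ω mm u a hC hω hh hh1 hd ha hL hu
  have hh2 : h ≤ ε / 4 := by linarith
  set E := ω / (4 * N) + ahi * C * (1 + 1 / alo) with hE
  have hE0 : 0 ≤ E := by positivity
  have hNE : N * E = ω / 4 + N * (ahi * (1 + 1 / alo)) * C := by rw [hE]; field_simp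
  by_cases hcase : ∃ y : ι → ℤ, (∀ i, |h * (y i : ℝ)| < ε) ∧ mm + 3 / 4 * ω ≤ u y 0
  · obtain ⟨y, hy, hy0⟩ := hcase
    have chain : ∀ (x : ι → ℤ), (∀ i, |h * (x i : ℝ)| < ε) → ∀ A : Finset ι, ∀ t, A.card * θ ≤ t → t ≤ 1 →
        u y 0 - (A.card + 1) * E ≤ u (fun m => if m ∈ A then x m else y m) t := by
      intro x hx A
      induction A using Finset.induction_on with
      | empty =>
        intro t ht ht1
        simp only [Finset.card_empty, Nat.cast_zero, zero_mul, zero_add, one_mul, Finset.notMem_empty, if_false] at ht ⊢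
        rcases eq_or_lt_of_le ht with h0 | h0
        · rw [← h0]; linarith
        have hy1 : ∀ m, |h * (y m : ℝ)| < 1 := fun m => by linarith [hy m]
        have hcont : ContinuousOn (u y) (Icc 0 t) := fun τ hτ =>
          (hd y hy1 τ hτ.1 (hτ.2.trans ht1)).continuousAt.continuousWithinAt
        obtain ⟨ξ, hξ, hξe⟩ := exists_hasDerivAt_eq_slope (u y) (fun τ => a y τ * Lp h (fun j => u j τ) y)
          h0 hcont (fun τ hτ => hd y hy1 τ hτ.1.le (hτ.2.le.trans ht1))
        have h1 := ha y hy1 ξ hξ.1.le (hξ.2.le.trans ht1)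
        have h2 := hL y hy1 ξ hξ.1.le (hξ.2.le.trans ht1)
        have h3 : -(ahi * C) ≤ a y ξ * Lp h (fun j => u j ξ) y := by nlinarith
        rw [hξe, le_div_iff₀ (by linarith)] at h3
        have h4 : ahi * C ≤ E := by
          have : 0 ≤ ω / (4 * N) := by positivity
          have : 0 ≤ ahi * C * (1 / alo) := by positivity
          rw [hE]; nlinarith
        have : 0 ≤ ahi * C := by positivity
        nlinarith
      | insert i A hiA ih =>
        intro t ht ht1
        rw [Finset.card_insert_of_notMem hiA] at ht ⊢
        push_cast at ht ⊢
        have hθA : 0 ≤ (A.card : ℝ) * θ := by positivity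
        have h1 := ih (t - θ) (by linarith) (by linarith)
        have h2 := osc_chain_step alo ahi C h ω mm ℓ ε N θ halo hah hC hω hN hθ hℓ0 hℓ1 hℓ2 hε hh hh2 u a
          hd ha hL hu i (fun m => if m ∈ insert i A then x m else y m) (y i)
          (fun m => by
            by_cases hm : m ∈ insert i A
            · simp only [hm, if_true]; exact hx m
            · simp only [hm, if_false]; exact hy m) (hy i) t (by linarith) ht1
        have h3 : Function.update (fun m => if m ∈ insert i A then x m else y m) i (y i)
            = fun m => if m ∈ A then x m else y m := by
          funext m
          by_cases hm : m = i
          · subst hm; simp [hiA]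
          · simp [hm]
        rw [h3] at h2
        linarith
    refine ⟨mm + ω / 2 - N * (ahi * (1 + 1 / alo)) * C, fun k hk t ht ht1 => ⟨?_, ?_⟩⟩
    · have h1 := chain k (fun i => by linarith [hk i]) Finset.univ t (by
        rw [Finset.card_univ]
        have : (Fintype.card ι : ℝ) * θ ≤ 1 / 2 := by
          rw [hθ, mul_one_div, div_le_div_iff₀ (by positivity) (by norm_num)]; linarith
        nlinarith) ht1
      simp only [Finset.mem_univ, if_true] at h1
      rw [Finset.card_univ, ← hN, hNE] at h1
      linarith
    · have h1 := (hu k (fun i => by linarith [hk i]) t (by nlinarith) ht1).2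
      have : (1 - c) * ω ≥ ω / 2 := by nlinarith
      linarith
  · push Not at hcase
    have hb := pc_barrier h ε 1 ahi (ω / 4) hh hε0 (by linarith) zero_le_one hahi.le (by positivity)
      (fun k t => mm + ω - u k t) a
      (fun k hk t ht => ((hd k (fun i => by linarith [hk i]) t ht.1 ht.2).const_sub (mm + ω)).continuousAt.continuousWithinAt)
      (fun k hk => by linarith [hcase k hk])
      (fun k hk t ht ht1 => by linarith [(hu k (fun i => by linarith [hk i]) t ht.le ht1).2])
      (fun k hk t ht ht1 => by
        have := ha k (fun i => by linarith [hk i]) t ht.le ht1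
        exact ⟨by linarith, this.2⟩)
      (fun k hk t ht ht1 => by
        have h1 := (hd k (fun i => by linarith [hk i]) t ht.le ht1).const_sub (mm + ω)
        have h2 : Lp h (fun j => mm + ω - u j t) k = - Lp h (fun j => u j t) k := by
          rw [Lp_sub, Lp_const]; ring
        rw [h2, mul_neg]; exact h1)
    refine ⟨mm, fun k hk t ht ht1 => ⟨?_, ?_⟩⟩
    · exact (hu k (fun i => by linarith [hk i]) t (by nlinarith) ht1).1
    · have ht0 : 0 ≤ t := by nlinarith
      have h1 := hb k (fun i => by linarith [hk i]) t ht0 ht1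
      have h2 : (1 / 2 : ℝ) ^ (Fintype.card ι) ≤ ∏ i, Real.cos (π / (2 * ε) * h * (k i : ℝ)) := by
        rw [← Finset.card_univ, ← Finset.prod_const]
        refine Finset.prod_le_prod (fun _ _ => by norm_num) fun i _ => ?_
        apply cos_ge_half
        rw [mul_assoc, abs_mul, abs_of_pos (by positivity)]
        calc π / (2 * ε) * |h * (k i : ℝ)| ≤ π / (2 * ε) * (ε / 2) := mul_le_mul_of_nonneg_left (hk i).le (by positivity)
          _ = π / 4 := by field_simp; ring
          _ ≤ 1 := by linarith [Real.pi_le_four]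
      have h3 : Real.exp (-K) ≤ Real.exp (-K * t) := Real.exp_le_exp.mpr (by nlinarith)
      have h4 : c * ω ≤ ω / 4 * Real.exp (-K * t) * ∏ i, Real.cos (π / (2 * ε) * h * (k i : ℝ)) := by
        calc c * ω = ω / 4 * Real.exp (-K) * (1 / 2) ^ (Fintype.card ι) := by rw [hc]; ring
          _ ≤ _ := by
            apply mul_le_mul _ h2 (by positivity) (by positivity)
            exact mul_le_mul_of_nonneg_left h3 (by positivity)
      have h5 : 0 ≤ N * (ahi * (1 + 1 / alo)) * C := by positivity
      linarith

end FW

namespace FW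
variable {ι : Type*} [Fintype ι] [DecidableEq ι]

theorem Lp_scale (h ρ : ℝ) (hρ : ρ ≠ 0) (f : (ι → ℤ) → ℝ) (k : ι → ℤ) :
    Lp (h / ρ) f k = ρ ^ 2 * Lp h f k := by
  unfold Lp
  rw [div_pow]
  field_simp

theorem osc_small (alo ahi C ω0 R σ : ℝ) (halo : 0 < alo) (hah : alo ≤ ahi) (hC : 0 ≤ C) (hω0 : 0 ≤ ω0)
    (hR : 0 < R) (hσ : 0 < σ) :
    ∃ r h0 : ℝ, 0 < r ∧ r ≤ R ∧ 0 < h0 ∧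
    ∀ (h s1 mm : ℝ) (u a : (ι → ℤ) → ℝ → ℝ), 0 < h → h ≤ h0 →
    (∀ k, (∀ i, |h * (k i : ℝ)| < R) → ∀ t, s1 - R ^ 2 ≤ t → t ≤ s1 →
      HasDerivAt (u k) (a k t * Lp h (fun j => u j t) k) t) →
    (∀ k, (∀ i, |h * (k i : ℝ)| < R) → ∀ t, s1 - R ^ 2 ≤ t → t ≤ s1 → alo ≤ a k t ∧ a k t ≤ ahi) →
    (∀ k, (∀ i, |h * (k i : ℝ)| < R) → ∀ t, s1 - R ^ 2 ≤ t → t ≤ s1 → -C ≤ Lp h (fun j => u j t) k) →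
    (∀ k, (∀ i, |h * (k i : ℝ)| < R) → ∀ t, s1 - R ^ 2 ≤ t → t ≤ s1 → mm ≤ u k t ∧ u k t ≤ mm + ω0) →
    ∃ m', ∀ k, (∀ i, |h * (k i : ℝ)| < r) → ∀ t, s1 - r ^ 2 ≤ t → t ≤ s1 →
      m' ≤ u k t ∧ u k t ≤ m' + σ := by
  obtain ⟨c, κ, C', hc0, hc1, hκ0, hκ1, hC', hunit⟩ := osc_unit (ι := ι) alo ahi halo hah
  set D := C' * C + 1 with hD
  have hD0 : 0 < D := by positivity
  set ρ0 := min R (Real.sqrt (c * σ / (2 * D))) with hρ0d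
  have hρ0 : 0 < ρ0 := lt_min hR (Real.sqrt_pos.mpr (by positivity))
  have hρR : ρ0 ≤ R := min_le_left _ _
  have hρ2 : C' * C * ρ0 ^ 2 ≤ c * σ / 2 := by
    have h1 : ρ0 ^ 2 ≤ c * σ / (2 * D) := by
      calc ρ0 ^ 2 ≤ (Real.sqrt (c * σ / (2 * D))) ^ 2 := pow_le_pow_left₀ hρ0.le (min_le_right _ _) 2
        _ = _ := Real.sq_sqrt (by positivity)
    calc C' * C * ρ0 ^ 2 ≤ D * ρ0 ^ 2 := by apply mul_le_mul_of_nonneg_right _ (by positivity); linarith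
      _ ≤ D * (c * σ / (2 * D)) := mul_le_mul_of_nonneg_left h1 hD0.le
      _ = c * σ / 2 := by field_simp
  obtain ⟨J, hJ⟩ := ((tendsto_pow_atTop_nhds_zero_of_lt_one (by linarith : 0 ≤ 1 - c) (by linarith)).mul_const ω0).eventually
    (gt_mem_nhds (by simpa using half_pos hσ : 0 * ω0 < σ / 2)) |>.exists
  refine ⟨κ ^ J * ρ0, κ ^ J * ρ0 * κ / 2, by positivity, ?_, by positivity, ?_⟩
  · have : κ ^ J ≤ 1 := pow_le_one₀ hκ0.le (by linarith)
    nlinarith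
  intro h s1 mm u a hh hh0 hd ha hL hu
  have claim : ∀ j ≤ J, ∃ m', ∀ k, (∀ i, |h * (k i : ℝ)| < κ ^ j * ρ0) → ∀ t, s1 - (κ ^ j * ρ0) ^ 2 ≤ t → t ≤ s1 →
      m' ≤ u k t ∧ u k t ≤ m' + ((1 - c) ^ j * ω0 + σ / 2) := by
    intro j
    induction j with
    | zero =>
      intro _
      refine ⟨mm, fun k hk t ht ht1 => ?_⟩
      simp only [pow_zero, one_mul] at hk ht ⊢
      have := hu k (fun i => by linarith [hk i]) t (by nlinarith) ht1
      exact ⟨this.1, by linarith [this.2]⟩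
    | succ j ih =>
      intro hjJ
      obtain ⟨m, hm⟩ := ih (by omega)
      set ρ := κ ^ j * ρ0 with hρ
      have hρp : 0 < ρ := by positivity
      have hκj : κ ^ j ≤ 1 := pow_le_one₀ hκ0.le (by linarith)
      have hρle : ρ ≤ ρ0 := by rw [hρ]; nlinarith
      have hρsq : ρ ^ 2 ≤ ρ0 ^ 2 := pow_le_pow_left₀ hρp.le hρle 2
      have hρsqR : ρ ^ 2 ≤ R ^ 2 := pow_le_pow_left₀ hρp.le (hρle.trans hρR) 2
      have habs : ∀ k : ι → ℤ, ∀ i, ∀ b, |h / ρ * (k i : ℝ)| < b ↔ |h * (k i : ℝ)| < b * ρ := by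
        intro k i b
        rw [div_mul_eq_mul_div, abs_div, abs_of_pos hρp, div_lt_iff₀ hρp]
      have habs1 : ∀ k : ι → ℤ, (∀ i, |h / ρ * (k i : ℝ)| < 1) → ∀ i, |h * (k i : ℝ)| < ρ := by
        intro k hk i; simpa using (habs k i 1).1 (hk i)
      have hhκ : h / ρ ≤ κ / 2 := by
        rw [div_le_iff₀ hρp]
        have h1 : κ ^ J ≤ κ ^ j := pow_le_pow_of_le_one hκ0.le (by linarith) (by omega)
        have h2 : κ ^ J * ρ0 * κ ≤ κ ^ j * ρ0 * κ :=
          mul_le_mul_of_nonneg_right (mul_le_mul_of_nonneg_right h1 hρ0.le) hκ0.le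
        rw [hρ]; linarith
      obtain ⟨m', hm'⟩ := hunit (ρ ^ 2 * C) (h / ρ) ((1 - c) ^ j * ω0 + σ / 2) m
        (fun k s => u k (s1 - ρ ^ 2 + ρ ^ 2 * s)) (fun k s => a k (s1 - ρ ^ 2 + ρ ^ 2 * s))
        (by positivity) (by have : 0 ≤ (1 - c) ^ j := pow_nonneg (by linarith) j
                            positivity) (by positivity) hhκ
        (fun k hk t ht ht1 => by
          have hk' := habs1 k hk
          have h1 := hd k (fun i => by linarith [hk' i]) (s1 - ρ ^ 2 + ρ ^ 2 * t) (by nlinarith) (by nlinarith)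
          have h2 : HasDerivAt (fun s => s1 - ρ ^ 2 + ρ ^ 2 * s) (ρ ^ 2) t := by
            simpa using ((hasDerivAt_id t).const_mul (ρ ^ 2)).const_add (s1 - ρ ^ 2)
          have h3 := HasDerivAt.comp t h1 h2
          rw [Lp_scale h ρ hρp.ne']
          have e : a k (s1 - ρ ^ 2 + ρ ^ 2 * t) * (ρ ^ 2 * Lp h (fun j => u j (s1 - ρ ^ 2 + ρ ^ 2 * t)) k)
            = a k (s1 - ρ ^ 2 + ρ ^ 2 * t) * Lp h (fun j => u j (s1 - ρ ^ 2 + ρ ^ 2 * t)) k * ρ ^ 2 := by ring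
          rw [e]; exact h3)
        (fun k hk t ht ht1 => by
          have hk' := habs1 k hk
          exact ha k (fun i => by linarith [hk' i]) (s1 - ρ ^ 2 + ρ ^ 2 * t) (by nlinarith) (by nlinarith))
        (fun k hk t ht ht1 => by
          have hk' := habs1 k hk
          have h1 := hL k (fun i => by linarith [hk' i]) (s1 - ρ ^ 2 + ρ ^ 2 * t) (by nlinarith) (by nlinarith)
          rw [Lp_scale h ρ hρp.ne']
          have := mul_le_mul_of_nonneg_left h1 (sq_nonneg ρ)
          linarith)
        (fun k hk t ht ht1 => by
          have hk' := habs1 k hk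
          exact hm k hk' (s1 - ρ ^ 2 + ρ ^ 2 * t) (by nlinarith) (by nlinarith))
      refine ⟨m', fun k hk t ht ht1 => ?_⟩
      have h1 := hm' k (fun i => (habs k i κ).2 (by have := hk i; rw [pow_succ] at this; rw [hρ]; linarith))
        ((t - s1 + ρ ^ 2) / ρ ^ 2) (by
          rw [le_div_iff₀ (by positivity)]
          have : (κ ^ (j + 1) * ρ0) ^ 2 = κ ^ 2 * ρ ^ 2 := by rw [hρ]; ring
          rw [this] at ht; linarith) (by rw [div_le_one (by positivity)]; linarith)
      have e : s1 - ρ ^ 2 + ρ ^ 2 * ((t - s1 + ρ ^ 2) / ρ ^ 2) = t := by field_simp; ring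
      simp only [e] at h1
      refine ⟨h1.1, h1.2.trans ?_⟩
      have h2 : C' * (ρ ^ 2 * C) ≤ c * σ / 2 := by
        have : C' * C * ρ ^ 2 ≤ C' * C * ρ0 ^ 2 := mul_le_mul_of_nonneg_left hρsq (by positivity)
        linarith
      rw [pow_succ (1 - c) j]; linarith
  obtain ⟨m', hm'⟩ := claim J le_rfl
  exact ⟨m', fun k hk t ht ht1 => ⟨(hm' k hk t ht ht1).1, by linarith [(hm' k hk t ht ht1).2]⟩⟩

end FW

namespace FW
variable {ι : Type*} [Fintype ι] [DecidableEq ι]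

theorem lemA_alg (x y q d : ℝ) (hx : 0 ≤ x) (hy : x / 2 ≤ y) :
    2 * q ^ 2 * x * (y - x) - 17 * q ^ 2 * (y - x) ^ 2 + x ^ 2 * d ^ 2 / 8
      ≤ (y ^ 2 * (q + d) ^ 2 - x ^ 2 * q ^ 2) - 2 * x ^ 2 * q * d := by
  have hy0 : 0 ≤ y := by linarith
  have h1 : x ^ 2 * d ^ 2 ≤ 4 * y ^ 2 * d ^ 2 := by
    have : x ^ 2 ≤ 4 * y ^ 2 := by nlinarith
    nlinarith [mul_le_mul_of_nonneg_right this (sq_nonneg d)]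
  have h2 : -(18 * q ^ 2 * (y - x) ^ 2 + y ^ 2 * d ^ 2 / 2) ≤ 2 * q * d * (y - x) * (y + x) := by
    have h3 : |y + x| ≤ 3 * y := by rw [abs_of_nonneg (by linarith)]; linarith
    have h4 : |2 * q * d * (y - x) * (y + x)| ≤ 2 * |q * (y - x)| * |d| * (3 * y) := by
      have : 2 * q * d * (y - x) * (y + x) = 2 * ((q * (y - x)) * d * (y + x)) := by ring
      rw [this, abs_mul, abs_mul, abs_mul, abs_two]
      have := mul_le_mul_of_nonneg_left h3 (by positivity : 0 ≤ 2 * (|q * (y - x)| * |d|))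
      linarith
    have h5 : 2 * |q * (y - x)| * |d| * (3 * y) ≤ 18 * q ^ 2 * (y - x) ^ 2 + y ^ 2 * d ^ 2 / 2 := by
      have e1 : |q * (y - x)| ^ 2 = q ^ 2 * (y - x) ^ 2 := by rw [sq_abs]; ring
      have e2 : (|d| * y) ^ 2 = y ^ 2 * d ^ 2 := by rw [mul_pow, sq_abs]; ring
      nlinarith [sq_nonneg (6 * |q * (y - x)| - |d| * y)]
    have := neg_abs_le (2 * q * d * (y - x) * (y + x))
    linarith
  nlinarith

/-- Lemma A. -/
theorem lemA (h : ℝ) (hh : 0 < h) (ξ q : (ι → ℤ) → ℝ) (k : ι → ℤ) (hx : 0 ≤ ξ k)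
    (hy : ∀ e, ξ k / 2 ≤ ξ (k + dir e)) :
    2 * ξ k ^ 2 * q k * Lp h q k + ξ k ^ 2 * Gm h q k / 8
      - q k ^ 2 * (17 * Gm h ξ k + 2 * ξ k * |Lp h ξ k|)
      ≤ Lp h (fun j => ξ j ^ 2 * q j ^ 2) k := by
  have key : ∀ e : ι × Bool,
      2 * q k ^ 2 * ξ k * ((ξ (k + dir e) - ξ k) / h ^ 2) - 17 * q k ^ 2 * (Dq h e ξ k) ^ 2
        + ξ k ^ 2 * (Dq h e q k) ^ 2 / 8 + 2 * ξ k ^ 2 * q k * ((q (k + dir e) - q k) / h ^ 2)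
      ≤ (ξ (k + dir e) ^ 2 * q (k + dir e) ^ 2 - ξ k ^ 2 * q k ^ 2) / h ^ 2 := by
    intro e
    have := lemA_alg (ξ k) (ξ (k + dir e)) (q k) (q (k + dir e) - q k) hx (hy e)
    have h2 := div_le_div_of_nonneg_right this (sq_nonneg h)
    unfold Dq
    have e1 : q k + (q (k + dir e) - q k) = q (k + dir e) := by ring
    rw [e1] at h2
    simp only [div_pow]
    simp only [sub_div, add_div] at h2 ⊢
    simp only [mul_div_assoc', div_div] at h2 ⊢
    have e3 : h ^ 2 * 8 = 8 * h ^ 2 := by ring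
    simp only [mul_sub, sub_div, mul_div_assoc', div_div, e3] at h2 ⊢
    linarith
  have hs := Finset.sum_le_sum (fun e (_ : e ∈ Finset.univ) => key e)
  simp only [Finset.sum_add_distrib, Finset.sum_sub_distrib, ← Finset.mul_sum, ← Finset.sum_div] at hs
  have hL : ∀ f : (ι → ℤ) → ℝ, Lp h f k = (∑ e, (f (k + dir e) - f k)) / h ^ 2 := fun f => rfl
  have hG : ∀ f : (ι → ℤ) → ℝ, Gm h f k = ∑ e, (Dq h e f k) ^ 2 := fun f => rfl
  simp only [← Finset.sum_sub_distrib] at hs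
  rw [← hL, ← hL, ← hG, ← hG] at hs
  rw [hL (fun j => ξ j ^ 2 * q j ^ 2)]
  have h3 : -(2 * ξ k * |Lp h ξ k| * q k ^ 2) ≤ 2 * q k ^ 2 * ξ k * Lp h ξ k := by
    have := mul_le_mul_of_nonneg_left (neg_abs_le (Lp h ξ k)) (by positivity : 0 ≤ 2 * q k ^ 2 * ξ k)
    linarith
  simp only [Finset.sum_sub_distrib, ← Finset.mul_sum] at hs ⊢
  linarith

theorem dir_opp (e : ι × Bool) : dir (e.1, !e.2) = -dir e := by
  funext i
  simp only [dir_apply, Pi.neg_apply]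
  rcases e with ⟨a, b⟩
  cases b <;> by_cases hi : i = a <;> simp [hi]

theorem Lp_opp (h : ℝ) (v : (ι → ℤ) → ℝ) (k : ι → ℤ) :
    Lp h v k = -(1/2) * ∑ e : ι × Bool, Dq h (e.1, !e.2) (Dq h e v) k := by
  have h1 : ∀ e : ι × Bool, Dq h (e.1, !e.2) (Dq h e v) k
      = -((v (k + dir e) - v k) + (v (k + dir (e.1, !e.2)) - v k)) / h ^ 2 := by
    intro e
    unfold Dq
    rw [dir_opp, neg_add_cancel_right, div_sub_div_same, div_div]
    ring
  have h2 : ∑ e : ι × Bool, (v (k + dir (e.1, !e.2)) - v k) = ∑ e : ι × Bool, (v (k + dir e) - v k) := by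
    rw [Fintype.sum_prod_type, Fintype.sum_prod_type]
    apply Finset.sum_congr rfl
    intro i _
    simp [add_comm]
  rw [Finset.sum_congr rfl (fun e _ => h1 e), ← Finset.sum_div, Finset.sum_neg_distrib, Finset.sum_add_distrib, h2]
  unfold Lp
  ring

theorem Lp_sq_le (h : ℝ) (v : (ι → ℤ) → ℝ) (k : ι → ℤ) :
    (Lp h v k) ^ 2 ≤ (Fintype.card ι / 2 : ℝ) * ∑ e, Gm h (Dq h e v) k := by
  rw [Lp_opp]
  have h1 : (∑ e : ι × Bool, Dq h (e.1, !e.2) (Dq h e v) k) ^ 2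
      ≤ (Fintype.card (ι × Bool) : ℝ) * ∑ e : ι × Bool, (Dq h (e.1, !e.2) (Dq h e v) k) ^ 2 := by
    have := sq_sum_le_card_mul_sum_sq (s := Finset.univ) (f := fun e : ι × Bool => Dq h (e.1, !e.2) (Dq h e v) k)
    simpa using this
  have h2 : ∑ e : ι × Bool, (Dq h (e.1, !e.2) (Dq h e v) k) ^ 2 ≤ ∑ e, Gm h (Dq h e v) k := by
    apply Finset.sum_le_sum
    intro e _
    exact Finset.single_le_sum (f := fun e' => (Dq h e' (Dq h e v) k) ^ 2) (fun _ _ => sq_nonneg _) (Finset.mem_univ _)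
  have h3 : (Fintype.card (ι × Bool) : ℝ) = 2 * Fintype.card ι := by simp; ring
  rw [h3] at h1
  have h4 := mul_le_mul_of_nonneg_left h2 (by positivity : (0:ℝ) ≤ 2 * Fintype.card ι)
  nlinarith

theorem hLp_sq_le (h : ℝ) (hh : 0 < h) (q : (ι → ℤ) → ℝ) (k : ι → ℤ) :
    (h * Lp h q k) ^ 2 ≤ 2 * Fintype.card ι * Gm h q k := by
  have e1 : h * Lp h q k = ∑ e, Dq h e q k := by
    unfold Lp Dq
    rw [← Finset.sum_div]; field_simp
  rw [e1]
  have := sq_sum_le_card_mul_sum_sq (s := Finset.univ) (f := fun e : ι × Bool => Dq h e q k)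
  have h3 : (Fintype.card (ι × Bool) : ℝ) = 2 * Fintype.card ι := by simp; ring
  rw [Finset.card_univ, h3] at this
  exact this

theorem Dq_mul (h : ℝ) (hh : 0 < h) (a f : (ι → ℤ) → ℝ) (e : ι × Bool) (k : ι → ℤ) :
    Dq h e (fun j => a j * f j) k = a k * Dq h e f k + Dq h e a k * (f k + h * Dq h e f k) := by
  unfold Dq; field_simp; ring

theorem Gm_nonneg (h : ℝ) (q : (ι → ℤ) → ℝ) (k : ι → ℤ) : 0 ≤ Gm h q k :=
  Finset.sum_nonneg fun _ _ => sq_nonneg _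

/-- Lemma B. -/
theorem lemB (h : ℝ) (hh : 0 < h) (ζ v : (ι → ℤ) → ℝ) (k : ι → ℤ) (hx : 0 ≤ ζ k)
    (hy : ∀ e, ζ k / 2 ≤ ζ (k + dir e)) (a lam Lam CA A : ℝ) (al : ι × Bool → ℝ) (hlam : 0 < lam)
    (ha : lam ≤ a) (ha' : a ≤ Lam) (hCA : 17 * Gm h ζ k + 2 * ζ k * |Lp h ζ k| ≤ CA)
    (hA : ∀ e, al e ^ 2 ≤ A) :
    ∑ e, 2 * ζ k ^ 2 * Dq h e v k * (a * Lp h (Dq h e v) k + al e * (Lp h v k + h * Lp h (Dq h e v) k))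
      - a * Lp h (fun j => ζ j ^ 2 * Gm h v j) k
    ≤ -(lam / 16) * ζ k ^ 2 * ∑ e, Gm h (Dq h e v) k + Lam * CA * Gm h v k
      + 32 * ((Fintype.card ι : ℝ) + 1) ^ 2 / lam * ζ k ^ 2 * A * Gm h v k := by
  set n : ℝ := (Fintype.card ι : ℝ) with hn
  have hn0 : 0 ≤ n := by positivity
  set N := (n + 1) ^ 2 with hN
  have hN0 : 0 < N := by positivity
  set ε := lam / (16 * N) with hε
  have hε0 : 0 < ε := by positivity
  have hεN : ε * N = lam / 16 := by rw [hε]; field_simp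
  have h2ε : 2 / ε = 32 * N / lam := by rw [hε]; field_simp; norm_num
  have hL : Lp h (fun j => ζ j ^ 2 * Gm h v j) k = ∑ e, Lp h (fun j => ζ j ^ 2 * (Dq h e v j) ^ 2) k := by
    rw [← Lp_sum]
    congr 1
    funext j; unfold Gm; rw [Finset.mul_sum]
  have hCA0 : 0 ≤ CA := le_trans (by have := Gm_nonneg h ζ k; positivity) hCA
  have ha0 : 0 < a := by linarith
  set G2 := ∑ e, Gm h (Dq h e v) k with hG2
  have hG20 : 0 ≤ G2 := Finset.sum_nonneg fun _ _ => Gm_nonneg _ _ _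
  have hLv := Lp_sq_le h v k
  rw [← hG2, ← hn] at hLv
  have key : ∀ e ∈ (Finset.univ : Finset (ι × Bool)),
      2 * ζ k ^ 2 * Dq h e v k * (a * Lp h (Dq h e v) k + al e * (Lp h v k + h * Lp h (Dq h e v) k))
        - a * Lp h (fun j => ζ j ^ 2 * (Dq h e v j) ^ 2) k
      ≤ -(lam / 8) * ζ k ^ 2 * Gm h (Dq h e v) k + Lam * CA * (Dq h e v k) ^ 2
       + (ζ k ^ 2 * (ε * (n / 2 * G2)) + ζ k ^ 2 * (ε * (2 * n * Gm h (Dq h e v) k)) + ζ k ^ 2 * (2 / ε * A * (Dq h e v k) ^ 2)) := by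
    intro e _
    have h1 := lemA h hh ζ (Dq h e v) k hx hy
    have hg := Gm_nonneg h (Dq h e v) k
    have h2 := hLp_sq_le h hh (Dq h e v) k
    set q := Dq h e v k
    set g := Gm h (Dq h e v) k
    set L1 := Lp h (Dq h e v) k
    set L0 := Lp h v k
    set LL := Lp h (fun j => ζ j ^ 2 * (Dq h e v j) ^ 2) k
    set x := ζ k
    have h3 : a * (2 * x ^ 2 * q * L1 + x ^ 2 * g / 8 - q ^ 2 * CA) ≤ a * LL := by
      apply mul_le_mul_of_nonneg_left _ ha0.le
      have := mul_le_mul_of_nonneg_left hCA (sq_nonneg q)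
      linarith
    have h4 : lam * (x ^ 2 * g) ≤ a * (x ^ 2 * g) := mul_le_mul_of_nonneg_right ha (by positivity)
    have h5 : a * (CA * q ^ 2) ≤ Lam * (CA * q ^ 2) := mul_le_mul_of_nonneg_right ha' (by positivity)
    have young : ∀ X : ℝ, 2 * q * al e * X ≤ ε * X ^ 2 + 1 / ε * A * q ^ 2 := by
      intro X
      have h6 : 0 ≤ (ε * X - al e * q) ^ 2 / ε := by positivity
      have h7 : (ε * X - al e * q) ^ 2 / ε = ε * X ^ 2 - 2 * q * al e * X + 1 / ε * (al e ^ 2 * q ^ 2) := by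
        field_simp; ring
      have h8 : 1 / ε * (al e ^ 2 * q ^ 2) ≤ 1 / ε * (A * q ^ 2) := by
        apply mul_le_mul_of_nonneg_left _ (by positivity)
        exact mul_le_mul_of_nonneg_right (hA e) (sq_nonneg q)
      linarith
    have y1 := young L0
    have y2 := young (h * L1)
    have y3 := mul_le_mul_of_nonneg_left hLv hε0.le
    have y4 := mul_le_mul_of_nonneg_left h2 hε0.le
    have y5 : 2 * q * al e * (L0 + h * L1) ≤ ε * (n / 2 * G2) + ε * (2 * n * g) + 2 / ε * A * q ^ 2 := by
      have : 2 / ε * A * q ^ 2 = 1 / ε * A * q ^ 2 + 1 / ε * A * q ^ 2 := by ring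
      linarith
    have y6 := mul_le_mul_of_nonneg_left y5 (sq_nonneg x)
    linarith
  have hs := Finset.sum_le_sum key
  rw [hL, Finset.mul_sum, ← Finset.sum_sub_distrib]
  refine hs.trans ?_
  simp only [Finset.sum_add_distrib, ← Finset.mul_sum, Finset.sum_const, nsmul_eq_mul]
  rw [← hG2]
  have hG : ∑ e, (Dq h e v k) ^ 2 = Gm h v k := rfl
  rw [hG]
  have h3 : ((Finset.univ : Finset (ι × Bool)).card : ℝ) = 2 * n := by rw [Finset.card_univ]; simp [hn]; ring
  rw [h3, h2ε]
  have h4 : ζ k ^ 2 * (ε * (n ^ 2 + 2 * n) * G2) ≤ ζ k ^ 2 * (ε * N * G2) := by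
    apply mul_le_mul_of_nonneg_left _ (sq_nonneg _)
    apply mul_le_mul_of_nonneg_right _ hG20
    apply mul_le_mul_of_nonneg_left _ hε0.le
    rw [hN]; linarith
  rw [hεN] at h4
  have e5 : 2 * n * (ζ k ^ 2 * (ε * (n / 2 * G2))) + ζ k ^ 2 * (ε * (2 * n * G2)) = ζ k ^ 2 * (ε * (n ^ 2 + 2 * n) * G2) := by ring
  linarith
end FW

namespace FW
variable {ι : Type*} [Fintype ι] [DecidableEq ι]

theorem nsq_add_dir (h : ℝ) (k : ι → ℤ) (e : ι × Bool) :
    nsq h (k + dir e) - nsq h k = 2 * (h * (k e.1 : ℝ)) * (h * (dir e e.1 : ℝ)) + h ^ 2 := by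
  unfold nsq
  rw [← Finset.sum_sub_distrib, Finset.sum_eq_single e.1]
  · have : ((dir e e.1 : ℤ) : ℝ) ^ 2 = 1 := by
      rw [dir_apply]; simp
    simp only [Pi.add_apply]; push_cast
    linear_combination h ^ 2 * this
  · intro i _ hi
    have : dir e i = 0 := by rw [dir_apply]; simp [hi]
    simp [this]
  · simp

theorem dir_self_abs (e : ι × Bool) : |((dir e e.1 : ℤ) : ℝ)| = 1 := by
  rw [dir_apply]; simp; split_ifs <;> simp

/-- cutoff -/
noncomputable def zt (h r : ℝ) (k : ι → ℤ) : ℝ := r ^ 2 - nsq h k + 12 * h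

theorem Dq_zt_le (h r : ℝ) (hh : 0 < h) (hr : 0 < r) (hr1 : r ≤ 1) (hhr : 12 * h ≤ r ^ 2) (k : ι → ℤ)
    (hk : nsq h k < r ^ 2) (e : ι × Bool) : |Dq h e (zt h r) k| ≤ 3 := by
  have h1 : Dq h e (zt h r) k = -(2 * (h * (k e.1 : ℝ)) * (dir e e.1 : ℝ) + h) := by
    unfold Dq zt
    have := nsq_add_dir h k e
    rw [div_eq_iff hh.ne']; linarith
  have h2 : |h * (k e.1 : ℝ)| ≤ 1 := by
    have h3 := le_nsq h k e.1
    have h4 : (h * (k e.1 : ℝ)) ^ 2 ≤ 1 := by nlinarith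
    exact (sq_le_one_iff_abs_le_one _).mp h4
  have h5 : |2 * (h * (k e.1 : ℝ)) * (dir e e.1 : ℝ)| ≤ 2 := by
    rw [abs_mul, abs_mul, dir_self_abs, abs_two]; linarith
  rw [h1, abs_neg]
  have h6 : h ≤ 1 := by nlinarith
  calc _ ≤ |2 * (h * (k e.1 : ℝ)) * (dir e e.1 : ℝ)| + |h| := abs_add_le _ _
    _ ≤ 3 := by rw [abs_of_pos hh]; linarith

theorem zt_facts (h r : ℝ) (hh : 0 < h) (hr : 0 < r) (hr1 : r ≤ 1) (hhr : 12 * h ≤ r ^ 2) (k : ι → ℤ)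
    (hk : nsq h k < r ^ 2) :
    12 * h ≤ zt h r k ∧ zt h r k ≤ 2 ∧ (∀ e, |zt h r (k + dir e) - zt h r k| ≤ 3 * h) ∧
    Lp h (zt h r) k = -(2 * Fintype.card ι) ∧ Gm h (zt h r) k ≤ 18 * Fintype.card ι := by
  have hD := Dq_zt_le h r hh hr hr1 hhr k hk
  refine ⟨by unfold zt; linarith, ?_, ?_, ?_, ?_⟩
  · unfold zt; have := nsq_nonneg h k; nlinarith
  · intro e
    have := hD e
    unfold Dq at this
    rw [abs_div, abs_of_pos hh, div_le_iff₀ hh] at this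
    exact this
  · have : (zt h r : (ι → ℤ) → ℝ) = fun k => (r ^ 2 + 12 * h) - nsq h k := by funext k; unfold zt; ring
    rw [this, Lp_sub, Lp_const, Lp_nsq h hh.ne']; ring
  · unfold Gm
    calc ∑ e, (Dq h e (zt h r) k) ^ 2 ≤ ∑ e : ι × Bool, (9 : ℝ) := by
          apply Finset.sum_le_sum; intro e _
          have := hD e
          rw [← sq_abs]; nlinarith [abs_nonneg (Dq h e (zt h r) k)]
      _ = 18 * Fintype.card ι := by simp; ring

theorem zt_CA (h r : ℝ) (hh : 0 < h) (hr : 0 < r) (hr1 : r ≤ 1) (hhr : 12 * h ≤ r ^ 2) (k : ι → ℤ)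
    (hk : nsq h k < r ^ 2) :
    17 * Gm h (zt h r) k + 2 * zt h r k * |Lp h (zt h r) k| ≤ 320 * Fintype.card ι := by
  obtain ⟨h1, h2, h3, h4, h5⟩ := zt_facts h r hh hr hr1 hhr k hk
  have hn : (0:ℝ) ≤ Fintype.card ι := by positivity
  rw [h4, abs_neg, abs_of_nonneg (by positivity)]
  nlinarith

theorem zt_half (h r : ℝ) (hh : 0 < h) (hr : 0 < r) (hr1 : r ≤ 1) (hhr : 12 * h ≤ r ^ 2) (k : ι → ℤ)
    (hk : nsq h k < r ^ 2) (e : ι × Bool) : 3 / 4 * zt h r k ≤ zt h r (k + dir e) := by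
  obtain ⟨h1, h2, h3, h4, h5⟩ := zt_facts h r hh hr hr1 hhr k hk
  have := (abs_le.mp (h3 e)).1
  linarith

theorem zt2_CA (h r : ℝ) (hh : 0 < h) (hr : 0 < r) (hr1 : r ≤ 1) (hhr : 12 * h ≤ r ^ 2) (k : ι → ℤ)
    (hk : nsq h k < r ^ 2) :
    17 * Gm h (fun j => zt h r j ^ 2) k + 2 * zt h r k ^ 2 * |Lp h (fun j => zt h r j ^ 2) k|
      ≤ 1700 * Fintype.card ι * zt h r k ^ 2 := by
  obtain ⟨h1, h2, h3, h4, h5⟩ := zt_facts h r hh hr hr1 hhr k hk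
  have hn : (0:ℝ) ≤ Fintype.card ι := by positivity
  have hG0 := Gm_nonneg h (zt h r) k
  have hz0 : 0 < zt h r k := by linarith
  have hL : Lp h (fun j => zt h r j ^ 2) k = 2 * zt h r k * Lp h (zt h r) k + Gm h (zt h r) k := by
    have := Lp_mul h hh.ne' (zt h r) (zt h r) k
    have e : (fun j : ι → ℤ => zt h r j ^ 2) = fun j => zt h r j * zt h r j := by funext j; ring
    rw [e, this]; unfold Gm
    have : ∀ e ∈ (Finset.univ : Finset (ι × Bool)), Dq h e (zt h r) k * Dq h e (zt h r) k = Dq h e (zt h r) k ^ 2 :=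
      fun e _ => by ring
    rw [Finset.sum_congr rfl this]; ring
  have hLa : |Lp h (fun j => zt h r j ^ 2) k| ≤ 26 * Fintype.card ι := by
    rw [hL, h4, abs_le]; constructor <;> nlinarith
  have hG : Gm h (fun j => zt h r j ^ 2) k ≤ 92 * Fintype.card ι * zt h r k ^ 2 := by
    unfold Gm
    calc ∑ e, (Dq h e (fun j => zt h r j ^ 2) k) ^ 2 ≤ ∑ e : ι × Bool, (46 * zt h r k ^ 2 : ℝ) := by
          apply Finset.sum_le_sum; intro e _
          have hD := Dq_zt_le h r hh hr hr1 hhr k hk e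
          have e1 : Dq h e (fun j => zt h r j ^ 2) k = Dq h e (zt h r) k * (zt h r (k + dir e) + zt h r k) := by
            unfold Dq; ring
          have h6 := abs_le.mp (h3 e)
          have h7 : (Dq h e (zt h r) k) ^ 2 ≤ 9 := by
            rw [← sq_abs]; nlinarith [abs_nonneg (Dq h e (zt h r) k)]
          have h8 : 0 ≤ zt h r (k + dir e) + zt h r k := by linarith
          have h9 : (zt h r (k + dir e) + zt h r k) ≤ 9 / 4 * zt h r k := by linarith
          have h10 : (zt h r (k + dir e) + zt h r k) ^ 2 ≤ (9 / 4 * zt h r k) ^ 2 := pow_le_pow_left₀ h8 h9 2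
          rw [e1, mul_pow]
          have := mul_le_mul h7 h10 (by positivity) (by norm_num)
          nlinarith [sq_nonneg (zt h r k)]
      _ = 92 * Fintype.card ι * zt h r k ^ 2 := by simp; ring
  have := mul_le_mul_of_nonneg_left hLa (by positivity : 0 ≤ 2 * zt h r k ^ 2)
  have h11 : 0 ≤ (Fintype.card ι : ℝ) * zt h r k ^ 2 := by positivity
  linarith

theorem exists_ball (h r : ℝ) (hh : 0 < h) (hr : 0 < r) :
    ∃ S : Finset (ι → ℤ), ∀ k, k ∈ S ↔ nsq h k < r ^ 2 := by
  classical
  obtain ⟨S, hS⟩ := exists_cube (ι := ι) h r hh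
  refine ⟨S.filter (fun k => nsq h k < r ^ 2), fun k => ?_⟩
  rw [Finset.mem_filter, and_iff_right_iff_imp, hS]
  intro hk i
  have := le_nsq h k i
  exact abs_lt_of_sq_lt_sq (by linarith) hr.le

end FW

namespace FW
variable {ι : Type*} [Fintype ι] [DecidableEq ι]

/-- time derivative of the quadratic quantity -/
theorem hasDerivAt_Gm (h : ℝ) (u u' : (ι → ℤ) → ℝ → ℝ) (k : ι → ℤ) (t : ℝ)
    (h0 : HasDerivAt (u k) (u' k t) t) (h1 : ∀ e, HasDerivAt (u (k + dir e)) (u' (k + dir e) t) t) :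
    HasDerivAt (fun t => Gm h (fun j => u j t) k)
      (∑ e, 2 * Dq h e (fun j => u j t) k * Dq h e (fun j => u' j t) k) t := by
  unfold Gm
  apply HasDerivAt.fun_sum
  intro e _
  have := (((h1 e).sub h0).div_const h).pow 2
  have e2 : (2 : ℕ) * ((u (k + dir e) t - u k t) / h) ^ (2 - 1) * ((u' (k + dir e) t - u' k t) / h)
    = 2 * Dq h e (fun j => u j t) k * Dq h e (fun j => u' j t) k := by unfold Dq; simp
  rw [← e2]
  exact this

theorem Gm_le_of_bd (h σ c : ℝ) (hh : 0 < h) (v : (ι → ℤ) → ℝ) (k : ι → ℤ) (h0 : |v k - c| ≤ σ)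
    (h1 : ∀ e, |v (k + dir e) - c| ≤ σ) : h ^ 2 * Gm h v k ≤ 8 * Fintype.card ι * σ ^ 2 := by
  unfold Gm
  rw [Finset.mul_sum]
  calc _ ≤ ∑ e : ι × Bool, (4 * σ ^ 2 : ℝ) := by
        apply Finset.sum_le_sum; intro e _
        unfold Dq
        have e1 : h ^ 2 * ((v (k + dir e) - v k) / h) ^ 2 = (v (k + dir e) - v k) ^ 2 := by field_simp
        rw [e1]
        have := abs_le.mp h0
        have := abs_le.mp (h1 e)
        have h5 : |v (k + dir e) - v k| ≤ 2 * σ := by rw [abs_le]; constructor <;> linarith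
        rw [← sq_abs]; nlinarith [abs_nonneg (v (k + dir e) - v k)]
    _ = _ := by simp; ring

theorem Lp_sq_shift (h c : ℝ) (hh : 0 < h) (v : (ι → ℤ) → ℝ) (k : ι → ℤ) :
    Lp h (fun j => (v j - c) ^ 2) k = 2 * (v k - c) * Lp h v k + Gm h v k := by
  have hs : Lp h (fun j => v j - c) k = Lp h v k := by rw [Lp_sub, Lp_const, sub_zero]
  have h1 := Lp_mul h hh.ne' (fun j => v j - c) (fun j => v j - c) k
  have e : (fun j : ι → ℤ => (v j - c) ^ 2) = fun j => (v j - c) * (v j - c) := by funext j; ring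
  have hd : ∀ e ∈ (Finset.univ : Finset (ι × Bool)), Dq h e (fun j => v j - c) k * Dq h e (fun j => v j - c) k = Dq h e v k ^ 2 := by
    intro e _; unfold Dq; ring
  rw [e, h1, Finset.sum_congr rfl hd, hs]; unfold Gm; ring

theorem bern1_alg (A0 A2 σ lam Lam CA C' N Ka Kb n t x Q G2 a b w BB WW : ℝ)
    (ht0 : 0 ≤ t) (ht1 : t ≤ 1) (hx0 : 0 ≤ x) (hx2 : x ≤ 2) (hQ : 0 ≤ Q) (hG2 : 0 ≤ G2)
    (hlam : 0 < lam) (ha : lam ≤ a) (ha' : a ≤ Lam) (hb : |b| ≤ Kb) (hA2 : 0 < A2) (hA0 : 0 < A0) (hCA : 0 ≤ CA)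
    (hC' : 0 ≤ C') (hn : 0 ≤ n) (hN : 0 ≤ N)
    (hw : w ^ 2 ≤ Lam ^ 2 * (n / 2) * G2) (hP1 : t * (x ^ 2 * Q) ≤ 2 * A0 * σ ^ 2)
    (hP2 : A2 * (t ^ 2 * x ^ 4 * w ^ 2) ≤ 2 * A0 * σ ^ 2)
    (c1 : 5 + Lam * CA ≤ A0 * lam) (c2 : N * Ka ^ 2 * (2 * A0 * σ ^ 2) ≤ 1)
    (c3 : A2 * (Lam ^ 2 * (n / 2)) * (9 + Lam * C') ≤ lam / 16) (c4 : 4 * Kb ^ 2 * (2 * A0 * σ ^ 2) ≤ A2)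
    (hB : BB ≤ -(lam / 16) * x ^ 2 * G2 + Lam * CA * Q + N * x ^ 2 * (Ka ^ 2 * Q) * Q)
    (hW : WW ≤ C' * x ^ 2 * w ^ 2) :
    -A0 * a * Q + x ^ 2 * Q + t * BB + A2 * t ^ 2 * a * WW + 2 * A2 * t * x ^ 4 * w ^ 2
      + 2 * A2 * t ^ 2 * x ^ 4 * b * w ^ 3 ≤ 0 := by
  have ha0 : 0 < a := by linarith
  have hLam : 0 < Lam := by linarith
  have hKb : 0 ≤ Kb := (abs_nonneg b).trans hb
  -- first group
  have hx4 : x ^ 2 ≤ 4 := by nlinarith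
  have g1 : N * Ka ^ 2 * (t * (x ^ 2 * Q)) ≤ 1 :=
    (mul_le_mul_of_nonneg_left hP1 (by positivity)).trans c2
  have g2 : A0 * lam ≤ A0 * a := mul_le_mul_of_nonneg_left ha hA0.le
  have g3 : t * (Lam * CA) ≤ Lam * CA := by
    have : 0 ≤ Lam * CA := by positivity
    nlinarith
  have t1 : (-A0 * a + x ^ 2 + t * (Lam * CA) + N * Ka ^ 2 * (t * (x ^ 2 * Q))) * Q ≤ 0 :=
    mul_nonpos_of_nonpos_of_nonneg (by linarith) hQ
  -- second group
  have hsq : (2 * Kb * (t * x ^ 2 * w)) ^ 2 ≤ 1 := by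
    have h1 : 4 * Kb ^ 2 * (A2 * (t ^ 2 * x ^ 4 * w ^ 2)) ≤ A2 :=
      (mul_le_mul_of_nonneg_left hP2 (by positivity)).trans c4
    have h2 : A2 * (2 * Kb * (t * x ^ 2 * w)) ^ 2 ≤ A2 * 1 := by
      calc _ = 4 * Kb ^ 2 * (A2 * (t ^ 2 * x ^ 4 * w ^ 2)) := by ring
        _ ≤ _ := by linarith
    exact le_of_mul_le_mul_left h2 hA2
  have habs : |2 * Kb * (t * x ^ 2 * w)| ≤ 1 := (sq_le_one_iff_abs_le_one _).mp hsq
  have hbw : 2 * t * x ^ 2 * b * w ≤ 1 := by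
    calc 2 * t * x ^ 2 * b * w ≤ |2 * t * x ^ 2 * b * w| := le_abs_self _
      _ = |b| * |2 * (t * x ^ 2 * w)| := by rw [← abs_mul]; ring_nf
      _ ≤ Kb * |2 * (t * x ^ 2 * w)| := mul_le_mul_of_nonneg_right hb (abs_nonneg _)
      _ = |2 * Kb * (t * x ^ 2 * w)| := by
          rw [show 2 * Kb * (t * x ^ 2 * w) = Kb * (2 * (t * x ^ 2 * w)) by ring, abs_mul Kb, abs_of_nonneg hKb]
      _ ≤ 1 := habs
  have hw0 := sq_nonneg w
  have k1 : t * (a * C') ≤ Lam * C' := by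
    have : a * C' ≤ Lam * C' := mul_le_mul_of_nonneg_right ha' hC'
    have : 0 ≤ a * C' := by positivity
    nlinarith
  have k2 : (2 * x ^ 2 + t * (a * C') + 2 * t * x ^ 2 * b * w) * w ^ 2 ≤ (9 + Lam * C') * w ^ 2 :=
    mul_le_mul_of_nonneg_right (by linarith) hw0
  have k3 : A2 * ((9 + Lam * C') * w ^ 2) ≤ lam / 16 * G2 := by
    calc A2 * ((9 + Lam * C') * w ^ 2) ≤ A2 * ((9 + Lam * C') * (Lam ^ 2 * (n / 2) * G2)) := by gcongr
      _ = A2 * (Lam ^ 2 * (n / 2)) * (9 + Lam * C') * G2 := by ring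
      _ ≤ _ := mul_le_mul_of_nonneg_right c3 hG2
  have k4 := mul_le_mul_of_nonneg_left k2 hA2.le
  have t2 : t * x ^ 2 * (-(lam / 16) * G2 + A2 * ((2 * x ^ 2 + t * (a * C') + 2 * t * x ^ 2 * b * w) * w ^ 2)) ≤ 0 :=
    mul_nonpos_of_nonneg_of_nonpos (by positivity) (by linarith)
  have e1 := mul_le_mul_of_nonneg_left hB ht0
  have e2 := mul_le_mul_of_nonneg_left hW (by positivity : 0 ≤ A2 * t ^ 2 * a)
  nlinarith

end FW

namespace FW
variable {ι : Type*} [Fintype ι] [DecidableEq ι]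

theorem reg_of_ball (h r : ℝ) (hh : 0 < h) (hr : 0 < r) (k : ι → ℤ) (hk : nsq h k < r ^ 2) (i : ι) :
    |h * (k i : ℝ)| < r := by
  have := le_nsq h k i
  exact abs_lt_of_sq_lt_sq (by linarith) hr.le

/-- Bernstein estimate of first order. -/
theorem bern1 (lam Lam Ka Kb : ℝ) (hlam : 0 < lam) (hLam : lam ≤ Lam) (hKa : 0 ≤ Ka) (hKb : 0 ≤ Kb) :
    ∃ σ A0 A2 : ℝ, 0 < σ ∧ 0 < A0 ∧ 0 < A2 ∧ ∀ (h r T c : ℝ) (u w a b : (ι → ℤ) → ℝ → ℝ),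
    0 < h → 0 < r → r ≤ 1 → 12 * h ≤ r ^ 2 → 0 ≤ T → T ≤ 1 →
    (∀ k, (∀ i, |h * (k i : ℝ)| < r + 3 * h) → ∀ t, 0 ≤ t → t ≤ T → HasDerivAt (u k) (w k t) t) →
    (∀ k, (∀ i, |h * (k i : ℝ)| < r + 3 * h) → ∀ t, 0 ≤ t → t ≤ T → w k t = a k t * Lp h (fun j => u j t) k) →
    (∀ k, (∀ i, |h * (k i : ℝ)| < r + 3 * h) → ∀ t, 0 ≤ t → t ≤ T →
      HasDerivAt (w k) (a k t * Lp h (fun j => w j t) k + b k t * w k t ^ 2) t) →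
    (∀ k, (∀ i, |h * (k i : ℝ)| < r + 3 * h) → ∀ t, 0 ≤ t → t ≤ T → lam ≤ a k t ∧ a k t ≤ Lam ∧ |b k t| ≤ Kb) →
    (∀ k e, (∀ i, |h * (k i : ℝ)| < r + 3 * h) → (∀ i, |h * ((k + dir e) i : ℝ)| < r + 3 * h) →
      ∀ t, 0 ≤ t → t ≤ T → (Dq h e (fun j => a j t) k) ^ 2 ≤ Ka ^ 2 * (Dq h e (fun j => u j t) k) ^ 2) →
    (∀ k, (∀ i, |h * (k i : ℝ)| < r + 3 * h) → ∀ t, 0 ≤ t → t ≤ T → |u k t - c| ≤ σ) →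
    ∀ k, nsq h k < r ^ 2 → ∀ t, 0 ≤ t → t ≤ T →
      t * ((r ^ 2 - nsq h k) ^ 2 * Gm h (fun j => u j t) k) ≤ 2 * A0 * σ ^ 2 ∧
      A2 * (t ^ 2 * (r ^ 2 - nsq h k) ^ 4 * w k t ^ 2) ≤ 2 * A0 * σ ^ 2 := by
  set n : ℝ := (Fintype.card ι : ℝ) with hn
  have hn0 : 0 ≤ n := by positivity
  have hLam0 : 0 < Lam := by linarith
  set CA := 320 * n with hCA
  set C' := 1700 * n with hC'
  set N := 32 * (n + 1) ^ 2 / lam with hN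
  have hN0 : 0 ≤ N := by positivity
  set A2 := lam / (16 * (Lam ^ 2 * (n + 1)) * (9 + Lam * C')) with hA2
  have hA20 : 0 < A2 := by positivity
  set A0 := (5 + Lam * CA) / lam + 4608 * n + 4 * 331776 * n ^ 2 * Lam ^ 2 * A2 + 1 with hA0
  have hA00 : 0 < A0 := by positivity
  set D := N * Ka ^ 2 * (2 * A0) + 4 * Kb ^ 2 * (2 * A0) / A2 + 1 with hD
  have hD1 : 1 ≤ D := by
    have : 0 ≤ N * Ka ^ 2 * (2 * A0) + 4 * Kb ^ 2 * (2 * A0) / A2 := by positivity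
    linarith
  set σ := 1 / D with hσ
  have hσ0 : 0 < σ := by positivity
  have hσD : D * σ ^ 2 ≤ 1 := by
    rw [hσ]
    have : D * (1 / D) ^ 2 = 1 / D := by field_simp
    rw [this, div_le_one (by linarith)]; exact hD1
  have c1 : 5 + Lam * CA ≤ A0 * lam := by
    have h1 : (5 + Lam * CA) / lam ≤ A0 := by
      have : 0 ≤ 4608 * n + 4 * 331776 * n ^ 2 * Lam ^ 2 * A2 := by positivity
      rw [hA0]; linarith
    rwa [div_le_iff₀ hlam] at h1
  have c2 : N * Ka ^ 2 * (2 * A0 * σ ^ 2) ≤ 1 := by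
    have h1 : N * Ka ^ 2 * (2 * A0) * σ ^ 2 ≤ D * σ ^ 2 := by
      apply mul_le_mul_of_nonneg_right _ (sq_nonneg _)
      have : 0 ≤ 4 * Kb ^ 2 * (2 * A0) / A2 := by positivity
      rw [hD]; linarith
    linarith
  have c4 : 4 * Kb ^ 2 * (2 * A0 * σ ^ 2) ≤ A2 := by
    have h1 : 4 * Kb ^ 2 * (2 * A0) / A2 * σ ^ 2 ≤ D * σ ^ 2 := by
      apply mul_le_mul_of_nonneg_right _ (sq_nonneg _)
      have : 0 ≤ N * Ka ^ 2 * (2 * A0) := by positivity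
      rw [hD]; linarith
    have h2 : 4 * Kb ^ 2 * (2 * A0) / A2 * σ ^ 2 ≤ 1 := h1.trans hσD
    rw [div_mul_eq_mul_div, div_le_one hA20] at h2
    linarith
  have c3 : A2 * (Lam ^ 2 * (n / 2)) * (9 + Lam * C') ≤ lam / 16 := by
    have h1 : A2 * (Lam ^ 2 * (n + 1)) * (9 + Lam * C') = lam / 16 := by
      have : 9 + Lam * C' ≠ 0 := by positivity
      rw [hA2]; field_simp
    rw [← h1]
    have : 0 ≤ 9 + Lam * C' := by positivity
    gcongr
    linarith
  have c5 : 4608 * n ≤ A0 := by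
    have : 0 ≤ (5 + Lam * CA) / lam + 4 * 331776 * n ^ 2 * Lam ^ 2 * A2 := by positivity
    rw [hA0]; linarith
  have c6 : 4 * 331776 * n ^ 2 * Lam ^ 2 * A2 ≤ A0 := by
    have : 0 ≤ (5 + Lam * CA) / lam + 4608 * n := by positivity
    rw [hA0]; linarith
  refine ⟨σ, A0, A2, hσ0, hA00, hA20, ?_⟩
  clear_value A0 A2 σ N D
  intro h r T c u w a b hh hr hr1 hhr hT0 hT1 hu hw hw' hab hDa hosc
  obtain ⟨S, hS⟩ := exists_ball (ι := ι) h r hh hr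
  have reg0 : ∀ k ∈ S, ∀ i, |h * (k i : ℝ)| < r := fun k hk i => reg_of_ball h r hh hr k ((hS k).mp hk) i
  have reg1 : ∀ k ∈ S, ∀ (e : ι × Bool) (i : ι), |h * ((k + dir e) i : ℝ)| < r + h := fun k hk e i =>
    (abs_add_dir h hh k e i).trans_lt (by linarith [reg0 k hk i])
  have reg2 : ∀ k ∈ S, ∀ (e e' : ι × Bool) (i : ι), |h * ((k + dir e + dir e') i : ℝ)| < r + 2 * h := fun k hk e e' i =>
    (abs_add_dir h hh (k + dir e) e' i).trans_lt (by linarith [reg1 k hk e i])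
  have R0 : ∀ k ∈ S, ∀ i, |h * (k i : ℝ)| < r + 3 * h := fun k hk i => by linarith [reg0 k hk i]
  have R1 : ∀ k ∈ S, ∀ (e : ι × Bool) (i : ι), |h * ((k + dir e) i : ℝ)| < r + 3 * h := fun k hk e i => by linarith [reg1 k hk e i]
  have R2 : ∀ k ∈ S, ∀ (e e' : ι × Bool) (i : ι), |h * ((k + dir e + dir e') i : ℝ)| < r + 3 * h := fun k hk e e' i => by
    linarith [reg2 k hk e e' i]
  set P : (ι → ℤ) → ℝ → ℝ := fun k t => A0 * (u k t - c) ^ 2 + t * (zt h r k ^ 2 * Gm h (fun j => u j t) k)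
    + A2 * (t ^ 2 * ((zt h r k ^ 2) ^ 2 * w k t ^ 2)) with hP
  have hPd : ∀ k ∈ S, ∀ t, 0 ≤ t → t ≤ T → HasDerivAt (P k)
      (A0 * (2 * (u k t - c) * w k t) + (zt h r k ^ 2 * Gm h (fun j => u j t) k
        + t * (zt h r k ^ 2 * ∑ e, 2 * Dq h e (fun j => u j t) k * Dq h e (fun j => w j t) k))
      + A2 * (2 * t * ((zt h r k ^ 2) ^ 2 * w k t ^ 2) + t ^ 2 * ((zt h r k ^ 2) ^ 2 *
        (2 * w k t * (a k t * Lp h (fun j => w j t) k + b k t * w k t ^ 2))))) t := by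
    intro k hk t ht0 htT
    have d1 := hu k (R0 k hk) t ht0 htT
    have d2 := hw' k (R0 k hk) t ht0 htT
    have d3 := hasDerivAt_Gm h u w k t d1 (fun e => hu _ (R1 k hk e) t ht0 htT)
    have e1 := ((d1.sub_const c).pow 2).const_mul A0
    have e2 := (hasDerivAt_id t).mul (d3.const_mul (zt h r k ^ 2))
    have e3 := (((hasDerivAt_id t).pow 2).mul ((d2.pow 2).const_mul ((zt h r k ^ 2) ^ 2))).const_mul A2
    have := (e1.add e2).add e3
    refine this.congr_deriv ?_
    simp only [id, Pi.pow_apply]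
    norm_num
  have main : ∀ k ∈ S, ∀ t, 0 ≤ t → t ≤ T → 0 ≤ 3 / 2 * A0 * σ ^ 2 - P k t := by
    apply cmp S h T 0 (1 / 2 * A0 * σ ^ 2) (by positivity) hT0 le_rfl (fun k t => 3 / 2 * A0 * σ ^ 2 - P k t)
    · intro k hk
      apply continuousOn_const.sub
      intro t ht
      exact (hPd k hk t ht.1 ht.2).continuousAt.continuousWithinAt
    · intro k hk
      have h1 := hosc k (R0 k hk) 0 le_rfl hT0
      have h2 : (u k 0 - c) ^ 2 ≤ σ ^ 2 := sq_le_sq' (abs_le.mp h1).1 (abs_le.mp h1).2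
      have h3 := mul_le_mul_of_nonneg_left h2 hA00.le
      have : 0 ≤ A0 * σ ^ 2 := by positivity
      simp only [hP]; norm_num; linarith
    · intro k hk e hke t ht0 htT
      have hz1 : zt h r (k + dir e) ≤ 12 * h := by
        rw [hS, not_lt] at hke
        unfold zt; linarith
      have hz0 : 0 ≤ zt h r (k + dir e) := by
        have := zt_half h r hh hr hr1 hhr k ((hS k).mp hk) e
        have := (zt_facts h r hh hr hr1 hhr k ((hS k).mp hk)).1
        linarith
      have o0 := hosc _ (R1 k hk e) t ht0.le htT
      have o1 := fun e' => hosc _ (R2 k hk e e') t ht0.le htT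
      have hG := Gm_le_of_bd h σ c hh (fun j => u j t) (k + dir e) o0 o1
      have hG0 := Gm_nonneg h (fun j => u j t) (k + dir e)
      rw [← hn] at hG
      set z := zt h r (k + dir e)
      set Gu := Gm h (fun j => u j t) (k + dir e)
      have b1 : (u (k + dir e) t - c) ^ 2 ≤ σ ^ 2 := sq_le_sq' (abs_le.mp o0).1 (abs_le.mp o0).2
      have b1' := mul_le_mul_of_nonneg_left b1 hA00.le
      have hz2 : z ^ 2 ≤ 144 * h ^ 2 := by nlinarith
      have b2 : t * (z ^ 2 * Gu) ≤ 1152 * n * σ ^ 2 := by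
        have h1 : z ^ 2 * Gu ≤ 144 * h ^ 2 * Gu := mul_le_mul_of_nonneg_right hz2 hG0
        have h2 : 0 ≤ z ^ 2 * Gu := by positivity
        nlinarith
      have hLb : (h ^ 2 * Lp h (fun j => u j t) (k + dir e)) ^ 2 ≤ 16 * n ^ 2 * σ ^ 2 := by
        have h1 := hLp_sq_le h hh (fun j => u j t) (k + dir e)
        rw [← hn] at h1
        have h2 := mul_le_mul_of_nonneg_left h1 (sq_nonneg h)
        have h3 := mul_le_mul_of_nonneg_left hG (by positivity : 0 ≤ 2 * n)
        calc _ = h ^ 2 * (h * Lp h (fun j => u j t) (k + dir e)) ^ 2 := by ring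
          _ ≤ _ := by linarith
      have hwv := hw _ (R1 k hk e) t ht0.le htT
      obtain ⟨ha1, ha2, -⟩ := hab _ (R1 k hk e) t ht0.le htT
      have b3 : t ^ 2 * ((z ^ 2) ^ 2 * w (k + dir e) t ^ 2) ≤ 331776 * n ^ 2 * Lam ^ 2 * σ ^ 2 := by
        have h1 : (z ^ 2) ^ 2 ≤ (144 * h ^ 2) ^ 2 := pow_le_pow_left₀ (sq_nonneg _) hz2 2
        have h2 : t ^ 2 ≤ 1 := by nlinarith
        have h3 : a (k + dir e) t ^ 2 ≤ Lam ^ 2 := pow_le_pow_left₀ (by linarith) ha2 2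
        rw [hwv]
        calc _ ≤ 1 * ((144 * h ^ 2) ^ 2 * (a (k + dir e) t * Lp h (fun j => u j t) (k + dir e)) ^ 2) := by
              gcongr
          _ = 20736 * (a (k + dir e) t ^ 2 * (h ^ 2 * Lp h (fun j => u j t) (k + dir e)) ^ 2) := by ring
          _ ≤ 20736 * (Lam ^ 2 * (16 * n ^ 2 * σ ^ 2)) := by gcongr
          _ = _ := by ring
      have b3' := mul_le_mul_of_nonneg_left b3 hA20.le
      have b4 := mul_le_mul_of_nonneg_right c5 (sq_nonneg σ)
      have b5 := mul_le_mul_of_nonneg_right c6 (sq_nonneg σ)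
      simp only [hP]
      linarith
    · intro k hk t ht0 htT hlo hhi
      refine ⟨_, a k t, 0, (hPd k hk t ht0.le htT).const_sub _, ?_, by simp, ?_⟩
      · linarith [(hab k (R0 k hk) t ht0.le htT).1]
      have hPk : P k t ≤ 2 * A0 * σ ^ 2 := by linarith
      have hkb := (hS k).mp hk
      obtain ⟨z1, z2, -, -, -⟩ := zt_facts h r hh hr hr1 hhr k hkb
      have hz0 : 0 ≤ zt h r k := by linarith
      have zh := zt_half h r hh hr hr1 hhr k hkb
      obtain ⟨ha1, ha2, hb1⟩ := hab k (R0 k hk) t ht0.le htT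
      have hLB := lemB h hh (zt h r) (fun j => u j t) k hz0 (fun e => by linarith [zh e]) (a k t) lam Lam CA
        (Ka ^ 2 * Gm h (fun j => u j t) k) (fun e => Dq h e (fun j => a j t) k) hlam ha1 ha2
        (zt_CA h r hh hr hr1 hhr k hkb) (fun e => by
          refine (hDa k e (R0 k hk) (R1 k hk e) t ht0.le htT).trans ?_
          apply mul_le_mul_of_nonneg_left _ (sq_nonneg _)
          exact Finset.single_le_sum (f := fun e => (Dq h e (fun j => u j t) k) ^ 2) (fun _ _ => sq_nonneg _) (Finset.mem_univ e))
      have hLA := lemA h hh (fun j => zt h r j ^ 2) (fun j => w j t) k (sq_nonneg _) (fun e => by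
        have h1 := zh e
        have h2 : (3 / 4 * zt h r k) ^ 2 ≤ zt h r (k + dir e) ^ 2 := pow_le_pow_left₀ (by linarith) h1 2
        have h3 : 0 ≤ zt h r k ^ 2 := sq_nonneg _
        have h4 : (3 / 4 * zt h r k) ^ 2 = 9 / 16 * zt h r k ^ 2 := by ring
        show zt h r k ^ 2 / 2 ≤ zt h r (k + dir e) ^ 2
        linarith)
      have hCA2 := zt2_CA h r hh hr hr1 hhr k hkb
      have hDw : ∀ e ∈ (Finset.univ : Finset (ι × Bool)), 2 * Dq h e (fun j => u j t) k * Dq h e (fun j => w j t) k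
          = 2 * Dq h e (fun j => u j t) k * (a k t * Lp h (Dq h e (fun j => u j t)) k
            + Dq h e (fun j => a j t) k * (Lp h (fun j => u j t) k + h * Lp h (Dq h e (fun j => u j t)) k)) := by
        intro e _
        have h1 : Dq h e (fun j => w j t) k = Dq h e (fun j => a j t * Lp h (fun j => u j t) j) k := by
          unfold Dq
          beta_reduce
          rw [hw k (R0 k hk) t ht0.le htT, hw _ (R1 k hk e) t ht0.le htT]
        rw [h1, Dq_mul h hh, Lp_Dq]
      have hLs := Lp_sq_le h (fun j => u j t) k
      have hQ0 := Gm_nonneg h (fun j => u j t) k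
      have hG20 : 0 ≤ ∑ e, Gm h (Dq h e (fun j => u j t)) k := Finset.sum_nonneg fun _ _ => Gm_nonneg _ _ _
      have hwk := hw k (R0 k hk) t ht0.le htT
      have hGw := Gm_nonneg h (fun j => w j t) k
      have hLP : Lp h (fun j => 3 / 2 * A0 * σ ^ 2 - P j t) k = -(A0 * (2 * (u k t - c) * Lp h (fun j => u j t) k + Gm h (fun j => u j t) k)
          + t * Lp h (fun j => zt h r j ^ 2 * Gm h (fun j => u j t) j) k
          + A2 * (t ^ 2 * Lp h (fun j => (zt h r j ^ 2) ^ 2 * w j t ^ 2) k)) := by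
        rw [Lp_sub, Lp_const, zero_sub]
        simp only [hP]
        rw [Lp_add, Lp_add, Lp_const_mul, Lp_const_mul, Lp_const_mul, Lp_const_mul, Lp_sq_shift h c hh]
      rw [hLP, Finset.sum_congr rfl hDw]
      have hsum : ∀ f : ι × Bool → ℝ, ∑ e, 2 * zt h r k ^ 2 * Dq h e (fun j => u j t) k * f e
          = zt h r k ^ 2 * ∑ e, 2 * Dq h e (fun j => u j t) k * f e := by
        intro f; rw [Finset.mul_sum]; exact Finset.sum_congr rfl fun e _ => by ring
      rw [hsum] at hLB
      have hP1 : t * (zt h r k ^ 2 * Gm h (fun j => u j t) k) ≤ 2 * A0 * σ ^ 2 := by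
        refine le_trans ?_ hPk
        simp only [hP]
        have : 0 ≤ A0 * (u k t - c) ^ 2 + A2 * (t ^ 2 * ((zt h r k ^ 2) ^ 2 * w k t ^ 2)) := by positivity
        linarith
      have hP2 : A2 * (t ^ 2 * zt h r k ^ 4 * w k t ^ 2) ≤ 2 * A0 * σ ^ 2 := by
        refine le_trans ?_ hPk
        simp only [hP]
        have : 0 ≤ A0 * (u k t - c) ^ 2 + t * (zt h r k ^ 2 * Gm h (fun j => u j t) k) := by positivity
        have e : A2 * (t ^ 2 * zt h r k ^ 4 * w k t ^ 2) = A2 * (t ^ 2 * ((zt h r k ^ 2) ^ 2 * w k t ^ 2)) := by ring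
        linarith
      rw [← hn, ← hN] at hLB
      rw [← hn] at hLs hCA2
      rw [← hC'] at hCA2
      generalize hSdef : ∑ e, 2 * Dq h e (fun j => u j t) k * (a k t * Lp h (Dq h e (fun j => u j t)) k
            + Dq h e (fun j => a j t) k * (Lp h (fun j => u j t) k + h * Lp h (Dq h e (fun j => u j t)) k)) = SS at *
      generalize ∑ e, Gm h (Dq h e (fun j => u j t)) k = G2 at *
      generalize Gm h (fun j => u j t) k = Q at *
      generalize Lp h (fun j => zt h r j ^ 2 * Gm h (fun j => u j t) j) k = LQ at *
      generalize hLWd : Lp h (fun j => (zt h r j ^ 2) ^ 2 * w j t ^ 2) k = LW at *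
      generalize Lp h (fun j => u j t) k = L0 at *
      generalize Lp h (fun j => w j t) k = Lw at *
      generalize Gm h (fun j => w j t) k = Gw at *
      generalize zt h r k = x at *
      have hWW : 2 * x ^ 4 * w k t * Lw - LW ≤ C' * x ^ 2 * w k t ^ 2 := by
        have h1 := mul_le_mul_of_nonneg_left hCA2 (sq_nonneg (w k t))
        have h2 : 0 ≤ (x ^ 2) ^ 2 * Gw / 8 := by positivity
        have e : 2 * x ^ 4 * w k t * Lw = 2 * (x ^ 2) ^ 2 * w k t * Lw := by ring
        linarith
      have hw2 : w k t ^ 2 ≤ Lam ^ 2 * (n / 2) * G2 := by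
        rw [hwk, mul_pow, mul_assoc]
        exact mul_le_mul (pow_le_pow_left₀ (by linarith) ha2 2) hLs (sq_nonneg _) (by positivity)
      have fin := bern1_alg A0 A2 σ lam Lam CA C' N Ka Kb n t x Q G2 (a k t) (b k t) (w k t) (x ^ 2 * SS - a k t * LQ)
        (2 * x ^ 4 * w k t * Lw - LW) ht0.le (htT.trans hT1) hz0 z2 hQ0 hG20 hlam ha1 ha2 hb1 hA20 hA00
        (by positivity) (by positivity) hn0 hN0 hw2 hP1 hP2 c1 c2 c3 c4 hLB hWW
      have e0 : A0 * (2 * (u k t - c) * w k t) = a k t * (A0 * (2 * (u k t - c) * L0)) := by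
        rw [hwk]; ring
      rw [e0]
      linarith
  intro k hk t ht0 htT
  have hm := main k ((hS k).mpr hk) t ht0 htT
  have hzz : r ^ 2 - nsq h k ≤ zt h r k := by unfold zt; linarith
  have hz0 : 0 ≤ r ^ 2 - nsq h k := by linarith
  have hQ0 := Gm_nonneg h (fun j => u j t) k
  simp only [hP] at hm
  have p1 : 0 ≤ A0 * (u k t - c) ^ 2 := by positivity
  have p2 : t * ((r ^ 2 - nsq h k) ^ 2 * Gm h (fun j => u j t) k) ≤ t * (zt h r k ^ 2 * Gm h (fun j => u j t) k) := by
    gcongr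
  have p3 : A2 * (t ^ 2 * (r ^ 2 - nsq h k) ^ 4 * w k t ^ 2) ≤ A2 * (t ^ 2 * ((zt h r k ^ 2) ^ 2 * w k t ^ 2)) := by
    rw [← pow_mul, mul_assoc (t ^ 2)]
    gcongr
  have p4 : 0 ≤ t * ((r ^ 2 - nsq h k) ^ 2 * Gm h (fun j => u j t) k) := by positivity
  have p5 : 0 ≤ A2 * (t ^ 2 * (r ^ 2 - nsq h k) ^ 4 * w k t ^ 2) := by positivity
  have p6 : 0 ≤ A0 * σ ^ 2 := by positivity
  constructor <;> linarith
end FW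

namespace FW
variable {ι : Type*} [Fintype ι] [DecidableEq ι]

/-- Bernstein estimate of second order. -/
theorem bern2 (lam Lam Kb W Ba Bb : ℝ) (hlam : 0 < lam) (hLam : lam ≤ Lam) (hKb : 0 ≤ Kb) (hW : 0 ≤ W)
    (hBa : 0 ≤ Ba) (hBb : 0 ≤ Bb) :
    ∃ C : ℝ, 0 < C ∧ ∀ (h r T : ℝ) (w a b : (ι → ℤ) → ℝ → ℝ),
    0 < h → 0 < r → r ≤ 1 → 12 * h ≤ r ^ 2 → 0 ≤ T → T ≤ 1 →
    (∀ k, (∀ i, |h * (k i : ℝ)| < r + 3 * h) → ∀ t, 0 ≤ t → t ≤ T →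
      HasDerivAt (w k) (a k t * Lp h (fun j => w j t) k + b k t * w k t ^ 2) t) →
    (∀ k, (∀ i, |h * (k i : ℝ)| < r + 3 * h) → ∀ t, 0 ≤ t → t ≤ T → lam ≤ a k t ∧ a k t ≤ Lam ∧ |b k t| ≤ Kb) →
    (∀ k e, (∀ i, |h * (k i : ℝ)| < r + 3 * h) → (∀ i, |h * ((k + dir e) i : ℝ)| < r + 3 * h) →
      ∀ t, 0 ≤ t → t ≤ T → (Dq h e (fun j => a j t) k) ^ 2 ≤ Ba ^ 2 ∧ (Dq h e (fun j => b j t) k) ^ 2 ≤ Bb ^ 2) →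
    (∀ k, (∀ i, |h * (k i : ℝ)| < r + 3 * h) → ∀ t, 0 ≤ t → t ≤ T → |w k t| ≤ W) →
    ∀ k, nsq h k < r ^ 2 → ∀ t, 0 ≤ t → t ≤ T →
      t * ((r ^ 2 - nsq h k) ^ 2 * Gm h (fun j => w j t) k) ≤ C := by
  set n : ℝ := (Fintype.card ι : ℝ) with hn
  have hn0 : 0 ≤ n := by positivity
  have hLam0 : 0 < Lam := by linarith
  set CA := 320 * n with hCA
  set N := 32 * (n + 1) ^ 2 / lam with hN
  have hN0 : 0 ≤ N := by positivity
  set A0 := (4 + Lam * CA + 4 * N * Ba ^ 2 + 4 * (4 * Kb * W + 1)) / lam with hA0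
  have hA00 : 0 < A0 := by positivity
  have c1 : A0 * lam = 4 + Lam * CA + 4 * N * Ba ^ 2 + 4 * (4 * Kb * W + 1) := by
    rw [hA0]; field_simp
  set C0 := A0 * (2 * Kb * W ^ 3) + 8 * n * (Bb ^ 2 * W ^ 4) with hC0
  have hC00 : 0 ≤ C0 := by positivity
  set M0 := A0 * W ^ 2 + 1152 * n * W ^ 2 + 1 with hM0
  have hM00 : 0 < M0 := by positivity
  refine ⟨M0 + C0, by positivity, ?_⟩
  clear_value A0 N C0 M0
  intro h r T w a b hh hr hr1 hhr hT0 hT1 hw' hab hDab hosc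
  obtain ⟨S, hS⟩ := exists_ball (ι := ι) h r hh hr
  have reg0 : ∀ k ∈ S, ∀ i, |h * (k i : ℝ)| < r := fun k hk i => reg_of_ball h r hh hr k ((hS k).mp hk) i
  have reg1 : ∀ k ∈ S, ∀ (e : ι × Bool) (i : ι), |h * ((k + dir e) i : ℝ)| < r + h := fun k hk e i =>
    (abs_add_dir h hh k e i).trans_lt (by linarith [reg0 k hk i])
  have reg2 : ∀ k ∈ S, ∀ (e e' : ι × Bool) (i : ι), |h * ((k + dir e + dir e') i : ℝ)| < r + 2 * h := fun k hk e e' i =>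
    (abs_add_dir h hh (k + dir e) e' i).trans_lt (by linarith [reg1 k hk e i])
  have R0 : ∀ k ∈ S, ∀ i, |h * (k i : ℝ)| < r + 3 * h := fun k hk i => by linarith [reg0 k hk i]
  have R1 : ∀ k ∈ S, ∀ (e : ι × Bool) (i : ι), |h * ((k + dir e) i : ℝ)| < r + 3 * h := fun k hk e i => by linarith [reg1 k hk e i]
  have R2 : ∀ k ∈ S, ∀ (e e' : ι × Bool) (i : ι), |h * ((k + dir e + dir e') i : ℝ)| < r + 3 * h := fun k hk e e' i => by
    linarith [reg2 k hk e e' i]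
  set P : (ι → ℤ) → ℝ → ℝ := fun k t => A0 * (w k t - 0) ^ 2 + t * (zt h r k ^ 2 * Gm h (fun j => w j t) k) with hP
  set w' : (ι → ℤ) → ℝ → ℝ := fun k t => a k t * Lp h (fun j => w j t) k + b k t * w k t ^ 2 with hw'd
  have hPd : ∀ k ∈ S, ∀ t, 0 ≤ t → t ≤ T → HasDerivAt (P k)
      (A0 * (2 * w k t * w' k t) + (zt h r k ^ 2 * Gm h (fun j => w j t) k
        + t * (zt h r k ^ 2 * ∑ e, 2 * Dq h e (fun j => w j t) k * Dq h e (fun j => w' j t) k))) t := by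
    intro k hk t ht0 htT
    have d1 : HasDerivAt (w k) (w' k t) t := hw' k (R0 k hk) t ht0 htT
    have d3 := hasDerivAt_Gm h w w' k t d1 (fun e => hw' _ (R1 k hk e) t ht0 htT)
    have e1 := ((d1.sub_const 0).pow 2).const_mul A0
    have e2 := (hasDerivAt_id t).mul (d3.const_mul (zt h r k ^ 2))
    have := e1.add e2
    refine this.congr_deriv ?_
    simp only [id, Pi.pow_apply]
    norm_num
  have main : ∀ k ∈ S, ∀ t, 0 ≤ t → t ≤ T → 0 ≤ M0 + C0 * t - P k t := by
    apply cmp S h T 0 1 one_pos hT0 le_rfl (fun k t => M0 + C0 * t - P k t)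
    · intro k hk
      apply ContinuousOn.sub (by fun_prop)
      intro t ht
      exact (hPd k hk t ht.1 ht.2).continuousAt.continuousWithinAt
    · intro k hk
      have h1 := hosc k (R0 k hk) 0 le_rfl hT0
      have h2 : (w k 0) ^ 2 ≤ W ^ 2 := sq_le_sq' (abs_le.mp h1).1 (abs_le.mp h1).2
      have h3 := mul_le_mul_of_nonneg_left h2 hA00.le
      have : 0 ≤ 1152 * n * W ^ 2 := by positivity
      simp only [hP]; norm_num; linarith
    · intro k hk e hke t ht0 htT
      have hz1 : zt h r (k + dir e) ≤ 12 * h := by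
        rw [hS, not_lt] at hke
        unfold zt; linarith
      have hz0 : 0 ≤ zt h r (k + dir e) := by
        have := zt_half h r hh hr hr1 hhr k ((hS k).mp hk) e
        have := (zt_facts h r hh hr hr1 hhr k ((hS k).mp hk)).1
        linarith
      have o0 : |w (k + dir e) t - 0| ≤ W := by rw [sub_zero]; exact hosc _ (R1 k hk e) t ht0.le htT
      have o1 : ∀ e', |w (k + dir e + dir e') t - 0| ≤ W := fun e' => by
        rw [sub_zero]; exact hosc _ (R2 k hk e e') t ht0.le htT
      have hG := Gm_le_of_bd h W 0 hh (fun j => w j t) (k + dir e) o0 o1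
      have hG0 := Gm_nonneg h (fun j => w j t) (k + dir e)
      rw [← hn] at hG
      set z := zt h r (k + dir e)
      set Gu := Gm h (fun j => w j t) (k + dir e)
      have b1 : (w (k + dir e) t - 0) ^ 2 ≤ W ^ 2 := sq_le_sq' (abs_le.mp o0).1 (abs_le.mp o0).2
      have b1' := mul_le_mul_of_nonneg_left b1 hA00.le
      have hz2 : z ^ 2 ≤ 144 * h ^ 2 := by nlinarith
      have b2 : t * (z ^ 2 * Gu) ≤ 1152 * n * W ^ 2 := by
        have h1 : z ^ 2 * Gu ≤ 144 * h ^ 2 * Gu := mul_le_mul_of_nonneg_right hz2 hG0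
        have h2 : 0 ≤ z ^ 2 * Gu := by positivity
        nlinarith
      have : 0 ≤ C0 * t := by positivity
      simp only [hP]
      linarith
    · intro k hk t ht0 htT hlo hhi
      refine ⟨_, a k t, 0, (((hasDerivAt_id t).const_mul C0).const_add M0).sub (hPd k hk t ht0.le htT), ?_, by simp, ?_⟩
      · linarith [(hab k (R0 k hk) t ht0.le htT).1]
      have hkb := (hS k).mp hk
      obtain ⟨z1, z2, -, -, -⟩ := zt_facts h r hh hr hr1 hhr k hkb
      have hz0 : 0 ≤ zt h r k := by linarith
      have zh := zt_half h r hh hr hr1 hhr k hkb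
      obtain ⟨ha1, ha2, hb1⟩ := hab k (R0 k hk) t ht0.le htT
      have hLB := lemB h hh (zt h r) (fun j => w j t) k hz0 (fun e => by linarith [zh e]) (a k t) lam Lam CA
        (Ba ^ 2) (fun e => Dq h e (fun j => a j t) k) hlam ha1 ha2
        (zt_CA h r hh hr hr1 hhr k hkb) (fun e => (hDab k e (R0 k hk) (R1 k hk e) t ht0.le htT).1)
      have hDw : ∀ e, Dq h e (fun j => w' j t) k = (a k t * Lp h (Dq h e (fun j => w j t)) k
            + Dq h e (fun j => a j t) k * (Lp h (fun j => w j t) k + h * Lp h (Dq h e (fun j => w j t)) k))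
            + Dq h e (fun j => b j t * w j t ^ 2) k := by
        intro e
        have h1 : Dq h e (fun j => w' j t) k = Dq h e (fun j => a j t * Lp h (fun j => w j t) j) k
            + Dq h e (fun j => b j t * w j t ^ 2) k := by
          simp only [hw'd]
          unfold Dq
          ring
        rw [h1, Dq_mul h hh, Lp_Dq]
      have hwW := abs_le.mp (hosc k (R0 k hk) t ht0.le htT)
      have hwW2 : w k t ^ 2 ≤ W ^ 2 := sq_le_sq' hwW.1 hwW.2
      have hx4 : zt h r k ^ 2 ≤ 4 := by nlinarith
      have hextra : ∀ e : ι × Bool, 2 * Dq h e (fun j => w j t) k * Dq h e (fun j => b j t * w j t ^ 2) k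
          ≤ (4 * Kb * W + 1) * Dq h e (fun j => w j t) k ^ 2 + Bb ^ 2 * W ^ 4 := by
        intro e
        have h1 : Dq h e (fun j => b j t * w j t ^ 2) k
            = b (k + dir e) t * (w (k + dir e) t + w k t) * Dq h e (fun j => w j t) k
              + Dq h e (fun j => b j t) k * w k t ^ 2 := by
          unfold Dq; field_simp; ring
        have hbe := (hab _ (R1 k hk e) t ht0.le htT).2.2
        have hwe := abs_le.mp (hosc _ (R1 k hk e) t ht0.le htT)
        have hDb := (hDab k e (R0 k hk) (R1 k hk e) t ht0.le htT).2
        have h2 : |b (k + dir e) t * (w (k + dir e) t + w k t)| ≤ Kb * (2 * W) := by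
          rw [abs_mul]
          apply mul_le_mul hbe _ (abs_nonneg _) hKb
          rw [abs_le]; constructor <;> linarith
        have h3 := mul_le_mul_of_nonneg_right ((le_abs_self _).trans h2) (sq_nonneg (Dq h e (fun j => w j t) k))
        have h4 : (Dq h e (fun j => b j t) k * w k t ^ 2) ^ 2 ≤ Bb ^ 2 * W ^ 4 := by
          rw [mul_pow]
          have : (w k t ^ 2) ^ 2 ≤ W ^ 4 := by
            calc _ ≤ (W ^ 2) ^ 2 := pow_le_pow_left₀ (sq_nonneg _) hwW2 2
              _ = _ := by ring
          exact mul_le_mul hDb this (sq_nonneg _) (sq_nonneg _)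
        have h5 := two_mul_le_add_sq (Dq h e (fun j => w j t) k) (Dq h e (fun j => b j t) k * w k t ^ 2)
        rw [h1]
        linarith
      have hsumE : ∑ e : ι × Bool, 2 * Dq h e (fun j => w j t) k * Dq h e (fun j => b j t * w j t ^ 2) k
          ≤ (4 * Kb * W + 1) * Gm h (fun j => w j t) k + 2 * n * (Bb ^ 2 * W ^ 4) := by
        refine (Finset.sum_le_sum fun e _ => hextra e).trans (le_of_eq ?_)
        rw [Finset.sum_add_distrib, ← Finset.mul_sum]
        have h3 : ((Finset.univ : Finset (ι × Bool)).card : ℝ) = 2 * n := by rw [Finset.card_univ]; simp [hn]; ring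
        rw [Finset.sum_const, nsmul_eq_mul, h3]; rfl
      have hQ0 := Gm_nonneg h (fun j => w j t) k
      have hG20 : 0 ≤ ∑ e, Gm h (Dq h e (fun j => w j t)) k := Finset.sum_nonneg fun _ _ => Gm_nonneg _ _ _
      have hLP : Lp h (fun j => M0 + C0 * t - P j t) k = -(A0 * (2 * (w k t - 0) * Lp h (fun j => w j t) k + Gm h (fun j => w j t) k)
          + t * Lp h (fun j => zt h r j ^ 2 * Gm h (fun j => w j t) j) k) := by
        rw [Lp_sub, Lp_const, zero_sub]
        simp only [hP]
        rw [Lp_add, Lp_const_mul, Lp_const_mul, Lp_sq_shift h 0 hh]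
      rw [hLP]
      have hsplit : ∑ e, 2 * Dq h e (fun j => w j t) k * Dq h e (fun j => w' j t) k
        = ∑ e, 2 * Dq h e (fun j => w j t) k * (a k t * Lp h (Dq h e (fun j => w j t)) k
            + Dq h e (fun j => a j t) k * (Lp h (fun j => w j t) k + h * Lp h (Dq h e (fun j => w j t)) k))
          + ∑ e : ι × Bool, 2 * Dq h e (fun j => w j t) k * Dq h e (fun j => b j t * w j t ^ 2) k := by
        rw [← Finset.sum_add_distrib]
        refine Finset.sum_congr rfl fun e _ => ?_
        rw [hDw e]; ring
      rw [hsplit]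
      have hsum : ∀ f : ι × Bool → ℝ, ∑ e, 2 * zt h r k ^ 2 * Dq h e (fun j => w j t) k * f e
          = zt h r k ^ 2 * ∑ e, 2 * Dq h e (fun j => w j t) k * f e := by
        intro f; rw [Finset.mul_sum]; exact Finset.sum_congr rfl fun e _ => by ring
      rw [hsum] at hLB
      rw [← hn, ← hN] at hLB
      have hwk' : w' k t = a k t * Lp h (fun j => w j t) k + b k t * w k t ^ 2 := rfl
      rw [hwk']
      have hbw : b k t * w k t ^ 3 ≤ Kb * W ^ 3 := by
        calc b k t * w k t ^ 3 ≤ |b k t * w k t ^ 3| := le_abs_self _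
          _ = |b k t| * |w k t| ^ 3 := by rw [abs_mul, abs_pow]
          _ ≤ Kb * W ^ 3 := by
            have := hosc k (R0 k hk) t ht0.le htT
            gcongr
      generalize ∑ e, 2 * Dq h e (fun j => w j t) k * (a k t * Lp h (Dq h e (fun j => w j t)) k
            + Dq h e (fun j => a j t) k * (Lp h (fun j => w j t) k + h * Lp h (Dq h e (fun j => w j t)) k)) = SS at *
      generalize ∑ e : ι × Bool, 2 * Dq h e (fun j => w j t) k * Dq h e (fun j => b j t * w j t ^ 2) k = SE at *
      generalize ∑ e, Gm h (Dq h e (fun j => w j t)) k = G2 at *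
      generalize Gm h (fun j => w j t) k = Q at *
      generalize Lp h (fun j => zt h r j ^ 2 * Gm h (fun j => w j t) j) k = LQ at *
      generalize Lp h (fun j => w j t) k = Lw at *
      generalize zt h r k = x at *
      have ht1 : t ≤ 1 := htT.trans hT1
      have s1 : x ^ 2 * SS - a k t * LQ ≤ (Lam * CA + 4 * N * Ba ^ 2) * Q := by
        have h1 : 0 ≤ (lam / 16) * x ^ 2 * G2 := by positivity
        have h2 : N * x ^ 2 * Ba ^ 2 * Q ≤ N * 4 * Ba ^ 2 * Q := by gcongr
        linarith
      have s2 : x ^ 2 * SE ≤ 4 * ((4 * Kb * W + 1) * Q + 2 * n * (Bb ^ 2 * W ^ 4)) := by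
        have h1 := mul_le_mul_of_nonneg_left hsumE (sq_nonneg x)
        refine h1.trans (mul_le_mul_of_nonneg_right hx4 ?_)
        positivity
      set Y := (Lam * CA + 4 * N * Ba ^ 2) * Q + 4 * ((4 * Kb * W + 1) * Q + 2 * n * (Bb ^ 2 * W ^ 4)) with hY
      have hY0 : 0 ≤ Y := by positivity
      have s3 : t * (x ^ 2 * SS - a k t * LQ + x ^ 2 * SE) ≤ Y := by
        have h1 : t * (x ^ 2 * SS - a k t * LQ + x ^ 2 * SE) ≤ t * Y :=
          mul_le_mul_of_nonneg_left (by linarith) ht0.le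
        nlinarith
      have s4 : A0 * lam * Q ≤ A0 * a k t * Q := by gcongr
      rw [c1] at s4
      have s5 : x ^ 2 * Q ≤ 4 * Q := mul_le_mul_of_nonneg_right hx4 hQ0
      have s6 := mul_le_mul_of_nonneg_left hbw hA00.le
      have e3 : A0 * (2 * w k t * (a k t * Lw + b k t * w k t ^ 2)) = a k t * (A0 * (2 * (w k t - 0) * Lw)) + 2 * (A0 * (b k t * w k t ^ 3)) := by ring
      rw [e3]
      linarith
  intro k hk t ht0 htT
  have hm := main k ((hS k).mpr hk) t ht0 htT
  have hzz : r ^ 2 - nsq h k ≤ zt h r k := by unfold zt; linarith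
  have hz0 : 0 ≤ r ^ 2 - nsq h k := by linarith
  have hQ0 := Gm_nonneg h (fun j => w j t) k
  simp only [hP] at hm
  have p1 : 0 ≤ A0 * (w k t - 0) ^ 2 := by positivity
  have p2 : t * ((r ^ 2 - nsq h k) ^ 2 * Gm h (fun j => w j t) k) ≤ t * (zt h r k ^ 2 * Gm h (fun j => w j t) k) := by
    gcongr
  have p3 : C0 * t ≤ C0 := by nlinarith
  linarith
end FW

namespace FW
variable {ι : Type*} [Fintype ι] [DecidableEq ι]

theorem lip_rpow (q lo hi : ℝ) (hlo : 0 < lo) : ∃ K : ℝ, 0 ≤ K ∧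
    ∀ x y, lo ≤ x → x ≤ hi → lo ≤ y → y ≤ hi → |x ^ q - y ^ q| ≤ K * |x - y| := by
  have hc : ContinuousOn (fun x : ℝ => q * x ^ (q - 1)) (Icc lo hi) := by
    apply ContinuousOn.mul continuousOn_const
    exact continuousOn_id.rpow_const (fun x hx => Or.inl (by simp only [id]; linarith [hx.1]))
  obtain ⟨K, hK⟩ := isCompact_Icc.exists_bound_of_continuousOn hc
  refine ⟨max K 0, le_max_right _ _, ?_⟩
  intro x y hx1 hx2 hy1 hy2
  have := Convex.norm_image_sub_le_of_norm_hasDerivWithin_le (f := fun x : ℝ => x ^ q) (f' := fun x => q * x ^ (q - 1)) (s := Icc lo hi)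
    (C := max K 0) (fun z hz => (Real.hasDerivAt_rpow_const (Or.inl (by linarith [hz.1]))).hasDerivWithinAt)
    (fun z hz => (hK z hz).trans (le_max_left _ _)) (convex_Icc lo hi) ⟨hy1, hy2⟩ ⟨hx1, hx2⟩
  exact this

/-- Path lemma. -/
theorem path_aux (B : ℝ) (f : (ι → ℤ) → ℝ) (k' : ι → ℤ) (N : ℕ) : ∀ k : ι → ℤ, (∑ i, (k' i - k i).natAbs = N) →
    (∀ (j : ι → ℤ) (i : ι), (∀ l, j l ∈ uIcc (k l) (k' l)) → (∀ l, (j + Pi.single i 1 : ι → ℤ) l ∈ uIcc (k l) (k' l)) →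
      |f (j + Pi.single i 1) - f j| ≤ B) →
    |f k' - f k| ≤ B * N := by
  induction N with
  | zero =>
    intro k hk _
    have : k = k' := by
      funext i
      have := (Finset.sum_eq_zero_iff.mp hk) i (Finset.mem_univ i)
      omega
    subst this; simp
  | succ N ih =>
    intro k hk hB
    have hne : ∃ i, k' i ≠ k i := by
      by_contra hcon
      push Not at hcon
      simp [hcon] at hk
    obtain ⟨i, hi⟩ := hne
    have hsplit : ∀ k1 : ι → ℤ, ∑ l, (k' l - k1 l).natAbs = (k' i - k1 i).natAbs + ∑ l ∈ Finset.univ.erase i, (k' l - k1 l).natAbs :=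
      fun k1 => (Finset.add_sum_erase _ (fun l => (k' l - k1 l).natAbs) (Finset.mem_univ i)).symm
    rcases lt_or_gt_of_ne hi with hlt | hgt
    · -- move down
      set k1 : ι → ℤ := k - Pi.single i 1 with hk1
      have hk1i : k1 i = k i - 1 := by simp [hk1]
      have hk1l : ∀ l, l ≠ i → k1 l = k l := fun l hl => by simp [hk1, Pi.single_eq_of_ne hl]
      have hback : k1 + Pi.single i 1 = k := by simp [hk1]
      have hin : ∀ l, k1 l ∈ uIcc (k l) (k' l) := by
        intro l
        by_cases hl : l = i
        · subst hl; rw [hk1i, mem_uIcc]; omega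
        · rw [hk1l l hl]; exact left_mem_uIcc
      have hsub : ∀ l, uIcc (k1 l) (k' l) ⊆ uIcc (k l) (k' l) := fun l => uIcc_subset_uIcc (hin l) right_mem_uIcc
      have h1 := ih k1 (by
        rw [hsplit] at hk ⊢
        have : ∑ l ∈ Finset.univ.erase i, (k' l - k1 l).natAbs = ∑ l ∈ Finset.univ.erase i, (k' l - k l).natAbs :=
          Finset.sum_congr rfl fun l hl => by rw [hk1l l (Finset.ne_of_mem_erase hl)]
        rw [this, hk1i]; omega)
        (fun j i' hj hj' => hB j i' (fun l => hsub l (hj l)) (fun l => hsub l (hj' l)))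
      have h2 := hB k1 i hin (fun l => by rw [hback]; exact left_mem_uIcc)
      rw [hback, abs_sub_comm] at h2
      have := abs_sub_le (f k') (f k1) (f k)
      push_cast; linarith
    · set k1 : ι → ℤ := k + Pi.single i 1 with hk1
      have hk1i : k1 i = k i + 1 := by simp [hk1]
      have hk1l : ∀ l, l ≠ i → k1 l = k l := fun l hl => by simp [hk1, Pi.single_eq_of_ne hl]
      have hin : ∀ l, k1 l ∈ uIcc (k l) (k' l) := by
        intro l
        by_cases hl : l = i
        · subst hl; rw [hk1i, mem_uIcc]; omega
        · rw [hk1l l hl]; exact left_mem_uIcc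
      have hsub : ∀ l, uIcc (k1 l) (k' l) ⊆ uIcc (k l) (k' l) := fun l => uIcc_subset_uIcc (hin l) right_mem_uIcc
      have h1 := ih k1 (by
        rw [hsplit] at hk ⊢
        have : ∑ l ∈ Finset.univ.erase i, (k' l - k1 l).natAbs = ∑ l ∈ Finset.univ.erase i, (k' l - k l).natAbs :=
          Finset.sum_congr rfl fun l hl => by rw [hk1l l (Finset.ne_of_mem_erase hl)]
        rw [this, hk1i]; omega)
        (fun j i' hj hj' => hB j i' (fun l => hsub l (hj l)) (fun l => hsub l (hj' l)))
      have h2 := hB k i (fun l => left_mem_uIcc) hin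
      have := abs_sub_le (f k') (f k1) (f k)
      push_cast; linarith

theorem path_lip (B : ℝ) (f : (ι → ℤ) → ℝ) (k k' : ι → ℤ)
    (hB : ∀ (j : ι → ℤ) (i : ι), (∀ l, j l ∈ uIcc (k l) (k' l)) → (∀ l, (j + Pi.single i 1 : ι → ℤ) l ∈ uIcc (k l) (k' l)) →
      |f (j + Pi.single i 1) - f j| ≤ B) :
    |f k' - f k| ≤ B * ∑ i, |((k' i : ℝ) - k i)| := by
  have := path_aux B f k' _ k rfl hB
  have e : ((∑ i, (k' i - k i).natAbs : ℕ) : ℝ) = ∑ i, |((k' i : ℝ) - k i)| := by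
    push_cast
    refine Finset.sum_congr rfl fun i _ => ?_
    rw [Nat.cast_natAbs]; push_cast; rfl
  rwa [e] at this

theorem dir_true (i : ι) : dir ((i, true) : ι × Bool) = Pi.single i 1 := by simp [dir]

theorem cube_uIcc (h r : ℝ) (hh : 0 < h) (k k' j : ι → ℤ) (hk : ∀ i, |h * (k i : ℝ)| < r) (hk' : ∀ i, |h * (k' i : ℝ)| < r)
    (hj : ∀ l, j l ∈ uIcc (k l) (k' l)) : ∀ i, |h * (j i : ℝ)| < r := by
  intro i
  have h1 := abs_lt.mp (hk i)
  have h2 := abs_lt.mp (hk' i)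
  have h3 := hj i
  rw [mem_uIcc] at h3
  rw [abs_lt]
  rcases h3 with ⟨a1, a2⟩ | ⟨a1, a2⟩
  · have b1 : (k i : ℝ) ≤ j i := by exact_mod_cast a1
    have b2 : (j i : ℝ) ≤ k' i := by exact_mod_cast a2
    constructor <;> nlinarith
  · have b1 : (k' i : ℝ) ≤ j i := by exact_mod_cast a1
    have b2 : (j i : ℝ) ≤ k i := by exact_mod_cast a2
    constructor <;> nlinarith

theorem Lp_trans (h : ℝ) (f : (ι → ℤ) → ℝ) (m k : ι → ℤ) :
    Lp h (fun j => f (m + j)) k = Lp h f (m + k) := by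
  unfold Lp; simp only [add_assoc]

theorem Dq_trans (h : ℝ) (e : ι × Bool) (f : (ι → ℤ) → ℝ) (m k : ι → ℤ) :
    Dq h e (fun j => f (m + j)) k = Dq h e f (m + k) := by
  unfold Dq; simp only [add_assoc]

end FW

namespace FW
variable {ι : Type*} [Fintype ι] [DecidableEq ι]

def Loc (p lo hi C2 R h s1 : ℝ) (u w : (ι → ℤ) → ℝ → ℝ) : Prop :=
  ∀ k : ι → ℤ, (∀ i, |h * (k i : ℝ)| < R) → ∀ t, s1 - R ^ 2 ≤ t → t ≤ s1 →
    lo ≤ u k t ∧ u k t ≤ hi ∧ HasDerivAt (u k) (w k t) t ∧ w k t = u k t ^ p * Lp h (fun j => u j t) k ∧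
    HasDerivAt (w k) (u k t ^ p * Lp h (fun j => w j t) k + p / u k t * w k t ^ 2) t ∧
    -C2 ≤ Lp h (fun j => u j t) k

theorem Loc.mono {p lo hi C2 R R' h s1 : ℝ} {u w : (ι → ℤ) → ℝ → ℝ} (H : Loc p lo hi C2 R h s1 u w) (h0 : 0 ≤ R') (h1 : R' ≤ R) :
    Loc p lo hi C2 R' h s1 u w := by
  intro k hk t ht1 ht2
  have : R' ^ 2 ≤ R ^ 2 := by gcongr
  exact H k (fun i => (hk i).trans_le h1) t (by linarith) ht2

theorem nsq_small (h r : ℝ) (hr : 0 < r) (k : ι → ℤ) (hk : ∀ i, |h * (k i : ℝ)| < r / (2 * (Fintype.card ι + 1))) :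
    nsq h k ≤ r ^ 2 / 4 := by
  set n : ℝ := (Fintype.card ι : ℝ) with hn
  have hn0 : 0 ≤ n := by positivity
  have h1 : nsq h k ≤ n * (r / (2 * (n + 1))) ^ 2 := by
    unfold nsq
    calc ∑ i, (h * (k i : ℝ)) ^ 2 ≤ ∑ i : ι, (r / (2 * (n + 1))) ^ 2 := by
          refine Finset.sum_le_sum fun i _ => ?_
          rw [← sq_abs]
          have := (hk i).le
          gcongr
      _ = _ := by simp [hn]
  refine h1.trans ?_
  have e : n * (r / (2 * (n + 1))) ^ 2 = r ^ 2 / 4 * (n / (n + 1) ^ 2) := by field_simp; ring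
  rw [e]
  have : n / (n + 1) ^ 2 ≤ 1 := by rw [div_le_one (by positivity)]; nlinarith
  nlinarith [sq_nonneg r]

theorem Dq_le_of_lip (h : ℝ) (hh : 0 < h) (e : ι × Bool) (f g : (ι → ℤ) → ℝ) (k : ι → ℤ) (K : ℝ)
    (H : |f (k + dir e) - f k| ≤ K * |g (k + dir e) - g k|) : |Dq h e f k| ≤ K * |Dq h e g k| := by
  unfold Dq
  rw [abs_div, abs_div, abs_of_pos hh, ← mul_div_assoc]
  gcongr

theorem abs_Dq_le_Gm (h : ℝ) (e : ι × Bool) (f : (ι → ℤ) → ℝ) (k : ι → ℤ) : (Dq h e f k) ^ 2 ≤ Gm h f k := by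
  unfold Gm
  exact Finset.single_le_sum (f := fun e => (Dq h e f k) ^ 2) (fun _ _ => sq_nonneg _) (Finset.mem_univ e)

theorem loc1 (p lo hi C2 R : ℝ) (hp : 1 ≤ p) (hlo : 0 < lo) (hhi : lo ≤ hi) (hC2 : 0 ≤ C2) (hR : 0 < R) (hR1 : R ≤ 1) :
    ∃ r h0 K : ℝ, 0 < r ∧ r ≤ R ∧ 0 < h0 ∧ 0 < K ∧ ∀ (h s1 : ℝ) (u w : (ι → ℤ) → ℝ → ℝ), 0 < h → h ≤ h0 →
      Loc p lo hi C2 R h s1 u w → ∀ k : ι → ℤ, (∀ i, |h * (k i : ℝ)| < r) → ∀ t, s1 - r ^ 2 ≤ t → t ≤ s1 →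
        (∀ e, |Dq h e (fun j => u j t) k| ≤ K) ∧ |w k t| ≤ K := by
  have hp0 : 0 < p := by linarith
  have hhi0 : 0 < hi := by linarith
  obtain ⟨Ka, hKa, hlip⟩ := lip_rpow p lo hi hlo
  obtain ⟨σ, A0, A2, hσ, hA0, hA2, hB⟩ := bern1 (ι := ι) (lo ^ p) (hi ^ p) Ka (p / lo) (by positivity)
    (by gcongr) hKa (by positivity)
  obtain ⟨r1, h1, hr1, hr1R, hh1, hO⟩ := osc_small (ι := ι) (lo ^ p) (hi ^ p) C2 (hi - lo) R σ (by positivity)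
    (by gcongr) hC2 (by linarith) hR hσ
  set r := r1 / 2 with hr
  have hr0 : 0 < r := by positivity
  set n : ℝ := (Fintype.card ι : ℝ) with hn
  have hn0 : 0 ≤ n := by positivity
  set K := 1 + 16 * A0 * σ ^ 2 / r ^ 6 + 128 * A0 * σ ^ 2 / (A2 * r ^ 12) with hK
  have hK1 : 1 ≤ K := by
    have : 0 ≤ 16 * A0 * σ ^ 2 / r ^ 6 := by positivity
    have : 0 ≤ 128 * A0 * σ ^ 2 / (A2 * r ^ 12) := by positivity
    linarith
  have hr2 : r / (2 * (n + 1)) ≤ r / 2 := by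
    apply div_le_div_of_nonneg_left hr0.le (by norm_num) (by linarith)
  refine ⟨r / (2 * (n + 1)), min h1 (min (r1 / 6) (r ^ 2 / 12)), K, by positivity, ?_, by positivity, by linarith, ?_⟩
  · linarith
  intro h s1 u w hh hh0 HL k hk t ht1 ht2
  have hh1' : h ≤ h1 := hh0.trans (min_le_left _ _)
  have hh2' : h ≤ r1 / 6 := hh0.trans ((min_le_right _ _).trans (min_le_left _ _))
  have hh3' : h ≤ r ^ 2 / 12 := hh0.trans ((min_le_right _ _).trans (min_le_right _ _))
  obtain ⟨m', hm'⟩ := hO h s1 lo u (fun k t => u k t ^ p) hh hh1'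
    (fun k hk t ht1 ht2 => by
      obtain ⟨_, _, h3, h4, _⟩ := HL k hk t ht1 ht2
      rw [h4] at h3; exact h3)
    (fun k hk t ht1 ht2 => by
      obtain ⟨h1, h2, _⟩ := HL k hk t ht1 ht2
      exact ⟨by gcongr, by have : 0 < u k t := by linarith
                           gcongr⟩)
    (fun k hk t ht1 ht2 => (HL k hk t ht1 ht2).2.2.2.2.2)
    (fun k hk t ht1 ht2 => by
      obtain ⟨h1, h2, _⟩ := HL k hk t ht1 ht2
      exact ⟨h1, by linarith⟩)
  have HL1 := HL.mono hr1.le hr1R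
  have hreg : ∀ k : ι → ℤ, (∀ i, |h * (k i : ℝ)| < r + 3 * h) → ∀ i, |h * (k i : ℝ)| < r1 :=
    fun k hk i => (hk i).trans_le (by linarith)
  have hrr : r ^ 2 ≤ r1 ^ 2 := by rw [hr]; nlinarith
  have HL2 : ∀ k : ι → ℤ, (∀ i, |h * (k i : ℝ)| < r + 3 * h) → ∀ t, 0 ≤ t → t ≤ r ^ 2 → _ :=
    fun k hk t ht1 ht2 => HL1 k (hreg k hk) (s1 - r ^ 2 + t) (by linarith) (by linarith)
  have key := hB h r (r ^ 2) m' (fun k t => u k (s1 - r ^ 2 + t)) (fun k t => w k (s1 - r ^ 2 + t))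
    (fun k t => u k (s1 - r ^ 2 + t) ^ p) (fun k t => p / u k (s1 - r ^ 2 + t)) hh hr0 (by linarith) (by linarith)
    (by positivity) (by nlinarith)
    (fun k hk t ht1 ht2 => (HL2 k hk t ht1 ht2).2.2.1.comp_const_add _ _)
    (fun k hk t ht1 ht2 => (HL2 k hk t ht1 ht2).2.2.2.1)
    (fun k hk t ht1 ht2 => (HL2 k hk t ht1 ht2).2.2.2.2.1.comp_const_add _ _)
    (fun k hk t ht1 ht2 => by
      obtain ⟨h1, h2, _⟩ := HL2 k hk t ht1 ht2
      have : 0 < u k (s1 - r ^ 2 + t) := by linarith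
      refine ⟨by gcongr, by gcongr, ?_⟩
      rw [abs_of_pos (by positivity)]; gcongr)
    (fun k e hk hk' t ht1 ht2 => by
      obtain ⟨h1, h2, _⟩ := HL2 k hk t ht1 ht2
      obtain ⟨h1', h2', _⟩ := HL2 _ hk' t ht1 ht2
      have := Dq_le_of_lip h hh e (fun j => u j (s1 - r ^ 2 + t) ^ p) (fun j => u j (s1 - r ^ 2 + t)) k Ka
        (hlip _ _ h1' h2' h1 h2)
      rw [← mul_pow, ← sq_abs, ← sq_abs (Ka * _), abs_mul, abs_of_nonneg hKa]
      gcongr)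
    (fun k hk t ht1 ht2 => by
      obtain ⟨a1, a2⟩ := hm' k (hreg k hk) (s1 - r ^ 2 + t) (by linarith) (by linarith)
      rw [abs_le]; constructor <;> linarith)
    k (by have := nsq_small h r hr0 k hk
          nlinarith [sq_pos_of_pos hr0]) (t - (s1 - r ^ 2)) (by
          have : (r / (2 * (n + 1))) ^ 2 ≤ (r / 2) ^ 2 := by gcongr
          nlinarith) (by linarith)
  have e1 : s1 - r ^ 2 + (t - (s1 - r ^ 2)) = t := by ring
  simp only [e1] at key
  have hq : r ^ 2 / 2 ≤ r ^ 2 - nsq h k := by have := nsq_small h r hr0 k hk; nlinarith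
  have ht : r ^ 2 / 2 ≤ t - (s1 - r ^ 2) := by
          have : (r / (2 * (n + 1))) ^ 2 ≤ (r / 2) ^ 2 := by gcongr
          nlinarith
  obtain ⟨k1, k2⟩ := key
  have g1 : Gm h (fun j => u j t) k ≤ K ^ 2 := by
    have : r ^ 2 / 2 * ((r ^ 2 / 2) ^ 2 * Gm h (fun j => u j t) k) ≤ 2 * A0 * σ ^ 2 := by
      refine le_trans ?_ k1
      have := Gm_nonneg h (fun j => u j t) k
      have ht0 : 0 ≤ t - (s1 - r ^ 2) := le_trans (by positivity) ht
      gcongr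
    have : Gm h (fun j => u j t) k ≤ 16 * A0 * σ ^ 2 / r ^ 6 := by
      rw [le_div_iff₀ (by positivity)]; nlinarith
    have h0 : 0 ≤ 128 * A0 * σ ^ 2 / (A2 * r ^ 12) := by positivity
    nlinarith
  have g2 : w k t ^ 2 ≤ K ^ 2 := by
    have : A2 * ((r ^ 2 / 2) ^ 2 * (r ^ 2 / 2) ^ 4 * w k t ^ 2) ≤ 2 * A0 * σ ^ 2 := by
      refine le_trans ?_ k2
      have ht0 : 0 ≤ t - (s1 - r ^ 2) := le_trans (by positivity) ht
      gcongr
    have : w k t ^ 2 ≤ 128 * A0 * σ ^ 2 / (A2 * r ^ 12) := by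
      rw [le_div_iff₀ (by positivity)]; nlinarith
    have h0 : 0 ≤ 16 * A0 * σ ^ 2 / r ^ 6 := by positivity
    nlinarith
  refine ⟨fun e => abs_le_of_sq_le_sq ((abs_Dq_le_Gm h e _ k).trans g1) (by linarith), abs_le_of_sq_le_sq g2 (by linarith)⟩

theorem loc2 (p lo hi C2 R : ℝ) (hp : 1 ≤ p) (hlo : 0 < lo) (hhi : lo ≤ hi) (hC2 : 0 ≤ C2) (hR : 0 < R) (hR1 : R ≤ 1) :
    ∃ r h0 K : ℝ, 0 < r ∧ r ≤ R ∧ 0 < h0 ∧ 0 < K ∧ ∀ (h s1 : ℝ) (u w : (ι → ℤ) → ℝ → ℝ), 0 < h → h ≤ h0 →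
      Loc p lo hi C2 R h s1 u w → ∀ k : ι → ℤ, (∀ i, |h * (k i : ℝ)| < r) →
        (∀ e, |Dq h e (fun j => u j s1) k| ≤ K) ∧ |w k s1| ≤ K ∧
        |Lp h (fun j => u j s1) k| ≤ K ∧ (∀ e, |Dq h e (fun j => Lp h (fun j => u j s1) j) k| ≤ K) := by
  have hp0 : 0 < p := by linarith
  have hhi0 : 0 < hi := by linarith
  obtain ⟨r1, h1, K1, hr1, hr1R, hh1, hK1, HK1⟩ := loc1 (ι := ι) p lo hi C2 R hp hlo hhi hC2 hR hR1
  obtain ⟨Ka, hKa, hlipa⟩ := lip_rpow p lo hi hlo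
  obtain ⟨Kb, hKb, hlipb⟩ := lip_rpow (-1) lo hi hlo
  obtain ⟨Kc, hKc, hlipc⟩ := lip_rpow (-p) lo hi hlo
  obtain ⟨C, hC, hB⟩ := bern2 (ι := ι) (lo ^ p) (hi ^ p) (p / lo) K1 (Ka * K1) (p * Kb * K1) (by positivity)
    (by gcongr) (by positivity) hK1.le (by positivity) (by positivity)
  set r := r1 / 2 with hr
  have hr0 : 0 < r := by positivity
  set n : ℝ := (Fintype.card ι : ℝ) with hn
  have hn0 : 0 ≤ n := by positivity
  set W := 1 + 4 * C / r ^ 6 with hW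
  have hW1 : 1 ≤ W := by
    have : 0 ≤ 4 * C / r ^ 6 := by positivity
    linarith
  set K := K1 + K1 * lo ^ (-p) + W * lo ^ (-p) + K1 * (Kc * K1) with hK
  have hlop : 0 < lo ^ (-p) := by positivity
  have hr2 : r / (2 * (n + 1)) ≤ r / 2 := by
    apply div_le_div_of_nonneg_left hr0.le (by norm_num) (by linarith)
  refine ⟨r / (2 * (n + 1)), min h1 (min (r1 / 6) (r ^ 2 / 12)), K, by positivity, ?_, by positivity, by positivity, ?_⟩
  · linarith
  intro h s1 u w hh hh0 HL
  have hh1' : h ≤ h1 := hh0.trans (min_le_left _ _)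
  have hh2' : h ≤ r1 / 6 := hh0.trans ((min_le_right _ _).trans (min_le_left _ _))
  have hh3' : h ≤ r ^ 2 / 12 := hh0.trans ((min_le_right _ _).trans (min_le_right _ _))
  have hh4' : h ≤ r / 12 := by nlinarith
  have HA := HK1 h s1 u w hh hh1' HL
  have HL1 := HL.mono hr1.le hr1R
  have hreg : ∀ k : ι → ℤ, (∀ i, |h * (k i : ℝ)| < r + 3 * h) → ∀ i, |h * (k i : ℝ)| < r1 :=
    fun k hk i => (hk i).trans_le (by linarith)
  have hrr : r ^ 2 ≤ r1 ^ 2 := by rw [hr]; nlinarith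
  have HL2 : ∀ k : ι → ℤ, (∀ i, |h * (k i : ℝ)| < r + 3 * h) → ∀ t, 0 ≤ t → t ≤ r ^ 2 → _ :=
    fun k hk t ht1 ht2 => HL1 k (hreg k hk) (s1 - r ^ 2 + t) (by linarith) (by linarith)
  have HA2 : ∀ k : ι → ℤ, (∀ i, |h * (k i : ℝ)| < r + 3 * h) → ∀ t, 0 ≤ t → t ≤ r ^ 2 → _ :=
    fun k hk t ht1 ht2 => HA k (hreg k hk) (s1 - r ^ 2 + t) (by linarith) (by linarith)
  have key := hB h r (r ^ 2) (fun k t => w k (s1 - r ^ 2 + t))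
    (fun k t => u k (s1 - r ^ 2 + t) ^ p) (fun k t => p / u k (s1 - r ^ 2 + t)) hh hr0 (by linarith) (by linarith)
    (by positivity) (by nlinarith)
    (fun k hk t ht1 ht2 => (HL2 k hk t ht1 ht2).2.2.2.2.1.comp_const_add _ _)
    (fun k hk t ht1 ht2 => by
      obtain ⟨h1, h2, _⟩ := HL2 k hk t ht1 ht2
      have : 0 < u k (s1 - r ^ 2 + t) := by linarith
      refine ⟨by gcongr, by gcongr, ?_⟩
      rw [abs_of_pos (by positivity)]; gcongr)
    (fun k e hk hk' t ht1 ht2 => by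
      obtain ⟨h1, h2, _⟩ := HL2 k hk t ht1 ht2
      obtain ⟨h1', h2', _⟩ := HL2 _ hk' t ht1 ht2
      have hd := (HA2 k hk t ht1 ht2).1 e
      constructor
      · have := Dq_le_of_lip h hh e (fun j => u j (s1 - r ^ 2 + t) ^ p) (fun j => u j (s1 - r ^ 2 + t)) k Ka
          (hlipa _ _ h1' h2' h1 h2)
        have : |Dq h e (fun j => u j (s1 - r ^ 2 + t) ^ p) k| ≤ Ka * K1 := this.trans (by gcongr)
        rw [← sq_abs]; gcongr
      · have := Dq_le_of_lip h hh e (fun j => p / u j (s1 - r ^ 2 + t)) (fun j => u j (s1 - r ^ 2 + t)) k (p * Kb) (by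
          have := hlipb _ _ h1' h2' h1 h2
          simp only [Real.rpow_neg_one] at this
          rw [div_eq_mul_inv, div_eq_mul_inv, ← mul_sub, abs_mul, abs_of_pos hp0, mul_assoc]
          gcongr)
        have : |Dq h e (fun j => p / u j (s1 - r ^ 2 + t)) k| ≤ p * Kb * K1 := this.trans (by gcongr)
        rw [← sq_abs]; gcongr)
    (fun k hk t ht1 ht2 => (HA2 k hk t ht1 ht2).2)
  have hDw : ∀ k : ι → ℤ, (∀ i, |h * (k i : ℝ)| < r / (2 * (n + 1))) → ∀ e, |Dq h e (fun j => w j s1) k| ≤ W := by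
    intro k hk e
    have kk := key k (by have := nsq_small h r hr0 k hk
                         nlinarith [sq_pos_of_pos hr0]) (r ^ 2) (by positivity) le_rfl
    have e1 : s1 - r ^ 2 + r ^ 2 = s1 := by ring
    simp only [e1] at kk
    have hq : r ^ 2 / 2 ≤ r ^ 2 - nsq h k := by have := nsq_small h r hr0 k hk; nlinarith
    have : r ^ 2 * ((r ^ 2 / 2) ^ 2 * Gm h (fun j => w j s1) k) ≤ C := by
      refine le_trans ?_ kk
      have := Gm_nonneg h (fun j => w j s1) k
      gcongr
    have : Gm h (fun j => w j s1) k ≤ 4 * C / r ^ 6 := by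
      rw [le_div_iff₀ (by positivity)]; nlinarith
    have g1 : Gm h (fun j => w j s1) k ≤ W ^ 2 := by nlinarith
    exact abs_le_of_sq_le_sq ((abs_Dq_le_Gm h e _ k).trans g1) (by linarith)
  have hLpw : ∀ k : ι → ℤ, (∀ i, |h * (k i : ℝ)| < r1) → Lp h (fun j => u j s1) k = w k s1 * u k s1 ^ (-p) := by
    intro k hk
    obtain ⟨a1, a2, a3, a4, _⟩ := HL1 k hk s1 (by nlinarith) le_rfl
    have hu : 0 < u k s1 := by linarith
    rw [a4, Real.rpow_neg hu.le]
    have : 0 < u k s1 ^ p := by positivity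
    field_simp
  have hup : ∀ k : ι → ℤ, (∀ i, |h * (k i : ℝ)| < r1) → 0 < u k s1 ^ (-p) ∧ u k s1 ^ (-p) ≤ lo ^ (-p) := by
    intro k hk
    obtain ⟨a1, a2, a3, a4, _⟩ := HL1 k hk s1 (by nlinarith) le_rfl
    have hu : 0 < u k s1 := by linarith
    exact ⟨by positivity, Real.rpow_le_rpow_of_nonpos hlo a1 (by linarith)⟩
  intro k hk
  have hk1 : ∀ i, |h * (k i : ℝ)| < r1 := fun i => (hk i).trans_le (by linarith)
  obtain ⟨b1, b2⟩ := HA k hk1 s1 (by nlinarith) le_rfl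
  have q1 : 0 ≤ K1 * lo ^ (-p) := by positivity
  have q2 : 0 ≤ W * lo ^ (-p) := by positivity
  have q3 : 0 ≤ K1 * (Kc * K1) := by positivity
  refine ⟨fun e => (b1 e).trans (by linarith), b2.trans (by linarith), ?_, ?_⟩
  · rw [hLpw k hk1, abs_mul, abs_of_pos (hup k hk1).1]
    have : |w k s1| * u k s1 ^ (-p) ≤ K1 * lo ^ (-p) := by
      have := (hup k hk1).2
      have := (hup k hk1).1
      gcongr
    linarith
  · intro e
    have hk2 : ∀ i, |h * ((k + dir e) i : ℝ)| < r1 := by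
      intro i
      have c1 := abs_add_dir h hh k e i
      have c2 := hk i
      linarith
    have hD : Dq h e (fun j => Lp h (fun j => u j s1) j) k = Dq h e (fun j => w j s1) k * u (k + dir e) s1 ^ (-p)
        + w k s1 * Dq h e (fun j => u j s1 ^ (-p)) k := by
      unfold Dq
      beta_reduce
      rw [hLpw _ hk1, hLpw _ hk2]
      field_simp
      ring
    rw [hD]
    obtain ⟨a1, a2, _⟩ := HL1 k hk1 s1 (by nlinarith) le_rfl
    obtain ⟨a1', a2', _⟩ := HL1 _ hk2 s1 (by nlinarith) le_rfl
    have d1 := Dq_le_of_lip h hh e (fun j => u j s1 ^ (-p)) (fun j => u j s1) k Kc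
          (hlipc _ _ a1' a2' a1 a2)
    have d2 : |Dq h e (fun j => u j s1 ^ (-p)) k| ≤ Kc * K1 := d1.trans (by have := b1 e; gcongr)
    have d3 := hDw k hk e
    obtain ⟨f1, f2⟩ := hup _ hk2
    calc _ ≤ |Dq h e (fun j => w j s1) k * u (k + dir e) s1 ^ (-p)| + |w k s1 * Dq h e (fun j => u j s1 ^ (-p)) k| := abs_add_le _ _
      _ ≤ W * lo ^ (-p) + K1 * (Kc * K1) := by
        rw [abs_mul, abs_mul, abs_of_pos f1]
        gcongr
      _ ≤ _ := by linarith

end FW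

namespace FW
variable {ι : Type*} [Fintype ι] [DecidableEq ι]

theorem Dq_lip_unit (h B : ℝ) (hh : 0 < h) (f : (ι → ℤ) → ℝ) (j : ι → ℤ) (i : ι)
    (H : |Dq h (i, true) f j| ≤ B) : |f (j + Pi.single i 1) - f j| ≤ h * B := by
  unfold Dq at H
  rw [dir_true, abs_div, abs_of_pos hh, div_le_iff₀ hh] at H
  linarith

theorem ell_holder (r K : ℝ) (hr : 0 < r) (hr1 : r ≤ 1) (hK : 0 < K) : ∃ C : ℝ, 0 < C ∧
    ∀ (h : ℝ) (f : (ι → ℤ) → ℝ), 0 < h → h ≤ r / 16 →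
    (∀ k : ι → ℤ, (∀ i, |h * (k i : ℝ)| < r) → (∀ e, |Dq h e f k| ≤ K) ∧ (∀ e, |Dq h e (fun j => Lp h f j) k| ≤ K)) →
    (∀ k : ι → ℤ, (∀ i, |h * (k i : ℝ)| < r / 4) → ∀ e e', |Dq h e (fun j => Dq h e' f j) k| ≤ C) ∧
    (∀ k k' : ι → ℤ, (∀ i, |h * (k i : ℝ)| < r / 4) → (∀ i, |h * (k' i : ℝ)| < r / 4) → ∀ e e',
      |Dq h e (fun j => Dq h e' f j) k' - Dq h e (fun j => Dq h e' f j) k| ≤ C * √(h * ∑ i, |(k' i : ℝ) - k i|)) := by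
  set n : ℝ := (Fintype.card ι : ℝ) with hn
  have hn0 : 0 ≤ n := by positivity
  set K3 := (8 * n + 20) * K / (r / 2) + r / 2 * K with hK3
  have hK30 : 0 < K3 := by positivity
  set C := K3 + 8 * K3 / r + ((8 * n + 20) * K3 + 2 * K) with hC
  have hC0 : 0 < C := by positivity
  refine ⟨C, hC0, ?_⟩
  intro h f hh hhr H
  have hLD : ∀ e' k, (∀ i, |h * (k i : ℝ)| < r) → |Lp h (fun j => Dq h e' f j) k| ≤ K := by
    intro e' k hk
    have := Lp_Dq h e' f k
    rw [this]
    exact (H k hk).2 e'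
  have h2 : ∀ k : ι → ℤ, (∀ i, |h * (k i : ℝ)| < r / 2) → ∀ e e', |Dq h e (fun j => Dq h e' f j) k| ≤ K3 := by
    intro k hk e e'
    have hreg : ∀ j : ι → ℤ, (∀ i, |h * (j i : ℝ)| < r / 2) → ∀ i, |h * ((k + j) i : ℝ)| < r := by
      intro j hj i
      have a1 := hj i
      have a2 := hk i
      have : h * ((k + j) i : ℝ) = h * (k i : ℝ) + h * (j i : ℝ) := by simp; ring
      rw [this]
      have := abs_add_le (h * (k i : ℝ)) (h * (j i : ℝ))
      linarith
    have := elliptic_grad h (r / 2) K K hh (by linarith) hK.le hK.le (fun j => Dq h e' f (k + j))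
      (fun j hj => (H _ (hreg j hj)).1 e')
      (fun j hj => by
        rw [Lp_trans h (fun j => Dq h e' f j) k j]
        exact hLD e' _ (hreg j hj)) e
    rw [Dq_trans h e (fun j => Dq h e' f j) k 0, add_zero] at this
    exact this
  have t1 : 0 ≤ 8 * K3 / r := by positivity
  have t2 : 0 ≤ (8 * n + 20) * K3 + 2 * K := by positivity
  refine ⟨fun k hk e e' => (h2 k (fun i => (hk i).trans (by linarith)) e e').trans (by linarith), ?_⟩
  intro k k' hk hk' e e'
  set S := ∑ i, |(k' i : ℝ) - k i| with hS
  have hS0 : 0 ≤ S := Finset.sum_nonneg fun _ _ => abs_nonneg _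
  set d := h * S with hd
  have hd0 : 0 ≤ d := by positivity
  by_cases hkk : k' = k
  · rw [hkk]; simp; positivity
  have hS1 : 1 ≤ S := by
    have : ∃ i, k' i ≠ k i := by
      by_contra hcon
      push Not at hcon
      exact hkk (funext hcon)
    obtain ⟨i, hi⟩ := this
    have h1 : 1 ≤ |k' i - k i| := Int.one_le_abs (sub_ne_zero.mpr hi)
    have h2 : (1 : ℝ) ≤ |(k' i : ℝ) - k i| := by exact_mod_cast h1
    exact h2.trans (Finset.single_le_sum (f := fun i => |(k' i : ℝ) - k i|) (fun _ _ => abs_nonneg _) (Finset.mem_univ i))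
  have hdh : h ≤ d := by nlinarith
  have hdpos : 0 < d := by linarith
  have hsd : 0 < √d := Real.sqrt_pos.mpr hdpos
  have hsq : √d * √d = d := Real.mul_self_sqrt hd0
  by_cases hbig : r / 4 < √d
  · have a1 := h2 k (fun i => (hk i).trans (by linarith)) e e'
    have a2 := h2 k' (fun i => (hk' i).trans (by linarith)) e e'
    have a3 := abs_sub (Dq h e (fun j => Dq h e' f j) k') (Dq h e (fun j => Dq h e' f j) k)
    have : 2 * K3 ≤ 8 * K3 / r * √d := by
      have : 8 * K3 / r * (r / 4) ≤ 8 * K3 / r * √d := by gcongr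
      have e : 8 * K3 / r * (r / 4) = 2 * K3 := by field_simp; ring
      linarith
    have : 8 * K3 / r * √d ≤ C * √d := by gcongr; linarith
    linarith
  push Not at hbig
  have hreg : ∀ j k : ι → ℤ, (∀ i, |h * (k i : ℝ)| < r / 4) → (∀ i, |h * (j i : ℝ)| < √d) → ∀ i, |h * ((k + j) i : ℝ)| < r / 2 := by
    intro j k hk hj i
    have a1 := hj i
    have a2 := hk i
    have : h * ((k + j) i : ℝ) = h * (k i : ℝ) + h * (j i : ℝ) := by simp; ring
    rw [this]
    have := abs_add_le (h * (k i : ℝ)) (h * (j i : ℝ))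
    linarith
  have key := elliptic_grad h (√d) (K3 * d) (2 * K) hh (by
      have : h ≤ 1 / 16 := by linarith
      by_contra hcon
      push Not at hcon
      nlinarith) (by positivity) (by positivity) (fun j => Dq h e' f (k' + j) - Dq h e' f (k + j))
    (fun j hj => by
      have := path_lip (h * K3) (Dq h e' f) (k + j) (k' + j) (fun l i hl _ =>
        Dq_lip_unit h K3 hh (Dq h e' f) l i (h2 l (cube_uIcc h (r / 2) hh _ _ l (hreg j k hk hj) (hreg j k' hk' hj) hl) (i, true) e'))
      refine this.trans (le_of_eq ?_)
      rw [hd, hS]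
      simp only [Pi.add_apply, Int.cast_add, add_sub_add_right_eq_sub]
      ring)
    (fun j hj => by
      have e1 := Lp_sub h (fun j => Dq h e' f (k' + j)) (fun j => Dq h e' f (k + j)) j
      rw [e1, Lp_trans h (fun j => Dq h e' f j) k j, Lp_trans h (fun j => Dq h e' f j) k' j]
      have a1 := hLD e' _ (fun i => (hreg j k hk hj i).trans (by linarith))
      have a2 := hLD e' _ (fun i => (hreg j k' hk' hj i).trans (by linarith))
      have a3 := abs_sub (Lp h (fun j => Dq h e' f j) (k' + j)) (Lp h (fun j => Dq h e' f j) (k + j))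
      linarith) e
  have e1 : Dq h e (fun j => Dq h e' f (k' + j) - Dq h e' f (k + j)) 0 = Dq h e (fun j => Dq h e' f j) k' - Dq h e (fun j => Dq h e' f j) k := by
    unfold Dq; simp; ring
  rw [e1] at key
  refine key.trans ?_
  have e2 : (8 * n + 20) * (K3 * d) / √d = (8 * n + 20) * K3 * √d := by
    rw [div_eq_iff hsd.ne', mul_assoc, mul_assoc, hsq]
  rw [e2]
  have : (8 * n + 20) * K3 * √d + √d * (2 * K) = ((8 * n + 20) * K3 + 2 * K) * √d := by ring
  rw [this]
  gcongr
  linarith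

/-- Local a priori estimate. -/
theorem loc3 (p lo hi C2 R : ℝ) (hp : 1 ≤ p) (hlo : 0 < lo) (hhi : lo ≤ hi) (hC2 : 0 ≤ C2) (hR : 0 < R) (hR1 : R ≤ 1) :
    ∃ r h0 K : ℝ, 0 < r ∧ r ≤ R ∧ 0 < h0 ∧ 0 < K ∧ ∀ (h s1 : ℝ) (u w : (ι → ℤ) → ℝ → ℝ), 0 < h → h ≤ h0 →
      Loc p lo hi C2 R h s1 u w →
      (∀ k : ι → ℤ, (∀ i, |h * (k i : ℝ)| < r) →
        (∀ e, |Dq h e (fun j => u j s1) k| ≤ K) ∧ |w k s1| ≤ K ∧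
        (∀ e e', |Dq h e (fun j => Dq h e' (fun j => u j s1) j) k| ≤ K)) ∧
      (∀ k k' : ι → ℤ, (∀ i, |h * (k i : ℝ)| < r) → (∀ i, |h * (k' i : ℝ)| < r) → ∀ e e',
        |Dq h e (fun j => Dq h e' (fun j => u j s1) j) k' - Dq h e (fun j => Dq h e' (fun j => u j s1) j) k| ≤
          K * √(h * ∑ i, |(k' i : ℝ) - k i|)) := by
  obtain ⟨r, h0, K, hr, hrR, hh0, hK, H⟩ := loc2 (ι := ι) p lo hi C2 R hp hlo hhi hC2 hR hR1
  obtain ⟨C, hC, H2⟩ := ell_holder (ι := ι) r K hr (hrR.trans hR1) hK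
  refine ⟨r / 4, min h0 (r / 16), K + C, by positivity, by linarith, by positivity, by positivity, ?_⟩
  intro h s1 u w hh hh1 HL
  have H1 := H h s1 u w hh (hh1.trans (min_le_left _ _)) HL
  obtain ⟨Ha, Hb⟩ := H2 h (fun j => u j s1) hh (hh1.trans (min_le_right _ _)) (fun k hk => ⟨(H1 k hk).1, (H1 k hk).2.2.2⟩)
  refine ⟨fun k hk => ?_, fun k k' hk hk' e e' => ?_⟩
  · obtain ⟨b1, b2, _⟩ := H1 k (fun i => (hk i).trans (by linarith))
    exact ⟨fun e => (b1 e).trans (by linarith), b2.trans (by linarith), fun e e' => (Ha k hk e e').trans (by linarith)⟩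
  · refine (Hb k k' hk hk' e e').trans ?_
    gcongr
    linarith

end FW

namespace FW
variable {ι : Type*} [Fintype ι] [DecidableEq ι]

noncomputable def tau (M s : ℝ) : ℝ := max 0 (min s M)

theorem tau_mem (M s : ℝ) (hM : 0 ≤ M) : 0 ≤ tau M s ∧ tau M s ≤ M := by
  unfold tau
  exact ⟨le_max_left _ _, max_le hM (min_le_right _ _)⟩

theorem tau_lip (M s t : ℝ) : |tau M s - tau M t| ≤ |s - t| := by
  unfold tau
  calc |max 0 (min s M) - max 0 (min t M)| ≤ max |(0:ℝ) - 0| |min s M - min t M| := abs_max_sub_max_le_max _ _ _ _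
    _ = |min s M - min t M| := by simp
    _ ≤ max |s - t| |M - M| := abs_min_sub_min_le_max _ _ _ _
    _ = |s - t| := by simp

theorem tau_eq (M s : ℝ) (h0 : 0 ≤ s) (h1 : s ≤ M) : tau M s = s := by
  unfold tau; rw [min_eq_left h1, max_eq_right h0]

theorem abs_Lp_le (h B : ℝ) (hh : 0 < h) (f : (ι → ℤ) → ℝ) (k : ι → ℤ) (hB : ∀ j, |f j| ≤ B) :
    |Lp h f k| ≤ 4 * Fintype.card ι * B / h ^ 2 := by
  unfold Lp
  rw [abs_div, abs_of_pos (by positivity : 0 < h ^ 2)]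
  gcongr
  calc |∑ e : ι × Bool, (f (k + dir e) - f k)| ≤ ∑ e : ι × Bool, |f (k + dir e) - f k| := Finset.abs_sum_le_sum_abs _ _
    _ ≤ ∑ e : ι × Bool, (2 * B) := Finset.sum_le_sum fun e _ => by
        have := abs_sub (f (k + dir e)) (f k)
        linarith [hB (k + dir e), hB k]
    _ = _ := by simp; ring

theorem rpow_lip0 (p M x y : ℝ) (hp : 1 ≤ p) (hM : 0 ≤ M) (hx : 0 ≤ x) (hxM : x ≤ M) (hy : 0 ≤ y) (hyM : y ≤ M) :
    |x ^ p - y ^ p| ≤ p * M ^ (p - 1) * |x - y| := by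
  have := Convex.norm_image_sub_le_of_norm_hasDerivWithin_le (f := fun x : ℝ => x ^ p) (f' := fun x => p * x ^ (p - 1)) (s := Icc 0 M)
    (C := p * M ^ (p - 1)) (fun z hz => (Real.hasDerivAt_rpow_const (Or.inr hp)).hasDerivWithinAt)
    (fun z hz => by
      have h0 := hz.1
      rw [Real.norm_of_nonneg (by positivity)]
      have : z ^ (p - 1) ≤ M ^ (p - 1) := Real.rpow_le_rpow h0 hz.2 (by linarith)
      gcongr) (convex_Icc 0 M) ⟨hy, hyM⟩ ⟨hx, hxM⟩
  exact this

noncomputable def ext (S : Finset (ι → ℤ)) (x : S → ℝ) (j : ι → ℤ) : ℝ := if hj : j ∈ S then x ⟨j, hj⟩ else 0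

noncomputable def fld (p M h : ℝ) (S : Finset (ι → ℤ)) (x : S → ℝ) (k : S) : ℝ :=
  tau M (x k) ^ p * Lp h (ext S fun k => tau M (x k)) k

theorem fld_bd (p M h : ℝ) (hp : 1 ≤ p) (hM : 0 < M) (hh : 0 < h) (S : Finset (ι → ℤ)) :
    ∃ K : ℝ, 0 ≤ K ∧ (∀ x, ‖fld p M h S x‖ ≤ K) ∧ (∀ x y, ‖fld p M h S x - fld p M h S y‖ ≤ K * ‖x - y‖) := by
  set c : ℝ := 4 * Fintype.card ι / h ^ 2 with hc
  have hc0 : 0 ≤ c := by positivity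
  have hM1 : 0 ≤ M ^ (p - 1) := by positivity
  have hMp : 0 ≤ M ^ p := by positivity
  have hb : ∀ x : S → ℝ, ∀ j, |ext S (fun k => tau M (x k)) j| ≤ M := by
    intro x j
    unfold ext
    split_ifs with hj
    · obtain ⟨a, b⟩ := tau_mem M (x ⟨j, hj⟩) hM.le
      rw [abs_of_nonneg a]; exact b
    · simpa using hM.le
  have hb2 : ∀ (x : S → ℝ) (k : ι → ℤ), |Lp h (ext S (fun k => tau M (x k))) k| ≤ c * M := fun x k => by
    refine (abs_Lp_le h M hh _ k (hb x)).trans (le_of_eq ?_)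
    rw [hc]; ring
  refine ⟨M ^ p * (c * M) + (p * M ^ (p - 1) * (c * M) + M ^ p * c), by positivity, ?_, ?_⟩
  · intro x
    rw [pi_norm_le_iff_of_nonneg (by positivity)]
    intro k
    unfold fld
    obtain ⟨a, b⟩ := tau_mem M (x k) hM.le
    rw [Real.norm_eq_abs, abs_mul, abs_of_nonneg (by positivity)]
    have h1 : tau M (x k) ^ p * |Lp h (ext S fun k => tau M (x k)) k| ≤ M ^ p * (c * M) := by
      have := hb2 x k
      gcongr
    have : 0 ≤ p * M ^ (p - 1) * (c * M) + M ^ p * c := by positivity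
    linarith
  · intro x y
    rw [pi_norm_le_iff_of_nonneg (by positivity)]
    intro k
    rw [Pi.sub_apply, Real.norm_eq_abs]
    unfold fld
    set D := ‖x - y‖ with hD
    have hxy : ∀ k, |x k - y k| ≤ D := fun k => by
      have := norm_le_pi_norm (x - y) k
      rwa [Pi.sub_apply, Real.norm_eq_abs] at this
    have hD0 : 0 ≤ D := norm_nonneg _
    obtain ⟨a, b⟩ := tau_mem M (x k) hM.le
    obtain ⟨a', b'⟩ := tau_mem M (y k) hM.le
    have e : tau M (x k) ^ p * Lp h (ext S fun k => tau M (x k)) k - tau M (y k) ^ p * Lp h (ext S fun k => tau M (y k)) k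
      = (tau M (x k) ^ p - tau M (y k) ^ p) * Lp h (ext S fun k => tau M (x k)) k
        + tau M (y k) ^ p * Lp h (fun j => ext S (fun k => tau M (x k)) j - ext S (fun k => tau M (y k)) j) k := by
      rw [Lp_sub]; ring
    rw [e]
    have h1 : |tau M (x k) ^ p - tau M (y k) ^ p| ≤ p * M ^ (p - 1) * D :=
      (rpow_lip0 p M _ _ hp hM.le a b a' b').trans (by
        have := (tau_lip M (x k) (y k)).trans (hxy k)
        gcongr)
    have h2 : |Lp h (fun j => ext S (fun k => tau M (x k)) j - ext S (fun k => tau M (y k)) j) k| ≤ c * D := by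
      refine (abs_Lp_le h D hh _ (k : ι → ℤ) ?_).trans (le_of_eq (by rw [hc]; ring))
      intro j
      unfold ext
      split_ifs with hj
      · exact (tau_lip M _ _).trans (hxy _)
      · simpa using hD0
    have h3 := hb2 x k
    calc _ ≤ |(tau M (x k) ^ p - tau M (y k) ^ p) * Lp h (ext S fun k => tau M (x k)) k| + |tau M (y k) ^ p * Lp h (fun j => ext S (fun k => tau M (x k)) j - ext S (fun k => tau M (y k)) j) k| := abs_add_le _ _
      _ ≤ p * M ^ (p - 1) * D * (c * M) + M ^ p * (c * D) := by
        rw [abs_mul, abs_mul, abs_of_nonneg (by positivity : 0 ≤ tau M (y k) ^ p)]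
        gcongr
      _ ≤ _ := by
        have : 0 ≤ M ^ p * (c * M) * D := by positivity
        nlinarith

theorem ode_clamp (p M h T : ℝ) (hp : 1 ≤ p) (hM : 0 < M) (hh : 0 < h) (hT : 0 ≤ T) (S : Finset (ι → ℤ)) (g : S → ℝ) :
    ∃ x : ℝ → S → ℝ, x 0 = g ∧ ∀ t, 0 ≤ t → t ≤ T → HasDerivAt x (fld p M h S (x t)) t := by
  obtain ⟨K, hK, hb, hl⟩ := fld_bd p M h hp hM hh S
  have hpl : IsPicardLindelof (fun _ : ℝ => fld p M h S) (tmin := -1) (tmax := T + 1) ⟨0, by constructor <;> linarith⟩ g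
      ⟨K * (T + 1), by positivity⟩ 0 ⟨K, hK⟩ ⟨K, hK⟩ := by
    refine ⟨fun t _ => ?_, fun x _ => continuousOn_const, fun t _ x _ => hb x, ?_⟩
    · exact (LipschitzWith.of_dist_le_mul fun x y => by
        rw [dist_eq_norm, dist_eq_norm]; exact hl x y).lipschitzOnWith
    · simp only [NNReal.coe_mk, NNReal.coe_zero, sub_zero, zero_sub, neg_neg]
      rw [max_eq_left (by linarith)]
      exact le_rfl
  obtain ⟨x, hx0, hx⟩ := hpl.exists_eq_forall_mem_Icc_hasDerivWithinAt (x := g) (by simp)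
  refine ⟨x, hx0, fun t ht1 ht2 => ?_⟩
  exact (hx t ⟨by linarith, by linarith⟩).hasDerivAt (Icc_mem_nhds (by linarith) (by linarith))

theorem Lp_ge_neg (h : ℝ) (hh : 0 < h) (f : (ι → ℤ) → ℝ) (k : ι → ℤ) (hf : ∀ j, 0 ≤ f j) :
    -(2 * Fintype.card ι / h ^ 2 * f k) ≤ Lp h f k := by
  unfold Lp
  have : ∑ e : ι × Bool, (- f k) ≤ ∑ e : ι × Bool, (f (k + dir e) - f k) :=
    Finset.sum_le_sum fun e _ => by linarith [hf (k + dir e)]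
  have e : ∑ e : ι × Bool, (- f k) = -(2 * Fintype.card ι * f k) := by
    rw [Finset.sum_const, Finset.card_univ, Fintype.card_prod, Fintype.card_bool, nsmul_eq_mul]; push_cast; ring
  rw [e] at this
  rw [div_mul_eq_mul_div, ← neg_div]
  gcongr

/-- The discrete solutions. -/
structure DSol (p M h T : ℝ) (S : Finset (ι → ℤ)) (g : (ι → ℤ) → ℝ) (u w : (ι → ℤ) → ℝ → ℝ) : Prop where
  pos : ∀ k ∈ S, ∀ t, 0 ≤ t → t ≤ T → 0 < u k t
  leM : ∀ k, ∀ t, 0 ≤ t → t ≤ T → u k t ≤ M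
  init : ∀ k ∈ S, u k 0 = g k
  out : ∀ k, k ∉ S → u k = 0 ∧ w k = 0
  du : ∀ k ∈ S, ∀ t, 0 ≤ t → t ≤ T → HasDerivAt (u k) (w k t) t
  eq : ∀ k ∈ S, ∀ t, 0 ≤ t → t ≤ T → w k t = u k t ^ p * Lp h (fun j => u j t) k
  dw : ∀ k ∈ S, ∀ t, 0 ≤ t → t ≤ T →
    HasDerivAt (w k) (u k t ^ p * Lp h (fun j => w j t) k + p / u k t * w k t ^ 2) t

theorem DSol_exists (p M h T : ℝ) (hp : 1 ≤ p) (hM : 0 < M) (hh : 0 < h) (hT : 0 ≤ T) (S : Finset (ι → ℤ)) (g : (ι → ℤ) → ℝ)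
    (hg : ∀ k, 0 < g k ∧ g k ≤ M) : ∃ u w, DSol p M h T S g u w := by
  obtain ⟨x, hx0, hx⟩ := ode_clamp p M h T hp hM hh hT S (fun k => g k)
  have hp0 : 0 < p := by linarith
  set u : (ι → ℤ) → ℝ → ℝ := fun k t => ext S (x t) k with hu
  have hext : ∀ (k : ι → ℤ) (hk : k ∈ S), u k = fun t => x t ⟨k, hk⟩ := by
    intro k hk; funext t; simp [hu, ext, hk]
  have hout : ∀ k : ι → ℤ, k ∉ S → u k = 0 := by
    intro k hk; funext t; simp [hu, ext, hk]
  have hu0 : ∀ k ∈ S, u k 0 = g k := by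
    intro k hk; rw [hext k hk]; simp only [hx0]
  set X : (ι → ℤ) → ℝ → ℝ := fun k t => tau M (u k t) with hX
  have hXe : ∀ t, (ext S fun k => tau M (x t k)) = fun j => X j t := by
    intro t; funext j; simp only [hX, hu, ext]
    split_ifs with hj
    · rfl
    · rw [tau_eq M 0 le_rfl hM.le]
  have hdu : ∀ k ∈ S, ∀ t, 0 ≤ t → t ≤ T → HasDerivAt (u k) (X k t ^ p * Lp h (fun j => X j t) k) t := by
    intro k hk t h0 h1
    have := (hasDerivAt_pi.mp (hx t h0 h1)) ⟨k, hk⟩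
    unfold fld at this
    rw [hXe t] at this
    have e : X k t = tau M (x t ⟨k, hk⟩) := by simp only [hX, hext k hk]
    rw [e, hext k hk]
    exact this
  have hcont : ∀ k ∈ S, ContinuousOn (u k) (Icc 0 T) := fun k hk t ht =>
    (hdu k hk t ht.1 ht.2).continuousAt.continuousWithinAt
  have hle : ∀ k ∈ S, ∀ t, 0 ≤ t → t ≤ T → 0 ≤ M - u k t := by
    apply cmp S h T 0 1 one_pos hT le_rfl (fun k t => M - u k t)
    · exact fun k hk => continuousOn_const.sub (hcont k hk)
    · intro k hk; rw [hu0 k hk]; linarith [(hg k).2]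
    · intro k hk e he t _ _; rw [hout _ he]; simpa using hM.le
    · intro k hk t h0 h1 _ h3
      refine ⟨_, 0, 0, (hdu k hk t h0.le h1).const_sub M, le_rfl, by simp, ?_⟩
      have hXk : X k t = M := by
        simp only [hX, tau]
        rw [min_eq_right (by linarith), max_eq_right hM.le]
      have : 0 ≤ Lp h (fun j => - X j t) k := Lp_nonneg_of_min h _ k fun e => by
        rw [hXk]; linarith [(tau_mem M (u (k + dir e) t) hM.le).2]
      rw [Lp_neg] at this
      have h5 : 0 ≤ X k t ^ p := by rw [hXk]; positivity
      nlinarith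
  have hge : ∀ k ∈ S, ∀ t, 0 ≤ t → t ≤ T → 0 ≤ u k t := by
    apply cmp S h T 0 1 one_pos hT le_rfl u hcont
    · intro k hk; rw [hu0 k hk]; linarith [(hg k).1]
    · intro k hk e he t _ _; rw [hout _ he]; simp
    · intro k hk t h0 h1 _ h3
      refine ⟨_, 0, 0, (hdu k hk t h0.le h1), le_rfl, by simp, ?_⟩
      have hXk : X k t = 0 := by
        simp only [hX, tau]
        rw [max_eq_left]
        exact (min_le_left _ _).trans h3
      rw [hXk, Real.zero_rpow hp0.ne']; simp
  have hge' : ∀ k, ∀ t, 0 ≤ t → t ≤ T → 0 ≤ u k t := by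
    intro k t h0 h1
    by_cases hk : k ∈ S
    · exact hge k hk t h0 h1
    · rw [hout k hk]; simp
  have hle' : ∀ k, ∀ t, 0 ≤ t → t ≤ T → u k t ≤ M := by
    intro k t h0 h1
    by_cases hk : k ∈ S
    · linarith [hle k hk t h0 h1]
    · rw [hout k hk]; simpa using hM.le
  have hXu : ∀ k, ∀ t, 0 ≤ t → t ≤ T → X k t = u k t := fun k t h0 h1 =>
    tau_eq M _ (hge' k t h0 h1) (hle' k t h0 h1)
  have hdu' : ∀ k ∈ S, ∀ t, 0 ≤ t → t ≤ T → HasDerivAt (u k) (u k t ^ p * Lp h (fun j => u j t) k) t := by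
    intro k hk t h0 h1
    have := hdu k hk t h0 h1
    rw [hXu k t h0 h1] at this
    have e : (fun j => X j t) = fun j => u j t := funext fun j => hXu j t h0 h1
    rwa [e] at this
  set L : ℝ := 2 * Fintype.card ι / h ^ 2 * M ^ p with hL
  have hL0 : 0 ≤ L := by positivity
  have hpos : ∀ k ∈ S, ∀ t, 0 ≤ t → t ≤ T → 0 ≤ (if k ∈ S then u k t - g k * Real.exp (-L * t) else 0) := by
    apply cmp S h T L 1 one_pos hT hL0 (fun k t => if k ∈ S then u k t - g k * Real.exp (-L * t) else 0)
    · intro k hk; simp only [hk, if_true]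
      exact (hcont k hk).sub (by fun_prop)
    · intro k hk; simp [hk, hu0 k hk]
    · intro k hk e he t _ _; simp [he]
    · intro k hk t h0 h1 _ h3
      simp only [hk, if_true] at h3 ⊢
      have hexp : HasDerivAt (fun t => g k * Real.exp (-L * t)) (g k * (Real.exp (-L * t) * (-L))) t := by
        have := ((hasDerivAt_id t).const_mul (-L)).exp.const_mul (g k)
        simpa using this
      refine ⟨_, 0, -L, (hdu' k hk t h0.le h1).sub hexp, le_rfl, by rw [abs_neg, abs_of_nonneg hL0], ?_⟩
      have h4 := Lp_ge_neg h hh (fun j => u j t) k (fun j => hge' j t h0.le h1)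
      have h5 := hge' k t h0.le h1
      have h6 : u k t ^ p ≤ M ^ p := Real.rpow_le_rpow h5 (hle' k t h0.le h1) hp0.le
      have h7 : 0 ≤ u k t ^ p := by positivity
      have h8 : -(L * u k t) ≤ u k t ^ p * Lp h (fun j => u j t) k := by
        have q0 : (0:ℝ) ≤ 2 * Fintype.card ι / h ^ 2 * u k t := by positivity
        have q1 : u k t ^ p * -(2 * Fintype.card ι / h ^ 2 * u k t) ≤ u k t ^ p * Lp h (fun j => u j t) k := by gcongr
        have q2 : u k t ^ p * (2 * Fintype.card ι / h ^ 2 * u k t) ≤ M ^ p * (2 * Fintype.card ι / h ^ 2 * u k t) := by gcongr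
        rw [hL]; nlinarith
      nlinarith
  have hpos' : ∀ k ∈ S, ∀ t, 0 ≤ t → t ≤ T → 0 < u k t := by
    intro k hk t h0 h1
    have := hpos k hk t h0 h1
    simp only [hk, if_true] at this
    have h2 : 0 < g k * Real.exp (-L * t) := mul_pos (hg k).1 (Real.exp_pos _)
    linarith
  set w : (ι → ℤ) → ℝ → ℝ := fun k t => if k ∈ S then u k t ^ p * Lp h (fun j => u j t) k else 0 with hw
  have hwout : ∀ k, k ∉ S → w k = 0 := by intro k hk; funext t; simp [hw, hk]
  have hweq : ∀ k ∈ S, ∀ t, w k t = u k t ^ p * Lp h (fun j => u j t) k := by intro k hk t; simp [hw, hk]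
  have hduw : ∀ k, ∀ t, 0 ≤ t → t ≤ T → HasDerivAt (u k) (w k t) t := by
    intro k t h0 h1
    by_cases hk : k ∈ S
    · rw [hweq k hk]; exact hdu' k hk t h0 h1
    · rw [hout k hk, hwout k hk]; exact hasDerivAt_const _ _
  refine ⟨u, w, ⟨hpos', hle', hu0, fun k hk => ⟨hout k hk, hwout k hk⟩, fun k _ => hduw k, fun k hk t _ _ => hweq k hk t, ?_⟩⟩
  intro k hk t h0 h1
  have hL : HasDerivAt (fun s => Lp h (fun j => u j s) k) (Lp h (fun j => w j t) k) t := by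
    unfold Lp
    apply HasDerivAt.div_const
    exact HasDerivAt.fun_sum fun e _ => (hduw _ t h0 h1).sub (hduw _ t h0 h1)
  have hk0 := hpos' k hk t h0 h1
  have hP := (hduw k t h0 h1).rpow_const (p := p) (Or.inl hk0.ne')
  have hPL := hP.mul hL
  have e1 : w k = fun s => u k s ^ p * Lp h (fun j => u j s) k := funext fun s => hweq k hk s
  have e2 : u k t ^ p * Lp h (fun j => w j t) k + p / u k t * w k t ^ 2 =
     w k t * p * u k t ^ (p - 1) * Lp h (fun j => u j t) k + u k t ^ p * Lp h (fun j => w j t) k := by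
    have e3 : w k t ^ 2 = w k t * (u k t ^ p * Lp h (fun j => u j t) k) := by rw [sq]; nth_rewrite 2 [hweq k hk t]; rfl
    rw [e3, Real.rpow_sub_one hk0.ne']
    field_simp
    ring
  rw [e2, e1]
  exact hPL.congr_deriv (by simp only [e1])

end FW

namespace FW
variable {ι : Type*} [Fintype ι] [DecidableEq ι]

section AB
variable {p M h T : ℝ} {S : Finset (ι → ℤ)} {g : (ι → ℤ) → ℝ} {u w : (ι → ℤ) → ℝ → ℝ}

theorem DSol.nonneg (H : DSol p M h T S g u w) (k : ι → ℤ) (t : ℝ) (h0 : 0 ≤ t) (h1 : t ≤ T) : 0 ≤ u k t := by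
  by_cases hk : k ∈ S
  · exact (H.pos k hk t h0 h1).le
  · rw [(H.out k hk).1]; simp

theorem DSol.duAll (H : DSol p M h T S g u w) (k : ι → ℤ) (t : ℝ) (h0 : 0 ≤ t) (h1 : t ≤ T) :
    HasDerivAt (u k) (w k t) t := by
  by_cases hk : k ∈ S
  · exact (H.du k hk t h0 h1)
  · rw [(H.out k hk).1, (H.out k hk).2]; exact hasDerivAt_const _ _

theorem DSol.cont (H : DSol p M h T S g u w) (k : ι → ℤ) : ContinuousOn (u k) (Icc 0 T) := fun t ht =>
  (H.duAll k t ht.1 ht.2).continuousAt.continuousWithinAt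

theorem DSol.contw (H : DSol p M h T S g u w) (k : ι → ℤ) : ContinuousOn (w k) (Icc 0 T) := by
  by_cases hk : k ∈ S
  · exact fun t ht => (H.dw k hk t ht.1 ht.2).continuousAt.continuousWithinAt
  · rw [(H.out k hk).2]; exact continuousOn_const

/-- Aronson–Bénilan. -/
theorem DSol.AB (H : DSol p M h T S g u w) (hp : 1 ≤ p) (hT : 0 ≤ T) :
    ∀ k ∈ S, ∀ t, 0 ≤ t → t ≤ T → 0 ≤ u k t + p * t * w k t := by
  have hbd : ∀ k : ι → ℤ, ∃ B : ℝ, 0 ≤ B ∧ (k ∈ S → ∀ t ∈ Icc 0 T, |p * w k t / u k t| ≤ B) := by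
    intro k
    by_cases hk : k ∈ S
    · have hc : ContinuousOn (fun t => p * w k t / u k t) (Icc 0 T) :=
        (continuousOn_const.mul (H.contw k)).div (H.cont k) (fun t ht => (H.pos k hk t ht.1 ht.2).ne')
      obtain ⟨B, hB⟩ := isCompact_Icc.exists_bound_of_continuousOn hc
      exact ⟨max B 0, le_max_right _ _, fun _ t ht => (hB t ht).trans (le_max_left _ _)⟩
    · exact ⟨0, le_rfl, fun h => absurd h hk⟩
  choose B hB0 hB using hbd
  apply cmp S h T (∑ k ∈ S, B k) 1 one_pos hT (Finset.sum_nonneg fun k _ => hB0 k) (fun k t => u k t + p * t * w k t)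
  · exact fun k hk => (H.cont k).add ((by fun_prop : ContinuousOn (fun t => p * t) (Icc 0 T)).mul (H.contw k))
  · intro k hk; simpa using H.nonneg k 0 le_rfl hT
  · intro k hk e he t _ _; rw [(H.out _ he).1, (H.out _ he).2]; simp
  · intro k hk t h0 h1 _ _
    have d1 := H.du k hk t h0.le h1
    have d2 := H.dw k hk t h0.le h1
    have d3 : HasDerivAt (fun t : ℝ => p * t) p t := by simpa using (hasDerivAt_id t).const_mul p
    have hu := H.pos k hk t h0.le h1
    refine ⟨_, u k t ^ p, p * w k t / u k t, d1.add (d3.mul d2), by positivity, ?_, ?_⟩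
    · exact (hB k hk t ⟨h0.le, h1⟩).trans (Finset.single_le_sum (f := B) (fun k _ => hB0 k) hk)
    · rw [Lp_add, Lp_const_mul]
      have e := H.eq k hk t h0.le h1
      apply le_of_eq
      rw [mul_add, ← e]
      field_simp
      ring

theorem DSol.Lp_ge (H : DSol p M h T S g u w) (hp : 1 ≤ p) (hT : 0 ≤ T) (k : ι → ℤ) (hk : k ∈ S) (t lo : ℝ) (h0 : 0 < t) (h1 : t ≤ T)
    (hlo : 0 < lo) (hu : lo ≤ u k t) : -(lo ^ (1 - p) / (p * t)) ≤ Lp h (fun j => u j t) k := by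
  have h2 := H.AB hp hT k hk t h0.le h1
  have e := H.eq k hk t h0.le h1
  have hup := H.pos k hk t h0.le h1
  set L := Lp h (fun j => u j t) k
  have hP : 0 < u k t ^ p := by positivity
  rw [e] at h2
  have h3 : u k t ^ (1 - p) ≤ lo ^ (1 - p) := Real.rpow_le_rpow_of_nonpos hlo hu (by linarith)
  have h4 : u k t ^ (1 - p) * u k t ^ p = u k t := by
    rw [← Real.rpow_add hup]; simp
  have h5 : 0 ≤ u k t ^ (1 - p) + p * t * L := by
    by_contra hcon
    push Not at hcon
    nlinarith
  have hpt : 0 < p * t := by positivity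
  rw [neg_le, ← sub_nonneg]
  have : lo ^ (1 - p) / (p * t) - -L = (lo ^ (1 - p) + p * t * L) / (p * t) := by field_simp; ring
  rw [this]
  apply div_nonneg _ hpt.le
  linarith

theorem DSol.mono (H : DSol p M h T S g u w) (hp : 1 ≤ p) (k : ι → ℤ) (hk : k ∈ S) (s t : ℝ) (h0 : 0 < s) (hst : s ≤ t) (h1 : t ≤ T) :
    s ^ (1 / p) * u k s ≤ t ^ (1 / p) * u k t := by
  have hp0 : 0 < p := by linarith
  have hd : ∀ x ∈ Icc s t, HasDerivAt (fun x => x ^ (1 / p) * u k x)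
      (1 / p * x ^ (1 / p - 1) * u k x + x ^ (1 / p) * w k x) x := by
    intro x hx
    have hx0 : 0 < x := by linarith [hx.1]
    have := (Real.hasDerivAt_rpow_const (x := x) (p := 1 / p) (Or.inl hx0.ne')).mul (H.du k hk x hx0.le (hx.2.trans h1))
    exact this
  have : MonotoneOn (fun x => x ^ (1 / p) * u k x) (Icc s t) := by
    apply monotoneOn_of_hasDerivWithinAt_nonneg (convex_Icc s t) (f' := fun x => 1 / p * x ^ (1 / p - 1) * u k x + x ^ (1 / p) * w k x)
    · exact fun x hx => (hd x hx).continuousAt.continuousWithinAt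
    · intro x hx
      rw [interior_Icc] at hx
      exact (hd x ⟨hx.1.le, hx.2.le⟩).hasDerivWithinAt
    · intro x hx
      rw [interior_Icc] at hx
      have hx0 : 0 < x := by linarith [hx.1]
      have := H.AB hp (by linarith) k hk x hx0.le (hx.2.le.trans h1)
      have e : 1 / p * x ^ (1 / p - 1) * u k x + x ^ (1 / p) * w k x = x ^ (1 / p - 1) / p * (u k x + p * x * w k x) := by
        rw [Real.rpow_sub_one hx0.ne']; field_simp
      rw [e]
      positivity
  exact this ⟨le_rfl, hst⟩ ⟨hst, le_rfl⟩ hst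

theorem DSol.intU (H : DSol p M h T S g u w) (hT : 0 ≤ T) (Φ : ℝ → ℝ)
    (hΦ : ∀ s, 0 < s → HasDerivAt Φ (s ^ (-p)) s) (k : ι → ℤ) (hk : k ∈ S) :
    Lp h (fun j => ∫ t in (0:ℝ)..T, u j t) k = Φ (u k T) - Φ (g k) := by
  have hint : ∀ j, IntervalIntegrable (u j) volume 0 T := fun j =>
    ContinuousOn.intervalIntegrable (by rw [uIcc_of_le hT]; exact H.cont j)
  have e1 : Lp h (fun j => ∫ t in (0:ℝ)..T, u j t) k = ∫ t in (0:ℝ)..T, Lp h (fun j => u j t) k := by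
    unfold Lp
    rw [intervalIntegral.integral_div, intervalIntegral.integral_finset_sum]
    · congr 1
      refine Finset.sum_congr rfl fun e _ => ?_
      rw [intervalIntegral.integral_sub (hint _) (hint _)]
    · exact fun e _ => (hint _).sub (hint _)
  have e2 : ∀ t ∈ uIcc 0 T, HasDerivAt (fun t => Φ (u k t)) (Lp h (fun j => u j t) k) t := by
    intro t ht
    rw [uIcc_of_le hT] at ht
    have hu := H.pos k hk t ht.1 ht.2
    have := (hΦ _ hu).comp t (H.du k hk t ht.1 ht.2)
    refine this.congr_deriv ?_
    rw [H.eq k hk t ht.1 ht.2, Real.rpow_neg hu.le]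
    have : 0 < u k t ^ p := by positivity
    field_simp
  rw [e1, intervalIntegral.integral_eq_sub_of_hasDerivAt e2, H.init k hk]
  apply ContinuousOn.intervalIntegrable
  rw [uIcc_of_le hT]
  unfold Lp
  apply ContinuousOn.div_const
  exact continuousOn_finsetSum _ fun e _ => (H.cont _).sub (H.cont _)

theorem int_rpow_ii {a b : ℝ} (ha : 0 < a) (hab : a ≤ b) (q : ℝ) : IntervalIntegrable (fun t : ℝ => t ^ q) volume a b := by
  apply ContinuousOn.intervalIntegrable
  rw [uIcc_of_le hab]
  exact continuousOn_id.rpow_const (fun x hx => Or.inl (by simp only [id]; linarith [hx.1]))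

theorem DSol.U_le (H : DSol p M h T S g u w) (hp : 1 ≤ p) (hM : 0 ≤ M) (hT : 1 ≤ T) (k : ι → ℤ) (hk : k ∈ S) :
    ∫ t in (0:ℝ)..T, u k t ≤ M + T ^ (1 / p) * (∫ t in (1:ℝ)..T, t ^ (-(1 / p))) * u k T := by
  have hc := H.cont k
  have i1 : IntervalIntegrable (u k) volume 0 1 :=
    ContinuousOn.intervalIntegrable (by rw [uIcc_of_le zero_le_one]; exact hc.mono (Icc_subset_Icc le_rfl hT))
  have i2 : IntervalIntegrable (u k) volume 1 T :=
    ContinuousOn.intervalIntegrable (by rw [uIcc_of_le hT]; exact hc.mono (Icc_subset_Icc zero_le_one le_rfl))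
  rw [← intervalIntegral.integral_add_adjacent_intervals i1 i2]
  have a1 : ∫ t in (0:ℝ)..1, u k t ≤ ∫ t in (0:ℝ)..1, M :=
    intervalIntegral.integral_mono_on zero_le_one i1 (by simp) (fun t ht => H.leM k t ht.1 (ht.2.trans hT))
  have a2 : ∫ t in (1:ℝ)..T, u k t ≤ ∫ t in (1:ℝ)..T, (T ^ (1 / p) * u k T) * t ^ (-(1 / p)) := by
    apply intervalIntegral.integral_mono_on hT i2 ((int_rpow_ii one_pos hT _).const_mul _)
    intro t ht
    have ht0 : 0 < t := by linarith [ht.1]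
    have := H.mono hp k hk t T ht0 ht.2 le_rfl
    rw [Real.rpow_neg ht0.le, ← div_eq_mul_inv, le_div_iff₀ (by positivity)]
    linarith
  rw [intervalIntegral.integral_const_mul] at a2
  simp at a1
  nlinarith

theorem DSol.U_ge (H : DSol p M h T S g u w) (hp : 1 ≤ p) (T0 : ℝ) (hT0 : 0 < T0) (hT : T0 ≤ T) (k : ι → ℤ) (hk : k ∈ S) :
    T0 ^ (1 / p) * u k T0 * (∫ t in T0..T, t ^ (-(1 / p))) ≤ ∫ t in (0:ℝ)..T, u k t := by
  have hc := H.cont k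
  have i1 : IntervalIntegrable (u k) volume 0 T0 :=
    ContinuousOn.intervalIntegrable (by rw [uIcc_of_le hT0.le]; exact hc.mono (Icc_subset_Icc le_rfl hT))
  have i2 : IntervalIntegrable (u k) volume T0 T :=
    ContinuousOn.intervalIntegrable (by rw [uIcc_of_le hT]; exact hc.mono (Icc_subset_Icc hT0.le le_rfl))
  rw [← intervalIntegral.integral_add_adjacent_intervals i1 i2]
  have a1 : 0 ≤ ∫ t in (0:ℝ)..T0, u k t :=
    intervalIntegral.integral_nonneg hT0.le fun t ht => H.nonneg k t ht.1 (ht.2.trans hT)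
  have a2 : ∫ t in T0..T, (T0 ^ (1 / p) * u k T0) * t ^ (-(1 / p)) ≤ ∫ t in T0..T, u k t := by
    apply intervalIntegral.integral_mono_on hT ((int_rpow_ii hT0 hT _).const_mul _) i2
    intro t ht
    have ht0 : 0 < t := by linarith [ht.1]
    have := H.mono hp k hk T0 t hT0 ht.1 ht.2
    rw [Real.rpow_neg ht0.le, ← div_eq_mul_inv, div_le_iff₀ (by positivity)]
    linarith
  rw [intervalIntegral.integral_const_mul] at a2
  linarith

/-- The core decay estimate for discrete solutions. -/
theorem DSol.decay [Nonempty ι] (H : DSol p M h T S g u w) (hp : 1 ≤ p) (hM : 0 < M) (hh : 0 < h) (hT : 1 ≤ T)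
    (hg : ∀ k, 0 < g k ∧ g k ≤ M) (Φ : ℝ → ℝ) (hΦ : ∀ s, 0 < s → HasDerivAt Φ (s ^ (-p)) s)
    (R ε m D : ℝ) (hR : 0 < R) (hhR : h ≤ R) (hε : 0 < ε) (hm : 0 < m) (hD : 0 < D)
    (hgε : ∀ k : ι → ℤ, (∃ i, R < |h * (k i : ℝ)|) → g k ≤ ε)
    (hD1 : Φ M - Φ m ≤ D) (hD2 : 8 * D < Φ m - Φ ε) (k : ι → ℤ) (hk : k ∈ S) :
    ∫ t in (0:ℝ)..T, u k t ≤ M + T ^ (1 / p) * (∫ t in (1:ℝ)..T, t ^ (-(1 / p))) * m + 16 * R ^ 2 * D := by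
  set n : ℝ := (Fintype.card ι : ℝ) with hn
  have hn0 : 0 < n := by rw [hn]; exact_mod_cast Fintype.card_pos
  have hΦm : MonotoneOn Φ (Ioi 0) := by
    apply monotoneOn_of_hasDerivWithinAt_nonneg (convex_Ioi 0) (f' := fun s => s ^ (-p))
    · exact fun x hx => (hΦ x hx).continuousAt.continuousWithinAt
    · intro x hx
      rw [interior_Ioi] at hx
      exact (hΦ x hx).hasDerivWithinAt
    · intro x hx
      rw [interior_Ioi] at hx
      have : 0 < x := hx
      positivity
  set J := T ^ (1 / p) * (∫ t in (1:ℝ)..T, t ^ (-(1 / p))) with hJ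
  have hJ0 : 0 ≤ J := by
    apply mul_nonneg (by positivity)
    exact intervalIntegral.integral_nonneg hT fun t ht => by
      have : 0 < t := by linarith [ht.1]
      positivity
  set a := 8 * R ^ 2 * D / n with ha
  have ha0 : 0 < a := by positivity
  have hna : n * a = 8 * R ^ 2 * D := by rw [ha]; field_simp
  set U : (ι → ℤ) → ℝ := fun j => ∫ t in (0:ℝ)..T, u j t with hU
  set Z : (ι → ℤ) → ℝ := fun j => a * ∑ i, (1 + Real.cos (h / R * (j i : ℝ))) with hZ
  have hZ0 : ∀ j, 0 ≤ Z j := fun j => mul_nonneg ha0.le (Finset.sum_nonneg fun i _ => by linarith [Real.neg_one_le_cos (h / R * (j i : ℝ))])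
  have hZ1 : ∀ j, Z j ≤ 16 * R ^ 2 * D := by
    intro j
    have : ∑ i, (1 + Real.cos (h / R * (j i : ℝ))) ≤ ∑ i : ι, (2:ℝ) :=
      Finset.sum_le_sum fun i _ => by linarith [Real.cos_le_one (h / R * (j i : ℝ))]
    have e : ∑ i : ι, (2:ℝ) = n * 2 := by simp [hn]
    rw [e] at this
    calc Z j ≤ a * (n * 2) := by simp only [hZ]; gcongr
      _ = _ := by linarith
  set q := 2 * (1 - Real.cos (h / R)) / h ^ 2 with hq
  have hx1 : |h / R| ≤ 1 := by
    rw [abs_of_pos (by positivity), div_le_one hR]; exact hhR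
  have hq1 : q ≤ 1 / R ^ 2 := by
    have := one_sub_cos_le (h / R)
    rw [hq, div_le_div_iff₀ (by positivity) (by positivity)]
    have e : (h / R) ^ 2 * R ^ 2 = h ^ 2 := by field_simp
    nlinarith [sq_nonneg R]
  have hq2 : 1 / (2 * R ^ 2) ≤ q := by
    have := le_one_sub_cos hx1
    rw [hq, div_le_div_iff₀ (by positivity) (by positivity)]
    have e : (h / R) ^ 2 * R ^ 2 = h ^ 2 := by field_simp
    nlinarith [sq_nonneg R]
  have hq0 : 0 ≤ q := le_trans (by positivity) hq2
  have hLZ : ∀ j, Lp h Z j = a * ∑ i, (-q * Real.cos (h / R * (j i : ℝ))) := by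
    intro j
    simp only [hZ]
    rw [Lp_const_mul, Lp_sum]
    congr 1
    refine Finset.sum_congr rfl fun i _ => ?_
    rw [Lp_coord h (fun z : ℤ => 1 + Real.cos (h / R * (z : ℝ))) i j]
    have := cos_rec (h / R) (j i)
    rw [hq]
    field_simp
    field_simp at this
    linarith
  by_contra hcon
  push Not at hcon
  obtain ⟨k0, hk0, hmax⟩ := S.exists_max_image (fun j => U j - Z j) ⟨k, hk⟩
  have h1 : M + J * m < U k0 - Z k0 := by
    have := hmax k hk
    have := hZ1 k
    simp only [hU] at *
    linarith
  have hLp : 0 ≤ Lp h (fun j => Z j - U j) k0 := by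
    apply Lp_nonneg_of_min
    intro e
    by_cases he : k0 + dir e ∈ S
    · linarith [hmax _ he]
    · have : U (k0 + dir e) = 0 := by simp only [hU]; rw [(H.out _ he).1]; simp
      rw [this]
      have := hZ0 (k0 + dir e)
      have : 0 ≤ J * m := by positivity
      linarith
  rw [Lp_sub] at hLp
  have hLU : Lp h U k0 = Φ (u k0 T) - Φ (g k0) := H.intU (by linarith) Φ hΦ k0 hk0
  have hum : m ≤ u k0 T := by
    have := H.U_le hp hM.le hT k0 hk0
    have h3 : J * m < J * u k0 T := by
      have := hZ0 k0
      simp only [hU] at *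
      linarith
    exact (lt_of_mul_lt_mul_left h3 hJ0).le
  have h4 : Φ m ≤ Φ (u k0 T) := hΦm hm (lt_of_lt_of_le hm hum) hum
  by_cases hin : ∃ i, R < |h * (k0 i : ℝ)|
  · have h5 : Φ (g k0) ≤ Φ ε := hΦm (hg k0).1 hε (hgε k0 hin)
    have h6 : Lp h Z k0 ≤ 8 * D := by
      rw [hLZ]
      have : ∑ i, (-q * Real.cos (h / R * (k0 i : ℝ))) ≤ ∑ i : ι, q := Finset.sum_le_sum fun i _ => by
        nlinarith [Real.neg_one_le_cos (h / R * (k0 i : ℝ))]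
      have e : ∑ i : ι, q = n * q := by simp [hn]
      rw [e] at this
      calc _ ≤ a * (n * q) := by gcongr
        _ ≤ a * (n * (1 / R ^ 2)) := by gcongr
        _ = n * a / R ^ 2 := by ring
        _ = 8 * D := by rw [hna]; field_simp
    linarith
  · push Not at hin
    have h5 : Φ (g k0) ≤ Φ M := hΦm (hg k0).1 hM (hg k0).2
    have h6 : Lp h Z k0 ≤ -(2 * D) := by
      rw [hLZ]
      have : ∑ i, (-q * Real.cos (h / R * (k0 i : ℝ))) ≤ ∑ i : ι, -(q * (1 / 2)) := Finset.sum_le_sum fun i _ => by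
        have : |h / R * (k0 i : ℝ)| ≤ 1 := by
          have e : h / R * (k0 i : ℝ) = h * (k0 i : ℝ) / R := by ring
          rw [e, abs_div, abs_of_pos hR, div_le_one hR]
          exact hin i
        nlinarith [cos_ge_half this]
      have e : ∑ i : ι, -(q * (1 / 2)) = -(n * (q * (1 / 2))) := by simp [hn]
      rw [e] at this
      calc _ ≤ a * -(n * (q * (1 / 2))) := by gcongr
        _ = -(a * (n * (q * (1 / 2)))) := by ring
        _ ≤ -(a * (n * (1 / (2 * R ^ 2) * (1 / 2)))) := by gcongr
        _ = -(n * a / (4 * R ^ 2)) := by field_simp; ring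
        _ = -(2 * D) := by rw [hna]; field_simp; ring
    linarith

end AB
end FW

namespace FW
variable {ι : Type*} [Fintype ι] [DecidableEq ι]

section DF
variable {p M h T : ℝ} {S : Finset (ι → ℤ)} {g : (ι → ℤ) → ℝ} {u w : (ι → ℤ) → ℝ → ℝ}

theorem DSol.restrict (H : DSol p M h T S g u w) {T' : ℝ} (hT : T' ≤ T) : DSol p M h T' S g u w :=
  ⟨fun k hk t h0 h1 => H.pos k hk t h0 (h1.trans hT), fun k t h0 h1 => H.leM k t h0 (h1.trans hT), H.init, H.out,
   fun k hk t h0 h1 => H.du k hk t h0 (h1.trans hT), fun k hk t h0 h1 => H.eq k hk t h0 (h1.trans hT),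
   fun k hk t h0 h1 => H.dw k hk t h0 (h1.trans hT)⟩

def GEps (h R ε M : ℝ) (g : (ι → ℤ) → ℝ) : Prop :=
  (∀ k, 0 < g k ∧ g k ≤ M) ∧ ∀ k : ι → ℤ, (∃ i, R < |h * (k i : ℝ)|) → g k ≤ ε

theorem decay_p1 [Nonempty ι] (M α : ℝ) (hM : 0 < M) (hα : 0 < α) : ∃ C l0 : ℝ, 0 < C ∧
    ∀ (h T0 R : ℝ) (S : Finset (ι → ℤ)) (g : (ι → ℤ) → ℝ) (u w : (ι → ℤ) → ℝ → ℝ),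
    0 < h → h ≤ 1 → 1 ≤ R → l0 ≤ Real.log T0 → 1 < T0 → DSol 1 M h (T0 ^ 2) S g u w →
    GEps h R (M * Real.exp (-α * (Real.log (T0 ^ 2)) ^ 2)) M g →
    ∀ k ∈ S, T0 ^ (1 / (1:ℝ)) * u k T0 ≤ C * R ^ (2 / (1:ℝ)) := by
  refine ⟨2 * M + 64, max 1 (10 / α), by positivity, ?_⟩
  intro h T0 R S g u w hh hh1 hR hl hT01 H hg k hk
  have hl1 : 1 ≤ Real.log T0 := (le_max_left _ _).trans hl
  have hl2 : 10 / α ≤ Real.log T0 := (le_max_right _ _).trans hl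
  rw [div_le_iff₀ hα] at hl2
  have hT00 : 0 < T0 := by linarith
  set T := T0 ^ 2 with hT
  have hT1 : 1 ≤ T := by nlinarith
  have hT0' : 0 < T := by linarith
  have hlT : Real.log T = 2 * Real.log T0 := by rw [hT, Real.log_pow]; norm_num
  set l := Real.log T0 with hl'
  have hm : 0 < M / T ^ 2 := by positivity
  have hΦm : Real.log (M / T ^ 2) = Real.log M - 4 * l := by
    rw [Real.log_div hM.ne' (by positivity), Real.log_pow, hlT]; push_cast; ring
  have key := H.decay le_rfl hM hh hT1 hg.1 Real.log
    (fun s hs => by rw [Real.rpow_neg_one]; exact Real.hasDerivAt_log hs.ne') R _ (M / T ^ 2) (4 * l)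
    (by linarith) (by linarith) (by positivity) hm (by linarith) hg.2 (by rw [hΦm]; linarith)
    (by
      rw [hΦm, Real.log_mul hM.ne' (Real.exp_pos _).ne', Real.log_exp, hlT]
      nlinarith) k hk
  have k2 := H.U_ge le_rfl T0 hT00 (by nlinarith) k hk
  have eJ : ∀ a b : ℝ, 0 < a → a ≤ b → ∫ t in a..b, t ^ (-(1 / (1:ℝ))) = Real.log b - Real.log a := by
    intro a b ha hab
    have e0 : (fun t : ℝ => t ^ (-(1 / (1:ℝ)))) = fun t => t⁻¹ := by
      funext t; rw [div_one, Real.rpow_neg_one]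
    rw [e0, integral_inv_of_pos ha (by linarith), Real.log_div (by linarith) ha.ne']
  rw [eJ T0 T hT00 (by nlinarith), hlT] at k2
  rw [eJ 1 T one_pos hT1, hlT, Real.log_one] at key
  have e1 : T ^ (1 / (1:ℝ)) = T := by simp
  have e2 : T0 ^ (1 / (1:ℝ)) = T0 := by simp
  have e3 : R ^ (2 / (1:ℝ)) = R ^ 2 := by rw [div_one]; exact Real.rpow_two R
  rw [e1] at key
  rw [e2] at k2 ⊢
  rw [e3]
  have hlT0 : l ≤ T0 := (Real.log_le_sub_one_of_pos hT00).trans (by linarith)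
  have e4 : T * (2 * l - 0) * (M / T ^ 2) = 2 * l * M / T := by field_simp; ring
  rw [e4] at key
  have h5 : 2 * l * M / T ≤ M := by
    rw [div_le_iff₀ hT0']
    have h2T : 2 * l ≤ T := by
      have := Real.log_le_sub_one_of_pos hT0'
      linarith
    nlinarith
  have h6 : T0 * u k T0 * l ≤ 2 * M + 64 * R ^ 2 * l := by linarith
  have h7 : 2 * M + 64 * R ^ 2 * l ≤ (2 * M + 64) * R ^ 2 * l := by
    have : 1 ≤ R ^ 2 * l := by nlinarith
    nlinarith
  exact le_of_mul_le_mul_right (h6.trans h7) (by linarith)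

theorem decay_pgt [Nonempty ι] (p M α : ℝ) (hp : 1 < p) (hM : 0 < M) (hα : 0 < α) : ∃ C l0 : ℝ, 0 < C ∧
    ∀ (h T0 R : ℝ) (S : Finset (ι → ℤ)) (g : (ι → ℤ) → ℝ) (u w : (ι → ℤ) → ℝ → ℝ),
    0 < h → h ≤ 1 → 1 ≤ R → l0 ≤ Real.log T0 → 1 < T0 → DSol p M h (T0 ^ 2) S g u w →
    GEps h R (M * Real.exp (-α * (Real.log (T0 ^ 2)) ^ 2)) M g →
    ∀ k ∈ S, T0 ^ (1 / p) * u k T0 ≤ C * R ^ (2 / p) := by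
  have hp1 : 0 < p - 1 := by linarith
  have hp0 : 0 < p := by linarith
  set q := p - 1 with hq
  refine ⟨2 * (M + (p + 16) / q), max 1 ((1 + |Real.log M| + Real.log 9 / q) / α), by positivity, ?_⟩
  intro h T0 R S g u w hh hh1 hR hl hT01 H hg k hk
  have hl1 : 1 ≤ Real.log T0 := (le_max_left _ _).trans hl
  have hl2 : _ ≤ Real.log T0 := (le_max_right _ _).trans hl
  rw [div_le_iff₀ hα] at hl2
  have hT00 : 0 < T0 := by linarith
  have hR0 : 0 < R := by linarith
  have hT02 : 2 ≤ T0 := by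
    have := Real.log_le_sub_one_of_pos hT00
    linarith
  set T := T0 ^ 2 with hT
  have hT1 : 1 ≤ T := by nlinarith
  have hT0' : 0 < T := by linarith
  have hlT : Real.log T = 2 * Real.log T0 := by rw [hT, Real.log_pow]; norm_num
  set l := Real.log T0 with hl'
  set m := R ^ (2 / p) * T ^ (-(1 / p)) with hm
  have hm0 : 0 < m := by positivity
  set D := m ^ (1 - p) / q with hD
  have hD0 : 0 < D := by positivity
  set Φ : ℝ → ℝ := fun s => -(s ^ (1 - p)) / q with hΦ
  have hΦd : ∀ s, 0 < s → HasDerivAt Φ (s ^ (-p)) s := by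
    intro s hs
    have := ((Real.hasDerivAt_rpow_const (x := s) (p := 1 - p) (Or.inl hs.ne')).neg).div_const q
    refine this.congr_deriv ?_
    have e : 1 - p - 1 = -p := by ring
    rw [e, hq]
    have : p - 1 ≠ 0 := by rw [← hq]; exact hp1.ne'
    field_simp
    ring
  have hlm : -(2 * l) ≤ Real.log m := by
    rw [hm, Real.log_mul (by positivity) (by positivity), Real.log_rpow hR0, Real.log_rpow hT0', hlT]
    have a1 : 0 ≤ 2 / p * Real.log R := mul_nonneg (by positivity) (Real.log_nonneg hR)
    have a2 : 1 / p ≤ 1 := by rw [div_le_one hp0]; linarith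
    nlinarith
  have key := H.decay hp.le hM hh hT1 hg.1 Φ hΦd R _ m D
    (by linarith) (by linarith) (by positivity) hm0 hD0 hg.2 (by
      simp only [hΦ, hD]
      have : 0 < M ^ (1 - p) := by positivity
      rw [← sub_div, div_le_div_iff_of_pos_right hp1]
      linarith)
    (by
      simp only [hΦ, hD]
      set ε := M * Real.exp (-α * Real.log T ^ 2) with hε
      have hε0 : 0 < ε := by positivity
      have hle : Real.log ε = Real.log M - α * (2 * l) ^ 2 := by
        rw [hε, Real.log_mul hM.ne' (Real.exp_pos _).ne', Real.log_exp, hlT]; ring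
      have h9 : 9 * m ^ (1 - p) < ε ^ (1 - p) := by
        rw [← Real.log_lt_log_iff (by positivity) (by positivity), Real.log_mul (by norm_num) (by positivity),
          Real.log_rpow hm0, Real.log_rpow hε0, hle]
        have e : 1 - p = -q := by rw [hq]; ring
        rw [e]
        have b1 : Real.log M ≤ |Real.log M| := le_abs_self _
        have b2 : -q * Real.log m ≤ q * (2 * l) := by nlinarith
        have b0 : 0 ≤ Real.log 9 / q := div_nonneg (Real.log_nonneg (by norm_num)) hp1.le
        have b3 : Real.log 9 = q * (Real.log 9 / q) := by field_simp
        have b4 : Real.log 9 / q + 2 * l + Real.log M < α * (2 * l) ^ 2 := by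
          have c1 : 4 * l * (l * α) = α * (2 * l) ^ 2 := by ring
          have c2 : 4 * l * (1 + |Real.log M| + Real.log 9 / q) ≤ 4 * l * (l * α) := by gcongr
          have c3 := abs_nonneg (Real.log M)
          nlinarith
        have b5 : q * (Real.log 9 / q + 2 * l + Real.log M) < q * (α * (2 * l) ^ 2) := by gcongr
        nlinarith
      rw [← sub_div, ← mul_div_assoc, div_lt_div_iff_of_pos_right hp1]
      linarith) k hk
  have k2 := H.U_ge hp.le T0 hT00 (by nlinarith) k hk
  have hTp : 0 < T ^ (1 - 1 / p) := by positivity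
  have hTp1 : 1 ≤ T ^ (1 - 1 / p) := Real.one_le_rpow hT1 (by rw [sub_nonneg, div_le_one hp0]; linarith)
  have hRp1 : 1 ≤ R ^ (2 / p) := Real.one_le_rpow hR (by positivity)
  -- upper integral
  have hJ : ∫ t in (1:ℝ)..T, t ^ (-(1 / p)) ≤ p / q * T ^ (1 - 1 / p) := by
    rw [integral_rpow (Or.inl (by
      have : 1 / p < 1 := by rw [div_lt_one hp0]; exact hp
      linarith))]
    have e : -(1 / p) + 1 = 1 - 1 / p := by ring
    rw [e, Real.one_rpow]
    have e2 : p / q * T ^ (1 - 1 / p) = T ^ (1 - 1 / p) / (1 - 1 / p) := by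
      rw [hq]
      have : p - 1 ≠ 0 := by rw [← hq]; exact hp1.ne'
      have h3 : 1 - 1 / p = (p - 1) / p := by field_simp
      rw [div_mul_eq_mul_div, eq_div_iff (by rw [h3]; positivity)]
      nth_rewrite 2 [h3]
      field_simp
    rw [e2]
    have h3 : 0 < 1 - 1 / p := by rw [sub_pos, div_lt_one hp0]; exact hp
    gcongr
    linarith
  have hI : T ^ (1 - 1 / p) / 2 ≤ ∫ t in T0..T, t ^ (-(1 / p)) := by
    have hTT : T0 ≤ T := by nlinarith
    have : ∫ t in T0..T, T ^ (-(1 / p)) ≤ ∫ t in T0..T, t ^ (-(1 / p)) := by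
      apply intervalIntegral.integral_mono_on hTT (by simp) (int_rpow_ii hT00 hTT _)
      intro t ht
      have : 0 < t := by linarith [ht.1]
      apply Real.rpow_le_rpow_of_nonpos this ht.2
      rw [neg_nonpos]; positivity
    refine le_trans ?_ this
    rw [intervalIntegral.integral_const, smul_eq_mul]
    have e : T ^ (1 - 1 / p) = T * T ^ (-(1 / p)) := by
      rw [sub_eq_add_neg, Real.rpow_add hT0', Real.rpow_one]
    rw [e]
    have : 0 < T ^ (-(1 / p)) := by positivity
    have : T / 2 ≤ T - T0 := by nlinarith
    nlinarith
  have e1 : T ^ (1 / p) * m = R ^ (2 / p) := by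
    rw [hm, mul_left_comm, ← Real.rpow_add hT0']; simp
  have e2 : R ^ 2 * D = R ^ (2 / p) * T ^ (1 - 1 / p) / q := by
    rw [hD, hm, Real.mul_rpow (by positivity) (by positivity), ← Real.rpow_mul hR0.le, ← Real.rpow_mul hT0'.le]
    have a1 : -(1 / p) * (1 - p) = 1 - 1 / p := by field_simp; ring
    have a2 : R ^ 2 * R ^ (2 / p * (1 - p)) = R ^ (2 / p) := by
      rw [← Real.rpow_natCast R 2, ← Real.rpow_add hR0]
      congr 1
      push_cast
      field_simp
      ring
    rw [a1, ← a2]; ring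
  have hB : M + T ^ (1 / p) * (∫ t in (1:ℝ)..T, t ^ (-(1 / p))) * m + 16 * R ^ 2 * D ≤
      (M + (p + 16) / q) * (R ^ (2 / p) * T ^ (1 - 1 / p)) := by
    have a1 : T ^ (1 / p) * (∫ t in (1:ℝ)..T, t ^ (-(1 / p))) * m ≤ R ^ (2 / p) * (p / q * T ^ (1 - 1 / p)) := by
      calc _ = R ^ (2 / p) * (∫ t in (1:ℝ)..T, t ^ (-(1 / p))) := by rw [← e1]; ring
        _ ≤ _ := by gcongr
    have a2 : 16 * R ^ 2 * D = 16 * (R ^ (2 / p) * T ^ (1 - 1 / p) / q) := by rw [← e2]; ring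
    have a3 : M ≤ M * (R ^ (2 / p) * T ^ (1 - 1 / p)) := by
      have : 1 ≤ R ^ (2 / p) * T ^ (1 - 1 / p) := by nlinarith
      nlinarith
    have a4 : (M + (p + 16) / q) * (R ^ (2 / p) * T ^ (1 - 1 / p)) = M * (R ^ (2 / p) * T ^ (1 - 1 / p)) +
       (R ^ (2 / p) * (p / q * T ^ (1 - 1 / p)) + 16 * (R ^ (2 / p) * T ^ (1 - 1 / p) / q)) := by ring
    linarith
  have hu0 := H.nonneg k T0 hT00.le (by nlinarith)
  have h6 : T0 ^ (1 / p) * u k T0 * (T ^ (1 - 1 / p) / 2) ≤ (M + (p + 16) / q) * (R ^ (2 / p) * T ^ (1 - 1 / p)) := by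
    refine le_trans ?_ ((k2.trans key).trans hB)
    gcongr
  apply le_of_mul_le_mul_right (a := T ^ (1 - 1 / p) / 2) _ (by positivity)
  linarith

theorem decay_all [Nonempty ι] (p M α : ℝ) (hp : 1 ≤ p) (hM : 0 < M) (hα : 0 < α) : ∃ C l0 : ℝ, 0 < C ∧
    ∀ (h T0 R : ℝ) (S : Finset (ι → ℤ)) (g : (ι → ℤ) → ℝ) (u w : (ι → ℤ) → ℝ → ℝ),
    0 < h → h ≤ 1 → 1 ≤ R → l0 ≤ Real.log T0 → 1 < T0 → DSol p M h (T0 ^ 2) S g u w →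
    GEps h R (M * Real.exp (-α * (Real.log (T0 ^ 2)) ^ 2)) M g →
    ∀ k ∈ S, T0 ^ (1 / p) * u k T0 ≤ C * R ^ (2 / p) := by
  rcases hp.eq_or_lt with h1 | h1
  · subst h1; exact decay_p1 M α hM hα
  · exact decay_pgt p M α h1 hM hα

theorem decay_fin [Nonempty ι] (p c0 α β γ δ : ℝ) (hp : 1 ≤ p) (hc0 : 0 < c0) (hα : 0 < α) (hβ : 0 < β) (hγ : 0 < γ) (hδ : 0 < δ) :
    ∃ t0 > Real.exp 1, ∃ C > 0, ∀ (h T0 T : ℝ) (S : Finset (ι → ℤ)) (g : (ι → ℤ) → ℝ) (u w : (ι → ℤ) → ℝ → ℝ),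
    0 < h → h ≤ 1 → t0 ≤ T0 → T0 ^ 2 ≤ T → DSol p c0 h T S g u w → (∀ k, 0 < g k ∧ g k ≤ c0) →
    (∀ (k : ι → ℤ) (i : ι), g k ≤ c0 * Real.exp (-α * Real.exp (β * |h * (k i : ℝ)| ^ γ))) →
    ∀ k ∈ S, u k T0 ≤ C * T0 ^ (-(1:ℝ) / p) * Real.log (Real.log T0) ^ (2 / (p * γ) + δ) := by
  obtain ⟨C, l0, hC, H⟩ := decay_all (ι := ι) p c0 α hp hc0 hα
  have hp0 : 0 < p := by linarith
  set L : ℝ := max 1 (max (β / 2) (Real.log (max 1 l0))) with hL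
  have hL1 : 1 ≤ L := le_max_left _ _
  have hL2 : β / 2 ≤ L := (le_max_left _ _).trans (le_max_right _ _)
  have hL3 : Real.log (max 1 l0) ≤ L := (le_max_right _ _).trans (le_max_right _ _)
  set t0 := Real.exp (Real.exp L) with ht0
  refine ⟨t0, ?_, C * (4 / β) ^ (2 / (p * γ)), by positivity, ?_⟩
  · apply Real.exp_lt_exp.mpr
    have := Real.add_one_le_exp L
    linarith
  intro h T0 T S g u w hh hh1 hT0 hT HS hg hgd k hk
  have hT0p : 0 < T0 := lt_of_lt_of_le (Real.exp_pos _) hT0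
  have hlog : Real.exp L ≤ Real.log T0 := by
    rw [Real.le_log_iff_exp_le hT0p]; exact hT0
  have hlogp : 0 < Real.log T0 := lt_of_lt_of_le (Real.exp_pos _) hlog
  have hll : L ≤ Real.log (Real.log T0) := by
    rw [Real.le_log_iff_exp_le hlogp]; exact hlog
  set ll := Real.log (Real.log T0) with hlldef
  have hT01 : 1 < T0 := by
    by_contra hcon
    push Not at hcon
    linarith [Real.log_nonpos hT0p.le hcon]
  have hlT : Real.log (T0 ^ 2) = 2 * Real.log T0 := by rw [Real.log_pow]; norm_num
  have hll2 : Real.log (Real.log (T0 ^ 2)) = Real.log 2 + ll := by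
    rw [hlT, Real.log_mul (by norm_num) hlogp.ne']
  have hlog2 : Real.log 2 ≤ 1 := by linarith [Real.log_le_sub_one_of_pos (by norm_num : (0:ℝ) < 2)]
  have hlog20 : 0 ≤ Real.log 2 := Real.log_nonneg (by norm_num)
  set Y := 2 / β * (Real.log 2 + ll) with hY
  have hY1 : 1 ≤ Y := by
    rw [hY, div_mul_eq_mul_div, le_div_iff₀ hβ]; linarith
  have hY2 : Y ≤ 4 / β * ll := by
    rw [hY, div_mul_eq_mul_div, div_mul_eq_mul_div]
    apply div_le_div_of_nonneg_right _ hβ.le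
    linarith
  set R := Y ^ (1 / γ) with hR
  have hR1 : 1 ≤ R := Real.one_le_rpow hY1 (by positivity)
  have hRγ : R ^ γ = Y := by
    rw [hR, ← Real.rpow_mul (by linarith)]
    have : 1 / γ * γ = 1 := by field_simp
    rw [this, Real.rpow_one]
  have hexp : Real.exp (β * R ^ γ) = (Real.log (T0 ^ 2)) ^ 2 := by
    rw [hRγ, hY, ← hll2]
    have e : β * (2 / β * Real.log (Real.log (T0 ^ 2))) = Real.log (Real.log (T0 ^ 2)) + Real.log (Real.log (T0 ^ 2)) := by
      field_simp; ring
    rw [e, Real.exp_add, Real.exp_log (by rw [hlT]; linarith)]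
    ring
  have key := H h T0 R S g u w hh hh1 hR1 (by
      have : max 1 l0 ≤ Real.exp L := by
        rw [← Real.log_le_iff_le_exp (lt_of_lt_of_le one_pos (le_max_left _ _))]; exact hL3
      exact (le_max_right 1 l0).trans (this.trans hlog)) hT01 (HS.restrict hT) ⟨hg, by
      rintro j ⟨i, hi⟩
      refine (hgd j i).trans ?_
      rw [← hexp]
      have : R ^ γ ≤ |h * (j i : ℝ)| ^ γ := Real.rpow_le_rpow (by linarith) hi.le hγ.le
      have h2 : Real.exp (β * R ^ γ) ≤ Real.exp (β * |h * (j i : ℝ)| ^ γ) := by gcongr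
      have h3 : -α * Real.exp (β * |h * (j i : ℝ)| ^ γ) ≤ -α * Real.exp (β * R ^ γ) := by nlinarith
      gcongr⟩ k hk
  have hR2 : R ^ (2 / p) = Y ^ (2 / (p * γ)) := by
    rw [hR, ← Real.rpow_mul (by linarith)]
    congr 1
    field_simp
  have hll0 : 0 < ll := by linarith
  have hR3 : R ^ (2 / p) ≤ (4 / β) ^ (2 / (p * γ)) * ll ^ (2 / (p * γ) + δ) := by
    rw [hR2]
    calc Y ^ (2 / (p * γ)) ≤ (4 / β * ll) ^ (2 / (p * γ)) := by
          apply Real.rpow_le_rpow (by linarith) hY2 (by positivity)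
      _ = (4 / β) ^ (2 / (p * γ)) * ll ^ (2 / (p * γ)) := by
          rw [Real.mul_rpow (by positivity) (by linarith)]
      _ ≤ _ := by
          gcongr
          · linarith
          · linarith
  have e : T0 ^ (-(1:ℝ) / p) = (T0 ^ (1 / p))⁻¹ := by
    rw [neg_div, Real.rpow_neg hT0p.le]
  have hTp : 0 < T0 ^ (1 / p) := by positivity
  rw [e]
  have : u k T0 ≤ (T0 ^ (1 / p))⁻¹ * (C * R ^ (2 / p)) := by
    rw [← div_eq_inv_mul, le_div_iff₀ hTp]; linarith
  refine this.trans ?_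
  have h5 : C * R ^ (2 / p) ≤ C * ((4 / β) ^ (2 / (p * γ)) * ll ^ (2 / (p * γ) + δ)) := by gcongr
  calc _ ≤ (T0 ^ (1 / p))⁻¹ * (C * ((4 / β) ^ (2 / (p * γ)) * ll ^ (2 / (p * γ) + δ))) := by gcongr
    _ = _ := by ring

end DF
end FW

namespace FW
variable {ι : Type*} [Fintype ι] [DecidableEq ι]


/-- A family of discrete approximations on finer and larger grids. -/
structure Fam (p M T : ℝ) (U0 : (ι → ℝ) → ℝ) (h : ℕ → ℝ) (S : ℕ → Finset (ι → ℤ))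
    (u w : ℕ → (ι → ℤ) → ℝ → ℝ) : Prop where
  hp : 1 ≤ p
  hM : 0 < M
  hT : 0 < T
  U0c : Continuous U0
  U0p : ∀ x, 0 < U0 x
  U0M : ∀ x, U0 x ≤ M
  hh : ∀ j, 0 < h j
  h0 : Tendsto h atTop (nhds 0)
  ex : ∀ R : ℝ, ∀ᶠ j in atTop, ∀ k : ι → ℤ, (∀ i, |h j * (k i : ℝ)| < R) → k ∈ S j
  sol : ∀ j, DSol p M (h j) T (S j) (fun k => U0 (fun i => h j * (k i : ℝ))) (u j) (w j)

section FamS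
variable {p M T : ℝ} {U0 : (ι → ℝ) → ℝ} {h : ℕ → ℝ} {S : ℕ → Finset (ι → ℤ)} {u w : ℕ → (ι → ℤ) → ℝ → ℝ}

theorem Fam.hsmall (H : Fam p M T U0 h S u w) (e : ℝ) (he : 0 < e) : ∀ᶠ j in atTop, h j < e :=
  H.h0.eventually (gt_mem_nhds he)

theorem Fam.lower (H : Fam p M T U0 h S u w) (R : ℝ) (hR : 0 < R) :
    ∃ lo, 0 < lo ∧ ∀ᶠ j in atTop, ∀ k : ι → ℤ, (∀ i, |h j * (k i : ℝ)| < R) → ∀ t, 0 ≤ t → t ≤ T → lo ≤ u j k t := by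
  obtain ⟨x0, -, hx0⟩ := (isCompact_closedBall (0 : ι → ℝ) (2 * R)).exists_isMinOn
    ⟨0, by simp; linarith⟩ H.U0c.continuousOn
  have hc := H.U0p x0
  have hMp : 0 ≤ M ^ p := Real.rpow_nonneg H.hM.le p
  have hp0 : 0 ≤ p := by linarith [H.hp]
  refine ⟨U0 x0 * Real.exp (-(M ^ p * Fintype.card ι * (π / (2 * (2 * R))) ^ 2) * T) * (1 / 2) ^ Fintype.card ι, by positivity, ?_⟩
  filter_upwards [H.hsmall R hR, H.ex (2 * R)] with j hj1 hj2 k hk t ht0 ht1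
  have Hs := H.sol j
  have key := pc_barrier (h j) (2 * R) T (M ^ p) (U0 x0) (H.hh j) (by linarith) (by linarith) H.hT.le hMp hc.le
    (u j) (fun k t => u j k t ^ p) (fun k _ => Hs.cont k) (by
      intro k hk
      rw [Hs.init k (hj2 k hk)]
      apply hx0
      rw [mem_closedBall, dist_zero_right, pi_norm_le_iff_of_nonneg (by linarith)]
      intro i
      exact (hk i).le) (fun k _ t h0 h1 => Hs.nonneg k t h0.le h1) (by
      intro k hk t h0 h1
      exact ⟨Real.rpow_nonneg (Hs.nonneg k t h0.le h1) p, Real.rpow_le_rpow (Hs.nonneg k t h0.le h1) (Hs.leM k t h0.le h1) hp0⟩)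
      (by
      intro k hk t h0 h1
      have := Hs.du k (hj2 k hk) t h0.le h1
      rw [Hs.eq k (hj2 k hk) t h0.le h1] at this
      exact this) k (fun i => (hk i).trans (by linarith)) t ht0 ht1
  refine le_trans ?_ key
  have h1 : (1 / 2 : ℝ) ^ Fintype.card ι ≤ ∏ i, Real.cos (π / (2 * (2 * R)) * h j * (k i : ℝ)) := by
    have : (1 / 2 : ℝ) ^ Fintype.card ι = ∏ i : ι, (1 / 2 : ℝ) := by simp
    rw [this]
    apply Finset.prod_le_prod
    · intro i _; norm_num
    · intro i _
      apply cos_ge_half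
      rw [mul_assoc, abs_mul, abs_of_pos (by positivity), div_mul_eq_mul_div, div_le_one (by positivity)]
      have h3 := (hk i).le
      have h4 := Real.pi_le_four
      have h5 := Real.pi_pos
      nlinarith [abs_nonneg (h j * (k i : ℝ))]
  have h2 : Real.exp (-(M ^ p * Fintype.card ι * (π / (2 * (2 * R))) ^ 2) * T) ≤
      Real.exp (-(M ^ p * Fintype.card ι * (π / (2 * (2 * R))) ^ 2) * t) := by
    apply Real.exp_le_exp.mpr
    have : 0 ≤ M ^ p * Fintype.card ι * (π / (2 * (2 * R))) ^ 2 := by positivity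
    nlinarith
  gcongr

/-- Uniform estimates on a cube. -/
structure Est (M τ T R lo K h : ℝ) (u w : (ι → ℤ) → ℝ → ℝ) : Prop where
  lo : ∀ k : ι → ℤ, (∀ i, |h * (k i : ℝ)| < R) → ∀ t, τ ≤ t → t ≤ T → lo ≤ u k t
  d1 : ∀ k : ι → ℤ, (∀ i, |h * (k i : ℝ)| < R) → ∀ t, τ ≤ t → t ≤ T → ∀ e, |Dq h e (fun j => u j t) k| ≤ K
  dt : ∀ k : ι → ℤ, (∀ i, |h * (k i : ℝ)| < R) → ∀ t, τ ≤ t → t ≤ T → |w k t| ≤ K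
  d2 : ∀ k : ι → ℤ, (∀ i, |h * (k i : ℝ)| < R) → ∀ t, τ ≤ t → t ≤ T → ∀ e e',
    |Dq h e (fun j => Dq h e' (fun j => u j t) j) k| ≤ K
  hol : ∀ k k' : ι → ℤ, (∀ i, |h * (k i : ℝ)| < R) → (∀ i, |h * (k' i : ℝ)| < R) → ∀ t, τ ≤ t → t ≤ T → ∀ e e',
    |Dq h e (fun j => Dq h e' (fun j => u j t) j) k' - Dq h e (fun j => Dq h e' (fun j => u j t) j) k| ≤
      K * √(h * ∑ i, |(k' i : ℝ) - k i|)

theorem Fam.est (H : Fam p M T U0 h S u w) (R τ : ℝ) (hR : 0 < R) (hτ : 0 < τ) :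
    ∃ lo K, 0 < lo ∧ 0 < K ∧ ∀ᶠ j in atTop, Est M τ T R lo K (h j) (u j) (w j) := by
  obtain ⟨lo, hlo, hlow⟩ := H.lower (R + 1) (by linarith)
  have hp0 : 0 < p := by linarith [H.hp]
  set lo' := min lo M with hlo'
  have hlo'p : 0 < lo' := lt_min hlo H.hM
  set R' := min 1 (τ / 2) with hR'
  have hR'p : 0 < R' := lt_min one_pos (by linarith)
  have hR'1 : R' ≤ 1 := min_le_left _ _
  have hR'2 : R' ≤ τ / 2 := min_le_right _ _
  obtain ⟨r, h0, K, hr, hrR, hh0, hK, hloc⟩ := loc3 (ι := ι) p lo' M (lo' ^ (1 - p) / (p * (τ / 2))) R' H.hp hlo'p (min_le_right _ _)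
    (by positivity) hR'p hR'1
  refine ⟨lo', K + 2 * K / √r, hlo'p, by positivity, ?_⟩
  filter_upwards [H.hsmall h0 hh0, hlow, H.ex (R + 1)] with j hj1 hj2 hj3
  have Hs := H.sol j
  have hKK : K ≤ K + 2 * K / √r := by
    have : 0 ≤ 2 * K / √r := by positivity
    linarith
  have base : ∀ m : ι → ℤ, (∀ i, |h j * (m i : ℝ)| < R) → ∀ s1, τ ≤ s1 → s1 ≤ T →
      Loc p lo' M (lo' ^ (1 - p) / (p * (τ / 2))) R' (h j) s1 (fun k => u j (m + k)) (fun k => w j (m + k)) := by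
    intro m hm s1 hs0 hs1 k hk t ht0 ht1
    have hmk : ∀ i, |h j * ((m + k) i : ℝ)| < R + 1 := by
      intro i
      have e : h j * (((m + k) i : ℤ) : ℝ) = h j * (m i : ℝ) + h j * (k i : ℝ) := by
        rw [Pi.add_apply]; push_cast; ring
      rw [e]
      have := abs_add_le (h j * (m i : ℝ)) (h j * (k i : ℝ))
      linarith [hm i, hk i]
    have hS := hj3 _ hmk
    have ht : τ / 2 ≤ t := by nlinarith
    have htT : t ≤ T := ht1.trans hs1
    have hl : lo' ≤ u j (m + k) t := (min_le_left _ _).trans (hj2 _ hmk t (by linarith) htT)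
    refine ⟨hl, Hs.leM _ t (by linarith) htT, Hs.du _ hS t (by linarith) htT, ?_, ?_, ?_⟩
    · rw [Lp_trans (h j) (fun q => u j q t) m k]
      exact Hs.eq _ hS t (by linarith) htT
    · rw [Lp_trans (h j) (fun q => w j q t) m k]
      exact Hs.dw _ hS t (by linarith) htT
    · rw [Lp_trans (h j) (fun q => u j q t) m k]
      refine le_trans ?_ (Hs.Lp_ge H.hp H.hT.le _ hS t lo' (by linarith) htT hlo'p hl)
      have : lo' ^ (1 - p) / (p * t) ≤ lo' ^ (1 - p) / (p * (τ / 2)) := by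
        have : 0 < lo' ^ (1 - p) := by positivity
        gcongr
      linarith
  have hD2 : ∀ (m k : ι → ℤ) t e e', Dq (h j) e (fun q => Dq (h j) e' (fun q => u j (m + q) t) q) k =
      Dq (h j) e (fun q => Dq (h j) e' (fun q => u j q t) q) (m + k) := by
    intro m k t e e'
    have : (fun q => Dq (h j) e' (fun q => u j (m + q) t) q) = fun q => Dq (h j) e' (fun q => u j q t) (m + q) := by
      funext q; exact Dq_trans (h j) e' (fun q => u j q t) m q
    rw [this]
    exact Dq_trans (h j) e (fun q => Dq (h j) e' (fun q => u j q t) q) m k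
  have h00 : ∀ i : ι, |h j * (((0 : ι → ℤ) i : ℤ) : ℝ)| < r := by intro i; simpa using hr
  have hd2 : ∀ k : ι → ℤ, (∀ i, |h j * (k i : ℝ)| < R) → ∀ t, τ ≤ t → t ≤ T → ∀ e e',
    |Dq (h j) e (fun q => Dq (h j) e' (fun q => u j q t) q) k| ≤ K := by
    intro k hk t ht0 ht1 e e'
    have := ((hloc (h j) t _ _ (H.hh j) hj1.le (base k hk t ht0 ht1)).1 0 h00).2.2 e e'
    rwa [hD2, add_zero] at this
  refine ⟨?_, ?_, ?_, ?_, ?_⟩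
  · intro k hk t ht0 ht1
    exact (min_le_left _ _).trans (hj2 k (fun i => (hk i).trans (by linarith)) t (by linarith) ht1)
  · intro k hk t ht0 ht1 e
    have := ((hloc (h j) t _ _ (H.hh j) hj1.le (base k hk t ht0 ht1)).1 0 h00).1 e
    rw [Dq_trans (h j) e (fun q => u j q t) k 0, add_zero] at this
    linarith
  · intro k hk t ht0 ht1
    have := ((hloc (h j) t _ _ (H.hh j) hj1.le (base k hk t ht0 ht1)).1 0 h00).2.1
    simp only [add_zero] at this
    linarith
  · intro k hk t ht0 ht1 e e'
    exact (hd2 k hk t ht0 ht1 e e').trans hKK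
  · intro k k' hk hk' t ht0 ht1 e e'
    have hs0 : 0 ≤ √(h j * ∑ i, |(k' i : ℝ) - k i|) := Real.sqrt_nonneg _
    by_cases hc : ∀ i, |h j * ((k' i : ℝ) - k i)| < r
    · have := (hloc (h j) t _ _ (H.hh j) hj1.le (base k hk t ht0 ht1)).2 0 (k' - k) h00 (by
        intro i
        have := hc i
        simpa using this) e e'
      rw [hD2, hD2, add_zero, add_sub_cancel] at this
      have e2 : ∑ i, |(((k' - k) i : ℤ) : ℝ) - ((0 : ι → ℤ) i : ℤ)| = ∑ i, |(k' i : ℝ) - k i| := by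
        apply Finset.sum_congr rfl; intro i _; simp
      rw [e2] at this
      refine this.trans ?_
      gcongr
    · push Not at hc
      obtain ⟨i, hi⟩ := hc
      have h1 := hd2 k hk t ht0 ht1 e e'
      have h2 := hd2 k' hk' t ht0 ht1 e e'
      have h3 : r ≤ h j * ∑ i, |(k' i : ℝ) - k i| := by
        refine hi.trans ?_
        rw [abs_mul, abs_of_pos (H.hh j)]
        have := Finset.single_le_sum (f := fun i => |(k' i : ℝ) - k i|) (fun i _ => abs_nonneg _) (Finset.mem_univ i)
        exact mul_le_mul_of_nonneg_left this (H.hh j).le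
      have h4 : √r ≤ √(h j * ∑ i, |(k' i : ℝ) - k i|) := Real.sqrt_le_sqrt h3
      have h5 : 0 < √r := Real.sqrt_pos.mpr hr
      have h6 : 2 * K / √r * √r = 2 * K := by field_simp
      have h7 : 0 ≤ 2 * K / √r := by positivity
      have h8 := abs_sub (Dq (h j) e (fun q => Dq (h j) e' (fun q => u j q t) q) k') (Dq (h j) e (fun q => Dq (h j) e' (fun q => u j q t) q) k)
      have h9 : 2 * K / √r * √r ≤ 2 * K / √r * √(h j * ∑ i, |(k' i : ℝ) - k i|) := by gcongr
      have h10 : 0 ≤ K * √(h j * ∑ i, |(k' i : ℝ) - k i|) := by positivity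
      linarith

end FamS
end FW

namespace FW
variable {ι : Type*} [Fintype ι] [DecidableEq ι]


section FamS
variable {p M T : ℝ} {U0 : (ι → ℝ) → ℝ} {h : ℕ → ℝ} {S : ℕ → Finset (ι → ℤ)} {u w : ℕ → (ι → ℤ) → ℝ → ℝ}

theorem Fam.init_cont (H : Fam p M T U0 h S u w) (x0 : ι → ℝ) (ε : ℝ) (hε : 0 < ε) :
    ∃ ρ δ, 0 < ρ ∧ 0 < δ ∧ ∀ᶠ j in atTop, ∀ k : ι → ℤ, (∀ i, |h j * (k i : ℝ) - x0 i| < ρ) → ∀ t, 0 ≤ t → t ≤ T → t ≤ δ →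
      |u j k t - U0 x0| ≤ ε := by
  obtain ⟨ρ0, hρ0, hcont⟩ := Metric.continuous_iff.mp H.U0c x0 (ε / 3) (by linarith)
  have hp0 : 0 ≤ p := by linarith [H.hp]
  have hMp : 0 ≤ M ^ p := Real.rpow_nonneg H.hM.le p
  have hM := H.hM
  set B := M / ρ0 ^ 2 with hB
  have hBp : 0 < B := by positivity
  set n := (Fintype.card ι : ℝ) with hn
  have hn0 : 0 ≤ n := by positivity
  set K := M ^ p * (2 * n * B) with hK
  have hK0 : 0 ≤ K := by positivity
  set q : ℝ → (ι → ℤ) → ℝ := fun h k => ∑ i, (h * (k i : ℝ) - x0 i) ^ 2 with hq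
  have hq0 : ∀ h k, 0 ≤ q h k := fun h k => Finset.sum_nonneg fun i _ => sq_nonneg _
  have hnear : ∀ (h : ℝ) (k : ι → ℤ), (∀ i, |h * (k i : ℝ) - x0 i| < ρ0) → |U0 (fun i => h * (k i : ℝ)) - U0 x0| < ε / 3 := by
    intro h k hk
    have := hcont (fun i => h * (k i : ℝ)) (by
      rw [dist_pi_lt_iff hρ0]
      intro i
      rw [Real.dist_eq]; exact hk i)
    rwa [Real.dist_eq] at this
  have hfar : ∀ (h : ℝ) (k : ι → ℤ), ¬ (∀ i, |h * (k i : ℝ) - x0 i| < ρ0) → M ≤ B * q h k := by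
    intro h k hk
    push Not at hk
    obtain ⟨i, hi⟩ := hk
    have h1 : (h * (k i : ℝ) - x0 i) ^ 2 ≤ q h k :=
      Finset.single_le_sum (f := fun i => (h * (k i : ℝ) - x0 i) ^ 2) (fun i _ => sq_nonneg _) (Finset.mem_univ i)
    have h2 : ρ0 ^ 2 ≤ (h * (k i : ℝ) - x0 i) ^ 2 := by
      rw [← sq_abs (h * (k i : ℝ) - x0 i)]; gcongr
    have h3 : B * ρ0 ^ 2 = M := by rw [hB]; field_simp
    have h4 : B * ρ0 ^ 2 ≤ B * q h k := by gcongr; linarith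
    linarith
  set ρ := min 1 (ε / (3 * (B * n + 1))) with hρ
  have hρp : 0 < ρ := lt_min one_pos (by positivity)
  set δ := ε / (3 * (K + 1)) with hδ
  have hδp : 0 < δ := by positivity
  refine ⟨ρ, δ, hρp, hδp, ?_⟩
  obtain ⟨X, hX⟩ : ∃ X : ℝ, ∀ i, |x0 i| ≤ X := ⟨‖x0‖, fun i => norm_le_pi_norm x0 i⟩
  filter_upwards [H.ex (X + ρ0)] with j hj k hk t ht0 htT htδ
  have Hs := H.sol j
  have hhj := H.hh j
  have hout : ∀ k : ι → ℤ, k ∉ S j → M ≤ B * q (h j) k := by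
    intro k hk
    apply hfar
    intro hcon
    apply hk
    apply hj
    intro i
    have h1 := hcon i
    have h2 := abs_add_le (h j * (k i : ℝ) - x0 i) (x0 i)
    rw [sub_add_cancel] at h2
    linarith [hX i]
  have hLq : ∀ k, Lp (h j) (fun k => B * q (h j) k) k = B * (2 * n) := by
    intro k
    rw [Lp_const_mul, hq, Lp_nsq_shift (h j) hhj.ne' x0 k]
  have hap : ∀ k t, 0 ≤ t → t ≤ T → 0 ≤ u j k t ^ p ∧ u j k t ^ p ≤ M ^ p := fun k t h0 h1 =>
    ⟨Real.rpow_nonneg (Hs.nonneg k t h0 h1) p, Real.rpow_le_rpow (Hs.nonneg k t h0 h1) (Hs.leM k t h0 h1) hp0⟩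
  have hup := cmp (S j) (h j) T 0 1 one_pos H.hT.le le_rfl (fun k t => (U0 x0 + ε / 3 + B * q (h j) k + K * t) - u j k t)
    (fun k _ => (by fun_prop : Continuous fun t : ℝ => U0 x0 + ε / 3 + B * q (h j) k + K * t).continuousOn.sub (Hs.cont k))
    (by
      intro k hk
      beta_reduce
      rw [Hs.init k hk]
      by_cases hc : ∀ i, |h j * (k i : ℝ) - x0 i| < ρ0
      · have := (abs_lt.mp (hnear _ _ hc)).2
        have := mul_nonneg hBp.le (hq0 (h j) k)
        linarith
      · have := hfar _ _ hc
        have := H.U0M (fun i => h j * (k i : ℝ))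
        have := H.U0p x0
        linarith)
    (by
      intro k hk e he t h0 h1
      beta_reduce
      rw [(Hs.out _ he).1]
      have := mul_nonneg hBp.le (hq0 (h j) (k + dir e))
      have := H.U0p x0
      have := mul_nonneg hK0 h0.le
      simp only [Pi.zero_apply]
      linarith)
    (by
      intro k hk t h0 h1 _ _
      refine ⟨K - w j k t, u j k t ^ p, 0, ?_, (hap k t h0.le h1).1, by simp, ?_⟩
      · have h2 : HasDerivAt (fun t : ℝ => U0 x0 + ε / 3 + B * q (h j) k + K * t) K t :=
          (((hasDerivAt_id t).const_mul K).const_add (U0 x0 + ε / 3 + B * q (h j) k)).congr_deriv (by ring)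
        exact h2.sub (Hs.du k hk t h0.le h1)
      · rw [Hs.eq k hk t h0.le h1]
        have e1 : Lp (h j) (fun k => (U0 x0 + ε / 3 + B * q (h j) k + K * t) - u j k t) k = B * (2 * n) - Lp (h j) (fun k => u j k t) k := by
          have e0 : (fun k => (U0 x0 + ε / 3 + B * q (h j) k + K * t) - u j k t) = fun k => ((U0 x0 + ε / 3 + K * t) + B * q (h j) k) - u j k t := by
            funext k; ring
          rw [e0, Lp_sub, Lp_add, Lp_const, hLq]; ring
        rw [e1]
        have := mul_le_mul_of_nonneg_right (hap k t h0.le h1).2 (by positivity : 0 ≤ 2 * n * B)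
        rw [hK]; nlinarith)
  have hlw := cmp (S j) (h j) T 0 1 one_pos H.hT.le le_rfl (fun k t => (-U0 x0 + ε / 3 + B * q (h j) k + K * t) + u j k t)
    (fun k _ => (by fun_prop : Continuous fun t : ℝ => -U0 x0 + ε / 3 + B * q (h j) k + K * t).continuousOn.add (Hs.cont k))
    (by
      intro k hk
      beta_reduce
      rw [Hs.init k hk]
      by_cases hc : ∀ i, |h j * (k i : ℝ) - x0 i| < ρ0
      · have := (abs_lt.mp (hnear _ _ hc)).1
        have := mul_nonneg hBp.le (hq0 (h j) k)
        linarith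
      · have := hfar _ _ hc
        have := H.U0p (fun i => h j * (k i : ℝ))
        have := H.U0M x0
        linarith)
    (by
      intro k hk e he t h0 h1
      beta_reduce
      rw [(Hs.out _ he).1]
      have := hout _ he
      have := H.U0M x0
      have := mul_nonneg hK0 h0.le
      simp only [Pi.zero_apply]
      linarith)
    (by
      intro k hk t h0 h1 _ _
      refine ⟨K + w j k t, u j k t ^ p, 0, ?_, (hap k t h0.le h1).1, by simp, ?_⟩
      · have h2 : HasDerivAt (fun t : ℝ => -U0 x0 + ε / 3 + B * q (h j) k + K * t) K t :=
          (((hasDerivAt_id t).const_mul K).const_add (-U0 x0 + ε / 3 + B * q (h j) k)).congr_deriv (by ring)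
        exact h2.add (Hs.du k hk t h0.le h1)
      · rw [Hs.eq k hk t h0.le h1]
        have e1 : Lp (h j) (fun k => (-U0 x0 + ε / 3 + B * q (h j) k + K * t) + u j k t) k = B * (2 * n) + Lp (h j) (fun k => u j k t) k := by
          have e0 : (fun k => (-U0 x0 + ε / 3 + B * q (h j) k + K * t) + u j k t) = fun k => ((-U0 x0 + ε / 3 + K * t) + B * q (h j) k) + u j k t := by
            funext k; ring
          rw [e0, Lp_add, Lp_add, Lp_const, hLq]; ring
        rw [e1]
        have := mul_le_mul_of_nonneg_right (hap k t h0.le h1).2 (by positivity : 0 ≤ 2 * n * B)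
        rw [hK]; nlinarith)
  have hqs : B * q (h j) k ≤ ε / 3 := by
    have h1 : q (h j) k ≤ n * ρ := by
      have : q (h j) k ≤ ∑ i : ι, ρ := by
        apply Finset.sum_le_sum
        intro i _
        have h2 := (hk i).le
        have h3 : ρ ≤ 1 := min_le_left _ _
        rw [← sq_abs]
        nlinarith [abs_nonneg (h j * (k i : ℝ) - x0 i)]
      simpa [hn] using this
    have h2 : ρ ≤ ε / (3 * (B * n + 1)) := min_le_right _ _
    rw [le_div_iff₀ (by positivity)] at h2
    nlinarith
  have hKs : K * t ≤ ε / 3 := by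
    have h2 : t ≤ ε / (3 * (K + 1)) := htδ
    rw [le_div_iff₀ (by positivity)] at h2
    nlinarith
  by_cases hkS : k ∈ S j
  · have h1 := hup k hkS t ht0 htT
    have h2 := hlw k hkS t ht0 htT
    rw [abs_le]
    constructor <;> linarith
  · have h1 := hout k hkS
    have h2 := H.U0M x0
    have h3 := H.U0p x0
    rw [(Hs.out k hkS).1]
    simp only [Pi.zero_apply, zero_sub, abs_neg]
    rw [abs_of_pos h3]; linarith

end FamS

theorem second_diff (f : ℕ → ℝ) (c ε : ℝ) (m : ℕ) (H : ∀ a, a < 2 * m → |f (a + 2) - 2 * f (a + 1) + f a - c| ≤ ε) :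
    |f (2 * m) - 2 * f m + f 0 - (m : ℝ) ^ 2 * c| ≤ (m : ℝ) ^ 2 * ε := by
  have h1 : ∀ a b, a + b ≤ 2 * m → |(f (a + b + 1) - f (a + b)) - (f (a + 1) - f a) - b * c| ≤ b * ε := by
    intro a b
    induction b with
    | zero => intro _; simp
    | succ b ih =>
      intro hab
      have h2 := ih (by omega)
      have h3 := H (a + b) (by omega)
      push_cast
      have e : f (a + (b + 1) + 1) - f (a + (b + 1)) - (f (a + 1) - f a) - ((b : ℝ) + 1) * c =
        ((f (a + b + 1) - f (a + b)) - (f (a + 1) - f a) - b * c) + (f (a + b + 2) - 2 * f (a + b + 1) + f (a + b) - c) := by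
        rw [show a + (b + 1) + 1 = a + b + 2 from by ring, show a + (b + 1) = a + b + 1 from by ring]; ring
      rw [e]
      have := abs_add_le ((f (a + b + 1) - f (a + b)) - (f (a + 1) - f a) - b * c) (f (a + b + 2) - 2 * f (a + b + 1) + f (a + b) - c)
      linarith
  have h2 : ∀ a, a ≤ m → |(f (a + m) - f a) - (f m - f 0) - a * (m * c)| ≤ a * (m * ε) := by
    intro a
    induction a with
    | zero => intro _; simp
    | succ a ih =>
      intro ha
      have h3 := ih (by omega)
      have h4 := h1 a m (by omega)
      push_cast
      have e : f (a + 1 + m) - f (a + 1) - (f m - f 0) - ((a : ℝ) + 1) * (m * c) =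
        ((f (a + m) - f a) - (f m - f 0) - a * (m * c)) + ((f (a + m + 1) - f (a + m)) - (f (a + 1) - f a) - m * c) := by
        rw [show a + 1 + m = a + m + 1 from by ring]; ring
      rw [e]
      have := abs_add_le ((f (a + m) - f a) - (f m - f 0) - a * (m * c)) ((f (a + m + 1) - f (a + m)) - (f (a + 1) - f a) - m * c)
      linarith
  have h3 := h2 m le_rfl
  have e : f (2 * m) - 2 * f m + f 0 - (m : ℝ) ^ 2 * c = (f (m + m) - f m) - (f m - f 0) - m * (m * c) := by
    rw [show 2 * m = m + m from by ring]; ring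
  rw [e]
  have e2 : (m : ℝ) ^ 2 * ε = m * (m * ε) := by ring
  rw [e2]; exact h3

theorem disc_taylor (h ω : ℝ) (hh : 0 < h) (f : (ι → ℤ) → ℝ) (k k' : ι → ℤ)
    (H : ∀ (j : ι → ℤ) (i : ι), (∀ l, j l ∈ uIcc (k l) (k' l)) → |Dq h (i, true) f j - Dq h (i, true) f k| ≤ ω) :
    |f k' - f k - ∑ i, Dq h (i, true) f k * (h * ((k' i : ℝ) - k i))| ≤ ω * (h * ∑ i, |((k' i : ℝ) - k i)|) := by
  have := path_lip (h * ω) (fun j => f j - ∑ i, Dq h (i, true) f k * (h * (j i : ℝ))) k k' (by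
    intro j i hj _
    have h1 := H j i hj
    have e : ∑ l, Dq h (l, true) f k * (h * (((j + Pi.single i 1 : ι → ℤ) l : ℤ) : ℝ)) =
        ∑ l, Dq h (l, true) f k * (h * (j l : ℝ)) + Dq h (i, true) f k * h := by
      have e1 : ∀ l, Dq h (l, true) f k * (h * (((j + Pi.single i 1 : ι → ℤ) l : ℤ) : ℝ)) =
        Dq h (l, true) f k * (h * (j l : ℝ)) + if l = i then Dq h (i, true) f k * h else 0 := by
        intro l
        by_cases hl : l = i
        · subst hl; simp; ring
        · simp [hl]
      simp only [e1, Finset.sum_add_distrib]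
      simp
    beta_reduce
    rw [e]
    have e2 : f (j + Pi.single i 1) - f j = h * Dq h (i, true) f j := by
      unfold Dq; rw [dir_true]; field_simp
    have e3 : f (j + Pi.single i 1) - (∑ l, Dq h (l, true) f k * (h * (j l : ℝ)) + Dq h (i, true) f k * h) -
        (f j - ∑ l, Dq h (l, true) f k * (h * (j l : ℝ))) = h * (Dq h (i, true) f j - Dq h (i, true) f k) := by
      linear_combination e2
    rw [e3, abs_mul, abs_of_pos hh]
    gcongr)
  have e : ∑ i, Dq h (i, true) f k * (h * ((k' i : ℝ) - k i)) = ∑ i, Dq h (i, true) f k * (h * (k' i : ℝ)) - ∑ i, Dq h (i, true) f k * (h * (k i : ℝ)) := by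
    rw [← Finset.sum_sub_distrib]; apply Finset.sum_congr rfl; intro i _; ring
  rw [e]
  beta_reduce at this
  calc _ = _ := by congr 1; ring
    _ ≤ _ := this
    _ = _ := by ring

end FW

namespace FW
variable {ι : Type*} [Fintype ι] [DecidableEq ι]


theorem sum_uIcc_le (k k' j : ι → ℤ) (hj : ∀ l, j l ∈ uIcc (k l) (k' l)) :
    ∑ i, |(j i : ℝ) - k i| ≤ ∑ i, |(k' i : ℝ) - k i| := by
  apply Finset.sum_le_sum
  intro i _
  have h1 := abs_sub_left_of_mem_uIcc (hj i)
  exact_mod_cast h1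

theorem Lp_D2 (h : ℝ) (f : (ι → ℤ) → ℝ) (k : ι → ℤ) :
    Lp h f k = ∑ i, Dq h (i, true) (fun j => Dq h (i, true) f j) (k - Pi.single i 1) := by
  rw [Lp_eq, Finset.sum_div]
  apply Finset.sum_congr rfl
  intro i _
  unfold Dq
  rw [dir_true, sub_add_cancel]
  by_cases hh : h = 0
  · subst hh; simp
  · field_simp; ring

section EstS
variable {M τ T R lo K h : ℝ} {u w : (ι → ℤ) → ℝ → ℝ}

theorem Est.lip (E : Est M τ T R lo K h u w) (hh : 0 < h) (k k' : ι → ℤ) (hk : ∀ i, |h * (k i : ℝ)| < R)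
    (hk' : ∀ i, |h * (k' i : ℝ)| < R) (t : ℝ) (h0 : τ ≤ t) (h1 : t ≤ T) :
    |u k' t - u k t| ≤ K * (h * ∑ i, |(k' i : ℝ) - k i|) := by
  have := path_lip (h * K) (fun j => u j t) k k' (by
    intro j i hj _
    exact Dq_lip_unit h K hh _ j i (E.d1 j (cube_uIcc h R hh k k' j hk hk' hj) t h0 h1 _))
  calc _ ≤ _ := this
    _ = _ := by ring

theorem Est.lipD (E : Est M τ T R lo K h u w) (hh : 0 < h) (k k' : ι → ℤ) (hk : ∀ i, |h * (k i : ℝ)| < R)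
    (hk' : ∀ i, |h * (k' i : ℝ)| < R) (t : ℝ) (h0 : τ ≤ t) (h1 : t ≤ T) (e : ι × Bool) :
    |Dq h e (fun j => u j t) k' - Dq h e (fun j => u j t) k| ≤ K * (h * ∑ i, |(k' i : ℝ) - k i|) := by
  have := path_lip (h * K) (fun j => Dq h e (fun j => u j t) j) k k' (by
    intro j i hj _
    exact Dq_lip_unit h K hh _ j i (E.d2 j (cube_uIcc h R hh k k' j hk hk' hj) t h0 h1 _ _))
  calc _ ≤ _ := this
    _ = _ := by ring

theorem Est.tay (E : Est M τ T R lo K h u w) (hh : 0 < h) (hK : 0 ≤ K) (k k' : ι → ℤ) (hk : ∀ i, |h * (k i : ℝ)| < R)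
    (hk' : ∀ i, |h * (k' i : ℝ)| < R) (t : ℝ) (h0 : τ ≤ t) (h1 : t ≤ T) :
    |u k' t - u k t - ∑ i, Dq h (i, true) (fun j => u j t) k * (h * ((k' i : ℝ) - k i))| ≤
      K * (h * ∑ i, |(k' i : ℝ) - k i|) * (h * ∑ i, |(k' i : ℝ) - k i|) := by
  apply disc_taylor h _ hh (fun j => u j t) k k'
  intro j i hj
  refine (E.lipD hh k j hk (cube_uIcc h R hh k k' j hk hk' hj) t h0 h1 (i, true)).trans ?_
  have := sum_uIcc_le k k' j hj
  gcongr

theorem Est.tayD (E : Est M τ T R lo K h u w) (hh : 0 < h) (hK : 0 ≤ K) (k k' : ι → ℤ) (hk : ∀ i, |h * (k i : ℝ)| < R)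
    (hk' : ∀ i, |h * (k' i : ℝ)| < R) (t : ℝ) (h0 : τ ≤ t) (h1 : t ≤ T) (e : ι × Bool) :
    |Dq h e (fun j => u j t) k' - Dq h e (fun j => u j t) k -
      ∑ i, Dq h (i, true) (fun j => Dq h e (fun j => u j t) j) k * (h * ((k' i : ℝ) - k i))| ≤
      K * √(h * ∑ i, |(k' i : ℝ) - k i|) * (h * ∑ i, |(k' i : ℝ) - k i|) := by
  apply disc_taylor h _ hh (fun j => Dq h e (fun j => u j t) j) k k'
  intro j i hj
  refine (E.hol k j hk (cube_uIcc h R hh k k' j hk hk' hj) t h0 h1 (i, true) e).trans ?_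
  have := sum_uIcc_le k k' j hj
  gcongr

theorem Est.lipT (E : Est M τ T R lo K h u w) (hd : ∀ k t, τ ≤ t → t ≤ T → HasDerivAt (u k) (w k t) t)
    (k : ι → ℤ) (hk : ∀ i, |h * (k i : ℝ)| < R) (t t' : ℝ) (h0 : τ ≤ t) (h1 : t ≤ T) (h0' : τ ≤ t') (h1' : t' ≤ T) :
    |u k t' - u k t| ≤ K * |t' - t| := by
  have := Convex.norm_image_sub_le_of_norm_hasDerivWithin_le (f := u k) (f' := w k) (s := Icc τ T) (x := t) (y := t') (C := K)
    (fun x hx => (hd k x hx.1 hx.2).hasDerivWithinAt) (fun x hx => E.dt k hk x hx.1 hx.2) (convex_Icc τ T) ⟨h0, h1⟩ ⟨h0', h1'⟩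
  exact this

theorem Est.d2T (E : Est M τ T (R + 1) lo K h u w) (hh : 0 < h) (hK : 0 ≤ K) (hd : ∀ k t, τ ≤ t → t ≤ T → HasDerivAt (u k) (w k t) t)
    (k : ι → ℤ) (hk : ∀ i, |h * (k i : ℝ)| < R) (t t' : ℝ) (h0 : τ ≤ t) (h1 : t ≤ T) (h0' : τ ≤ t') (h1' : t' ≤ T)
    (m : ℕ) (hm : 0 < m) (hm1 : 2 * m * h ≤ 1) (i : ι) :
    |Dq h (i, true) (fun j => Dq h (i, true) (fun j => u j t') j) k - Dq h (i, true) (fun j => Dq h (i, true) (fun j => u j t) j) k|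
      ≤ 2 * (K * √(2 * m * h)) + 4 * (K * |t' - t|) / (m * h) ^ 2 := by
  have hmp : (0:ℝ) < m := by exact_mod_cast hm
  set P : ℕ → ι → ℤ := fun a => k + Pi.single i (a : ℤ) with hP
  have hPd : ∀ a, P a + Pi.single i 1 = P (a + 1) := by
    intro a
    simp only [hP, add_assoc, ← Pi.single_add]; push_cast; rfl
  have hP0 : P 0 = k := by simp [hP]
  have hPc : ∀ a : ℕ, a ≤ 2 * m → ∀ l, |h * (P a l : ℝ)| < R + 1 := by
    intro a ha l
    have hak : |h * (((Pi.single i (a : ℤ) : ι → ℤ) l : ℤ) : ℝ)| ≤ 1 := by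
      by_cases hl : l = i
      · subst hl
        rw [Pi.single_eq_same]
        have : (a : ℝ) ≤ 2 * m := by exact_mod_cast ha
        rw [abs_of_nonneg (by push_cast; positivity)]
        push_cast
        nlinarith
      · simp [hl]
    have e : h * (P a l : ℝ) = h * (k l : ℝ) + h * (((Pi.single i (a : ℤ) : ι → ℤ) l : ℤ) : ℝ) := by
      simp only [hP, Pi.add_apply]; push_cast; ring
    rw [e]
    have := abs_add_le (h * (k l : ℝ)) (h * (((Pi.single i (a : ℤ) : ι → ℤ) l : ℤ) : ℝ))
    linarith [hk l]
  have main : ∀ s, τ ≤ s → s ≤ T → |u (P (2 * m)) s - 2 * u (P m) s + u (P 0) s -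
      (m:ℝ) ^ 2 * (h ^ 2 * Dq h (i, true) (fun j => Dq h (i, true) (fun j => u j s) j) k)| ≤ (m:ℝ) ^ 2 * (h ^ 2 * (K * √(2 * m * h))) := by
    intro s hs0 hs1
    apply second_diff (fun a => u (P a) s)
    intro a ha
    have e1 : u (P (a + 2)) s - 2 * u (P (a + 1)) s + u (P a) s =
        h ^ 2 * Dq h (i, true) (fun j => Dq h (i, true) (fun j => u j s) j) (P a) := by
      unfold Dq
      beta_reduce
      simp only [dir_true, hPd]
      field_simp; ring
    rw [e1, ← mul_sub, abs_mul, abs_of_pos (by positivity : 0 < h ^ 2)]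
    have h2 := E.hol k (P a) (fun l => (hk l).trans (by linarith)) (hPc a ha.le) s hs0 hs1 (i, true) (i, true)
    have e2 : ∑ l, |((P a l : ℤ) : ℝ) - k l| = a := by
      rw [Finset.sum_eq_single i]
      · simp [hP]
      · intro l _ hl; simp [hP, hl]
      · simp
    rw [e2] at h2
    have h3 : √(h * a) ≤ √(2 * m * h) := by
      apply Real.sqrt_le_sqrt
      have : (a : ℝ) ≤ 2 * m := by exact_mod_cast ha.le
      nlinarith
    have h4 : K * √(h * a) ≤ K * √(2 * m * h) := by gcongr
    gcongr
    linarith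
  have g1 := abs_le.mp (main t h0 h1)
  have g2 := abs_le.mp (main t' h0' h1')
  have l2 := abs_le.mp (E.lipT hd (P (2 * m)) (hPc _ le_rfl) t t' h0 h1 h0' h1')
  have l1 := abs_le.mp (E.lipT hd (P m) (hPc _ (by omega)) t t' h0 h1 h0' h1')
  have l0 := abs_le.mp (E.lipT hd (P 0) (hPc _ (by omega)) t t' h0 h1 h0' h1')
  have hmh : 0 < ((m:ℝ) * h) ^ 2 := by positivity
  have e : 2 * (K * √(2 * m * h)) + 4 * (K * |t' - t|) / (m * h) ^ 2 =
    (2 * ((m:ℝ) ^ 2 * (h ^ 2 * (K * √(2 * m * h)))) + 4 * (K * |t' - t|)) / (m * h) ^ 2 := by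
    field_simp
  rw [e, le_div_iff₀ hmh]
  set D' := Dq h (i, true) (fun j => Dq h (i, true) (fun j => u j t') j) k
  set D := Dq h (i, true) (fun j => Dq h (i, true) (fun j => u j t) j) k
  have e3 : |D' - D| * ((m:ℝ) * h) ^ 2 = |(m:ℝ) ^ 2 * (h ^ 2 * D') - (m:ℝ) ^ 2 * (h ^ 2 * D)| := by
    rw [← abs_of_pos hmh, ← abs_mul]; congr 1; ring
  rw [e3, abs_le]
  constructor <;> linarith

end EstS

section FamS
variable {p M T : ℝ} {U0 : (ι → ℝ) → ℝ} {h : ℕ → ℝ} {S : ℕ → Finset (ι → ℤ)} {u w : ℕ → (ι → ℤ) → ℝ → ℝ}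

theorem Fam.Lmod (H : Fam p M T U0 h S u w) (R τ ε : ℝ) (hR : 0 < R) (hτ : 0 < τ) (hε : 0 < ε) :
    ∃ δ, 0 < δ ∧ ∀ᶠ j in atTop, ∀ k : ι → ℤ, (∀ i, |h j * (k i : ℝ)| < R) → ∀ t t', τ ≤ t → t ≤ T → τ ≤ t' → t' ≤ T → |t' - t| ≤ δ →
      |Lp (h j) (fun q => u j q t') k - Lp (h j) (fun q => u j q t) k| ≤ ε := by
  obtain ⟨lo, K, hlo, hK, hest⟩ := H.est (R + 1 + 1) τ (by linarith) hτ
  set n := (Fintype.card ι : ℝ) with hn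
  have hn0 : 0 ≤ n := by positivity
  set a := ε / (4 * (n * K + 1)) with ha
  have hap : 0 < a := by positivity
  set σ := min (1 / 4) (a ^ 2 / 2) with hσ
  have hσp : 0 < σ := lt_min (by norm_num) (by positivity)
  have hσ1 : σ ≤ 1 / 4 := min_le_left _ _
  have hσ2 : σ ≤ a ^ 2 / 2 := min_le_right _ _
  set δ := ε * σ ^ 2 / (32 * (n * K + 1)) with hδ
  have hδp : 0 < δ := by positivity
  refine ⟨δ, hδp, ?_⟩
  filter_upwards [hest, H.hsmall (σ / 2) (by linarith)] with j E hjs k hk t t' h0 h1 h0' h1' htt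
  have hh := H.hh j
  set m := ⌊σ / h j⌋₊ with hm
  have hm1 : (m:ℝ) * h j ≤ σ := by
    have := Nat.floor_le (by positivity : 0 ≤ σ / h j)
    rwa [le_div_iff₀ hh] at this
  have hm2 : σ / 2 ≤ (m:ℝ) * h j := by
    have := Nat.lt_floor_add_one (σ / h j)
    rw [div_lt_iff₀ hh] at this
    have e : ((m:ℝ) + 1) * h j = m * h j + h j := by ring
    rw [e] at this
    linarith
  have hm0 : 0 < m := by
    rcases Nat.eq_zero_or_pos m with h | h
    · rw [h] at hm2; simp at hm2; linarith
    · exact h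
  have hd : ∀ k t, τ ≤ t → t ≤ T → HasDerivAt (u j k) (w j k t) t := fun k t h0 h1 => (H.sol j).duAll k t (by linarith) h1
  have each : ∀ i : ι, |Dq (h j) (i, true) (fun q => Dq (h j) (i, true) (fun q => u j q t') q) (k - Pi.single i 1) -
      Dq (h j) (i, true) (fun q => Dq (h j) (i, true) (fun q => u j q t) q) (k - Pi.single i 1)| ≤ ε / (n * K + 1) * K := by
    intro i
    have hc : ∀ l, |h j * (((k - Pi.single i 1 : ι → ℤ) l : ℤ) : ℝ)| < R + 1 := by
      intro l
      have h2 := abs_add_dir (h j) hh k (i, false) l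
      have e : k + dir (i, false) = k - Pi.single i 1 := by simp [dir, sub_eq_add_neg]
      rw [e] at h2
      linarith [hk l]
    refine (E.d2T hh hK.le hd (k - Pi.single i 1) hc t t' h0 h1 h0' h1' m hm0 (by linarith) i).trans ?_
    have s1 : √(2 * m * h j) ≤ a := by
      rw [Real.sqrt_le_left hap.le]; linarith
    have s2 : 4 * (K * |t' - t|) / (m * h j) ^ 2 ≤ 4 * (K * δ) / (σ / 2) ^ 2 := by gcongr
    have s3 : 4 * (K * δ) / (σ / 2) ^ 2 = ε / (n * K + 1) * K / 2 := by
      rw [hδ]; field_simp; ring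
    have s4 : 2 * (K * √(2 * m * h j)) ≤ 2 * (K * a) := by gcongr
    have s5 : 2 * (K * a) = ε / (n * K + 1) * K / 2 := by
      rw [ha]; field_simp; ring
    linarith
  rw [Lp_D2, Lp_D2, ← Finset.sum_sub_distrib]
  refine (Finset.abs_sum_le_sum_abs _ _).trans ?_
  refine (Finset.sum_le_sum fun i _ => each i).trans ?_
  rw [Finset.sum_const, nsmul_eq_mul, Finset.card_univ]
  rw [← hn]
  have : n * (ε / (n * K + 1) * K) = ε * (n * K) / (n * K + 1) := by ring
  rw [this, div_le_iff₀ (by positivity)]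
  linarith

theorem Fam.wmod (H : Fam p M T U0 h S u w) (R τ ε : ℝ) (hR : 0 < R) (hτ : 0 < τ) (hε : 0 < ε) :
    ∃ δ, 0 < δ ∧ ∀ᶠ j in atTop, ∀ k : ι → ℤ, (∀ i, |h j * (k i : ℝ)| < R) → ∀ t t', τ ≤ t → t ≤ T → τ ≤ t' → t' ≤ T → |t' - t| ≤ δ →
      |w j k t' - w j k t| ≤ ε := by
  obtain ⟨lo, K, hlo, hK, hest⟩ := H.est (R + 1) τ (by linarith) hτ
  have hMp : 0 ≤ M ^ p := Real.rpow_nonneg H.hM.le p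
  have hMp1 : 0 ≤ M ^ (p - 1) := Real.rpow_nonneg H.hM.le _
  have hp0 : 0 ≤ p := by linarith [H.hp]
  obtain ⟨δ1, hδ1, hL⟩ := H.Lmod R τ (ε / (2 * (M ^ p + 1))) hR hτ (by positivity)
  set n := (Fintype.card ι : ℝ) with hn
  have hn0 : 0 ≤ n := by positivity
  set A := p * M ^ (p - 1) * K * (n * K) with hA
  have hA0 : 0 ≤ A := by positivity
  refine ⟨min δ1 (ε / (2 * (A + 1))), lt_min hδ1 (by positivity), ?_⟩
  filter_upwards [hest, hL, H.ex R, H.hsmall 1 one_pos] with j E hLj hS hj1 k hk t t' h0 h1 h0' h1' htt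
  have hh := H.hh j
  have Hs := H.sol j
  have hd : ∀ k t, τ ≤ t → t ≤ T → HasDerivAt (u j k) (w j k t) t := fun k t h0 h1 => (H.sol j).duAll k t (by linarith) h1
  have hk1 : ∀ i, |h j * (k i : ℝ)| < R + 1 := fun i => (hk i).trans (by linarith)
  rw [Hs.eq k (hS k hk) t (by linarith) h1, Hs.eq k (hS k hk) t' (by linarith) h1']
  have a1 := hLj k hk t t' h0 h1 h0' h1' (htt.trans (min_le_left _ _))
  have a2 := E.lipT hd k hk1 t t' h0 h1 h0' h1'
  have a3 := rpow_lip0 p M (u j k t') (u j k t) H.hp H.hM.le (Hs.nonneg k t' (by linarith) h1') (Hs.leM k t' (by linarith) h1')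
    (Hs.nonneg k t (by linarith) h1) (Hs.leM k t (by linarith) h1)
  have a4 : |Lp (h j) (fun q => u j q t') k| ≤ n * K := by
    rw [Lp_D2]
    refine (Finset.abs_sum_le_sum_abs _ _).trans ?_
    refine (Finset.sum_le_sum (g := fun _ => K) fun i _ => ?_).trans ?_
    · apply E.d2 _ _ t' h0' h1'
      intro l
      have h2 := abs_add_dir (h j) hh k (i, false) l
      have e : k + dir (i, false) = k - Pi.single i 1 := by simp [dir, sub_eq_add_neg]
      rw [e] at h2
      linarith [hk l]
    · rw [Finset.sum_const, nsmul_eq_mul, Finset.card_univ]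
  have a5 : 0 ≤ u j k t ^ p := Real.rpow_nonneg (Hs.nonneg k t (by linarith) h1) p
  have a6 : u j k t ^ p ≤ M ^ p := Real.rpow_le_rpow (Hs.nonneg k t (by linarith) h1) (Hs.leM k t (by linarith) h1) hp0
  set L' := Lp (h j) (fun q => u j q t') k
  set L := Lp (h j) (fun q => u j q t) k
  have e : u j k t' ^ p * L' - u j k t ^ p * L = (u j k t' ^ p - u j k t ^ p) * L' + u j k t ^ p * (L' - L) := by ring
  rw [e]
  refine (abs_add_le _ _).trans ?_
  rw [abs_mul, abs_mul, abs_of_nonneg a5]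
  have b1 : |u j k t' ^ p - u j k t ^ p| * |L'| ≤ (p * M ^ (p - 1) * (K * |t' - t|)) * (n * K) := by
    apply mul_le_mul _ a4 (abs_nonneg _) (by positivity)
    refine a3.trans ?_
    gcongr
  have b2 : (p * M ^ (p - 1) * (K * |t' - t|)) * (n * K) = A * |t' - t| := by rw [hA]; ring
  have b3 : |t' - t| ≤ ε / (2 * (A + 1)) := htt.trans (min_le_right _ _)
  have b4 : A * |t' - t| ≤ ε / 2 := by
    rw [le_div_iff₀ (by positivity)] at b3
    nlinarith [abs_nonneg (t' - t)]
  have b5 : u j k t ^ p * |L' - L| ≤ M ^ p * (ε / (2 * (M ^ p + 1))) := by gcongr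
  have b6 : M ^ p * (ε / (2 * (M ^ p + 1))) ≤ ε / 2 := by
    rw [mul_div_assoc', div_le_div_iff₀ (by positivity) (by norm_num)]
    nlinarith
  linarith

end FamS
end FW

namespace FW
variable {ι : Type*} [Fintype ι] [DecidableEq ι]


/-- A fixed nonprincipal ultrafilter used to take limits. -/
noncomputable def uf : Filter ℕ := (Filter.hyperfilter ℕ : Filter ℕ)

instance uf_neBot : uf.NeBot := by unfold uf; infer_instance

theorem uf_le : uf ≤ atTop := Nat.hyperfilter_le_atTop

/-- Ultrafilter limit. -/
noncomputable def ul (a : ℕ → ℝ) : ℝ := limUnder uf a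

theorem ul_tendsto (a : ℕ → ℝ) (C : ℝ) (H : ∀ᶠ j in atTop, |a j| ≤ C) : Tendsto a uf (nhds (ul a)) := by
  apply tendsto_nhds_limUnder
  have h1 : ((Filter.hyperfilter ℕ).map a : Filter ℝ) ≤ 𝓟 (Icc (-C) C) := by
    rw [le_principal_iff]
    have h2 := uf_le H
    have h3 : a ⁻¹' (Icc (-C) C) ∈ uf := by
      filter_upwards [h2] with j hj
      exact abs_le.mp hj
    exact h3
  obtain ⟨x, -, hx⟩ := isCompact_Icc.ultrafilter_le_nhds _ h1
  exact ⟨x, hx⟩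

/-- Rounding down to the grid. -/
noncomputable def rd (h : ℝ) (x : ι → ℝ) : ι → ℤ := fun i => ⌊x i / h⌋

theorem rd_close (h : ℝ) (hh : 0 < h) (x : ι → ℝ) (i : ι) : |h * (rd h x i : ℝ) - x i| ≤ h := by
  have h1 := Int.floor_le (x i / h)
  have h2 := Int.lt_floor_add_one (x i / h)
  rw [le_div_iff₀ hh] at h1
  rw [div_lt_iff₀ hh] at h2
  unfold rd
  rw [abs_le]
  constructor <;> nlinarith

theorem rd_cube (h R : ℝ) (hh : 0 < h) (hh1 : h ≤ 1) (x : ι → ℝ) (hx : ∀ i, |x i| < R) (i : ι) : |h * (rd h x i : ℝ)| < R + 1 := by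
  have h1 := rd_close h hh x i
  have h2 := abs_add_le (h * (rd h x i : ℝ) - x i) (x i)
  rw [sub_add_cancel] at h2
  linarith [hx i]

theorem rd_dist (h : ℝ) (hh : 0 < h) (x y : ι → ℝ) :
    h * ∑ i, |(rd h y i : ℝ) - rd h x i| ≤ ∑ i, |y i - x i| + 2 * Fintype.card ι * h := by
  rw [Finset.mul_sum]
  have : ∑ i, |y i - x i| + 2 * Fintype.card ι * h = ∑ i : ι, (|y i - x i| + 2 * h) := by
    rw [Finset.sum_add_distrib, Finset.sum_const, nsmul_eq_mul, Finset.card_univ]; ring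
  rw [this]
  apply Finset.sum_le_sum
  intro i _
  rw [← abs_of_pos hh, ← abs_mul, abs_of_pos hh]
  have h1 := abs_le.mp (rd_close h hh x i)
  have h2 := abs_le.mp (rd_close h hh y i)
  have h3 := abs_le.mp (le_refl |y i - x i|)
  rw [abs_le]
  constructor <;> nlinarith

section FamS
variable {p M T : ℝ} {U0 : (ι → ℝ) → ℝ} {h : ℕ → ℝ} {S : ℕ → Finset (ι → ℤ)} {u w : ℕ → (ι → ℤ) → ℝ → ℝ}

/-- The limit function. -/
noncomputable def lv (h : ℕ → ℝ) (u : ℕ → (ι → ℤ) → ℝ → ℝ) (x : ι → ℝ) (t : ℝ) : ℝ := ul fun j => u j (rd (h j) x) t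

/-- The limit of first differences. -/
noncomputable def lG (h : ℕ → ℝ) (u : ℕ → (ι → ℤ) → ℝ → ℝ) (i : ι) (x : ι → ℝ) (t : ℝ) : ℝ :=
  ul fun j => Dq (h j) (i, true) (fun q => u j q t) (rd (h j) x)

/-- The limit of second differences. -/
noncomputable def lH (h : ℕ → ℝ) (u : ℕ → (ι → ℤ) → ℝ → ℝ) (l i : ι) (x : ι → ℝ) (t : ℝ) : ℝ :=
  ul fun j => Dq (h j) (l, true) (fun q => Dq (h j) (i, true) (fun q => u j q t) q) (rd (h j) x)

theorem exists_R (x : ι → ℝ) : ∃ R : ℝ, 0 < R ∧ ∀ i, |x i| < R :=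
  ⟨‖x‖ + 1, by positivity, fun i => by have := norm_le_pi_norm x i; rw [Real.norm_eq_abs] at this; linarith⟩

theorem Fam.estx (H : Fam p M T U0 h S u w) (R τ : ℝ) (hR : 0 < R) (hτ : 0 < τ) :
    ∃ lo K, 0 < lo ∧ 0 < K ∧ ∀ᶠ j in atTop, Est M τ T (R + 1) lo K (h j) (u j) (w j) ∧ ∀ x : ι → ℝ, (∀ i, |x i| < R) →
      ∀ i, |h j * (rd (h j) x i : ℝ)| < R + 1 := by
  obtain ⟨lo, K, hlo, hK, hE⟩ := H.est (R + 1) τ (by linarith) hτ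
  refine ⟨lo, K, hlo, hK, ?_⟩
  filter_upwards [hE, H.hsmall 1 one_pos] with j h1 h2
  exact ⟨h1, fun x hx i => rd_cube (h j) R (H.hh j) h2.le x hx i⟩

theorem Fam.tv (H : Fam p M T U0 h S u w) (x : ι → ℝ) (t : ℝ) (h0 : 0 ≤ t) (h1 : t ≤ T) :
    Tendsto (fun j => u j (rd (h j) x) t) uf (nhds (lv h u x t)) := by
  apply ul_tendsto _ M
  filter_upwards with j
  rw [abs_of_nonneg ((H.sol j).nonneg _ t h0 h1)]
  exact (H.sol j).leM _ t h0 h1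

theorem Fam.tG (H : Fam p M T U0 h S u w) (i : ι) (x : ι → ℝ) (t : ℝ) (h0 : 0 < t) (h1 : t ≤ T) :
    Tendsto (fun j => Dq (h j) (i, true) (fun q => u j q t) (rd (h j) x)) uf (nhds (lG h u i x t)) := by
  obtain ⟨R, hR, hx⟩ := exists_R x
  obtain ⟨lo, K, hlo, hK, hE⟩ := H.estx R t hR h0
  apply ul_tendsto _ K
  filter_upwards [hE] with j hj
  exact hj.1.d1 _ (hj.2 x hx) t le_rfl h1 _

theorem Fam.tH (H : Fam p M T U0 h S u w) (l i : ι) (x : ι → ℝ) (t : ℝ) (h0 : 0 < t) (h1 : t ≤ T) :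
    Tendsto (fun j => Dq (h j) (l, true) (fun q => Dq (h j) (i, true) (fun q => u j q t) q) (rd (h j) x)) uf (nhds (lH h u l i x t)) := by
  obtain ⟨R, hR, hx⟩ := exists_R x
  obtain ⟨lo, K, hlo, hK, hE⟩ := H.estx R t hR h0
  apply ul_tendsto _ K
  filter_upwards [hE] with j hj
  exact hj.1.d2 _ (hj.2 x hx) t le_rfl h1 _ _

theorem Fam.th (H : Fam p M T U0 h S u w) : Tendsto h uf (nhds 0) := H.h0.mono_left uf_le

theorem Fam.td (H : Fam p M T U0 h S u w) (x y : ι → ℝ) :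
    Tendsto (fun j => ∑ i, |y i - x i| + 2 * Fintype.card ι * h j) uf (nhds (∑ i, |y i - x i|)) := by
  have := (H.th.const_mul (2 * (Fintype.card ι : ℝ))).const_add (∑ i, |y i - x i|)
  simpa using this

theorem Fam.trd (H : Fam p M T U0 h S u w) (x : ι → ℝ) (i : ι) :
    Tendsto (fun j => h j * (rd (h j) x i : ℝ)) uf (nhds (x i)) := by
  rw [tendsto_iff_norm_sub_tendsto_zero]
  apply squeeze_zero (fun _ => norm_nonneg _) _ H.th
  intro j
  exact rd_close (h j) (H.hh j) x i

theorem Fam.trd2 (H : Fam p M T U0 h S u w) (x y : ι → ℝ) (i : ι) :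
    Tendsto (fun j => h j * ((rd (h j) y i : ℝ) - rd (h j) x i)) uf (nhds (y i - x i)) := by
  have := (H.trd y i).sub (H.trd x i)
  simpa only [mul_sub] using this

theorem Fam.lim (H : Fam p M T U0 h S u w) (R τ : ℝ) (hR : 0 < R) (hτ : 0 < τ) :
    ∃ lo K, 0 < lo ∧ 0 < K ∧ ∀ t, τ ≤ t → t ≤ T → ∀ x : ι → ℝ, (∀ i, |x i| < R) →
      lo ≤ lv h u x t ∧ (∀ t', τ ≤ t' → t' ≤ T → |lv h u x t' - lv h u x t| ≤ K * |t' - t|) ∧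
      ∀ y : ι → ℝ, (∀ i, |y i| < R) →
      |lv h u y t - lv h u x t| ≤ K * ∑ i, |y i - x i| ∧
      |lv h u y t - lv h u x t - ∑ i, lG h u i x t * (y i - x i)| ≤ K * (∑ i, |y i - x i|) * (∑ i, |y i - x i|) ∧
      (∀ i, |lG h u i y t - lG h u i x t - ∑ l, lH h u l i x t * (y l - x l)| ≤ K * √(∑ i, |y i - x i|) * (∑ i, |y i - x i|)) ∧
      (∀ l i, |lH h u l i y t - lH h u l i x t| ≤ K * √(∑ i, |y i - x i|)) := by
  obtain ⟨lo, K, hlo, hK, hE0⟩ := H.estx R τ hR hτ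
  have hE := uf_le hE0
  refine ⟨lo, K, hlo, hK, ?_⟩
  intro t h0 h1 x hx
  have ht : 0 < t := by linarith
  refine ⟨?_, ?_, ?_⟩
  · apply ge_of_tendsto (H.tv x t ht.le h1)
    filter_upwards [hE] with j hj
    exact hj.1.lo _ (hj.2 x hx) t h0 h1
  · intro t' h0' h1'
    apply le_of_tendsto ((H.tv x t' (by linarith) h1').sub (H.tv x t ht.le h1)).abs
    filter_upwards [hE] with j hj
    exact hj.1.lipT (fun k s hs0 hs1 => (H.sol j).duAll k s (by linarith) hs1) _ (hj.2 x hx) t t' h0 h1 h0' h1'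
  intro y hy
  refine ⟨?_, ?_, ?_, ?_⟩
  · apply le_of_tendsto_of_tendsto ((H.tv y t ht.le h1).sub (H.tv x t ht.le h1)).abs ((H.td x y).const_mul K)
    filter_upwards [hE] with j hj
    refine (hj.1.lip (H.hh j) _ _ (hj.2 x hx) (hj.2 y hy) t h0 h1).trans ?_
    have := rd_dist (h j) (H.hh j) x y
    gcongr
  · apply le_of_tendsto_of_tendsto (((H.tv y t ht.le h1).sub (H.tv x t ht.le h1)).sub
      (tendsto_finsetSum Finset.univ fun i _ => (H.tG i x t ht h1).mul (H.trd2 x y i))).abs (((H.td x y).const_mul K).mul (H.td x y))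
    filter_upwards [hE] with j hj
    refine (hj.1.tay (H.hh j) hK.le _ _ (hj.2 x hx) (hj.2 y hy) t h0 h1).trans ?_
    have := rd_dist (h j) (H.hh j) x y
    have := H.hh j
    gcongr
  · intro i
    apply le_of_tendsto_of_tendsto (((H.tG i y t ht h1).sub (H.tG i x t ht h1)).sub
      (tendsto_finsetSum Finset.univ fun l _ => (H.tH l i x t ht h1).mul (H.trd2 x y l))).abs (((H.td x y).sqrt.const_mul K).mul (H.td x y))
    filter_upwards [hE] with j hj
    refine (hj.1.tayD (H.hh j) hK.le _ _ (hj.2 x hx) (hj.2 y hy) t h0 h1 (i, true)).trans ?_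
    have := rd_dist (h j) (H.hh j) x y
    have := H.hh j
    gcongr
  · intro l i
    apply le_of_tendsto_of_tendsto ((H.tH l i y t ht h1).sub (H.tH l i x t ht h1)).abs ((H.td x y).sqrt.const_mul K)
    filter_upwards [hE] with j hj
    refine (hj.1.hol _ _ (hj.2 x hx) (hj.2 y hy) t h0 h1 (l, true) (i, true)).trans ?_
    have := rd_dist (h j) (H.hh j) x y
    gcongr

theorem Fam.tw (H : Fam p M T U0 h S u w) (x : ι → ℝ) (t : ℝ) (h0 : 0 < t) (h1 : t ≤ T) :
    Tendsto (fun j => w j (rd (h j) x) t) uf (nhds (lv h u x t ^ p * ∑ i, lH h u i i x t)) := by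
  obtain ⟨R, hR, hx⟩ := exists_R x
  have hp0 : 0 ≤ p := by linarith [H.hp]
  obtain ⟨lo, K, hlo, hK, hE⟩ := H.est (R + 1 + 1) t (by linarith) h0
  have hcl : ∀ᶠ j in uf, Est M t T (R + 1 + 1) lo K (h j) (u j) (w j) ∧ h j ≤ 1 ∧ ∀ k : ι → ℤ, (∀ i, |h j * (k i : ℝ)| < R + 1 + 1) → k ∈ S j := by
    apply uf_le
    filter_upwards [hE, H.hsmall 1 one_pos, H.ex (R + 1 + 1)] with j a b c
    exact ⟨a, b.le, c⟩
  have hLp : Tendsto (fun j => Lp (h j) (fun q => u j q t) (rd (h j) x)) uf (nhds (∑ i, lH h u i i x t)) := by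
    have : (fun j => Lp (h j) (fun q => u j q t) (rd (h j) x)) = fun j => ∑ i, Dq (h j) (i, true) (fun q => Dq (h j) (i, true) (fun q => u j q t) q) (rd (h j) x - Pi.single i 1) := by
      funext j; rw [Lp_D2]
    rw [this]
    apply tendsto_finsetSum
    intro i _
    have hs : Tendsto (fun j => K * √(h j)) uf (nhds 0) := by
      have := H.th.sqrt.const_mul K
      simpa using this
    have hz : Tendsto (fun j => Dq (h j) (i, true) (fun q => Dq (h j) (i, true) (fun q => u j q t) q) (rd (h j) x - Pi.single i 1)
        - Dq (h j) (i, true) (fun q => Dq (h j) (i, true) (fun q => u j q t) q) (rd (h j) x)) uf (nhds 0) := by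
      apply squeeze_zero_norm' _ hs
      filter_upwards [hcl] with j hj
      obtain ⟨E, hj1, -⟩ := hj
      have c1 := rd_cube (h j) R (H.hh j) hj1 x hx
      have := E.hol (rd (h j) x) (rd (h j) x - Pi.single i 1) (fun l => (c1 l).trans (by linarith)) (by
        intro l
        have h2 := abs_add_dir (h j) (H.hh j) (rd (h j) x) (i, false) l
        have e : rd (h j) x + dir (i, false) = rd (h j) x - Pi.single i 1 := by simp [dir, sub_eq_add_neg]
        rw [e] at h2
        linarith [c1 l]) t le_rfl h1 (i, true) (i, true)
      have e2 : ∑ l, |(((rd (h j) x - Pi.single i 1 : ι → ℤ) l : ℤ) : ℝ) - rd (h j) x l| = 1 := by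
        rw [Finset.sum_eq_single i]
        · simp
        · intro l _ hl; simp [hl]
        · simp
      rw [e2, mul_one] at this
      exact this
    have := hz.add (H.tH i i x t h0 h1)
    simpa using this
  have := ((H.tv x t h0.le h1).rpow_const (Or.inr hp0)).mul hLp
  refine this.congr' ?_
  filter_upwards [hcl] with j hj
  exact ((H.sol j).eq _ (hj.2.2 _ (fun i => (rd_cube (h j) R (H.hh j) hj.2.1 x hx i).trans (by linarith))) t h0.le h1).symm

theorem Fam.deriv (H : Fam p M T U0 h S u w) (x : ι → ℝ) (t : ℝ) (h0 : 0 < t) (h1 : t < T) :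
    HasDerivAt (fun s => lv h u x s) (lv h u x t ^ p * ∑ i, lH h u i i x t) t := by
  obtain ⟨R, hR, hx⟩ := exists_R x
  rw [hasDerivAt_iff_isLittleO, Asymptotics.isLittleO_iff]
  intro ε hε
  obtain ⟨δ, hδ, hw0⟩ := H.wmod (R + 1) (t / 2) ε (by linarith) (by linarith) hε
  have hw := uf_le hw0
  have hsm : ∀ᶠ j in uf, h j < 1 := uf_le (H.hsmall 1 one_pos)
  have hset : Ioo (max (t / 2) (t - δ)) (min T (t + δ)) ∈ nhds t := by
    apply Ioo_mem_nhds
    · apply max_lt <;> linarith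
    · apply lt_min <;> linarith
  filter_upwards [hset] with s hs
  have hs1 : t / 2 < s := (le_max_left _ _).trans_lt hs.1
  have hs2 : t - δ < s := (le_max_right _ _).trans_lt hs.1
  have hs3 : s < T := hs.2.trans_le (min_le_left _ _)
  have hs4 : s < t + δ := hs.2.trans_le (min_le_right _ _)
  rw [Real.norm_eq_abs, Real.norm_eq_abs, smul_eq_mul]
  apply le_of_tendsto (((H.tv x s (by linarith) hs3.le).sub (H.tv x t h0.le h1.le)).sub ((H.tw x t h0 h1.le).const_mul (s - t))).abs
  filter_upwards [hw, hsm] with j hj hj1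
  have hc := rd_cube (h j) R (H.hh j) hj1.le x hx
  have := Convex.norm_image_sub_le_of_norm_hasDerivWithin_le (f := fun r => u j (rd (h j) x) r - (r - t) * w j (rd (h j) x) t)
    (f' := fun r => w j (rd (h j) x) r - w j (rd (h j) x) t) (s := uIcc t s) (x := t) (y := s) (C := ε) (by
      intro r hr
      have hr0 : t / 2 ≤ r := by
        rcases le_total t s with hts | hts
        · rw [uIcc_of_le hts] at hr; linarith [hr.1]
        · rw [uIcc_of_ge hts] at hr; linarith [hr.1]
      have hr1 : r ≤ T := by
        rcases le_total t s with hts | hts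
        · rw [uIcc_of_le hts] at hr; linarith [hr.2]
        · rw [uIcc_of_ge hts] at hr; linarith [hr.2]
      have d1 := (H.sol j).duAll (rd (h j) x) r (by linarith) hr1
      have d2 : HasDerivAt (fun r => (r - t) * w j (rd (h j) x) t) (w j (rd (h j) x) t) r :=
        (((hasDerivAt_id r).sub_const t).mul_const (w j (rd (h j) x) t)).congr_deriv (by ring)
      exact (d1.sub d2).hasDerivWithinAt) (by
      intro r hr
      have hrr : t / 2 ≤ r ∧ r ≤ T ∧ |r - t| ≤ δ := by
        rw [abs_le]
        rcases le_total t s with hts | hts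
        · rw [uIcc_of_le hts] at hr
          exact ⟨by linarith [hr.1], by linarith [hr.2], by linarith [hr.1], by linarith [hr.2]⟩
        · rw [uIcc_of_ge hts] at hr
          exact ⟨by linarith [hr.1], by linarith [hr.2], by linarith [hr.1], by linarith [hr.2]⟩
      exact hj _ hc t r (by linarith) h1.le hrr.1 hrr.2.1 hrr.2.2) (convex_uIcc t s) left_mem_uIcc right_mem_uIcc
  rw [Real.norm_eq_abs, Real.norm_eq_abs] at this
  refine le_of_eq_of_le ?_ this
  congr 1
  ring

theorem Fam.init (H : Fam p M T U0 h S u w) (x : ι → ℝ) : lv h u x 0 = U0 x := by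
  apply tendsto_nhds_unique (H.tv x 0 le_rfl H.hT.le)
  obtain ⟨R, hR, hx⟩ := exists_R x
  have h1 : Tendsto (fun j => (fun i => h j * (rd (h j) x i : ℝ))) uf (nhds x) := tendsto_pi_nhds.mpr fun i => H.trd x i
  have h2 := (H.U0c.tendsto x).comp h1
  refine h2.congr' ?_
  apply uf_le
  filter_upwards [H.ex (R + 1), H.hsmall 1 one_pos] with j hj hj1
  exact ((H.sol j).init _ (hj _ (rd_cube (h j) R (H.hh j) hj1.le x hx))).symm

theorem Fam.init_lim (H : Fam p M T U0 h S u w) (x0 : ι → ℝ) (ε : ℝ) (hε : 0 < ε) :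
    ∃ ρ δ, 0 < ρ ∧ 0 < δ ∧ ∀ x : ι → ℝ, (∀ i, |x i - x0 i| < ρ) → ∀ t, 0 ≤ t → t ≤ T → t ≤ δ → |lv h u x t - U0 x0| ≤ ε := by
  obtain ⟨ρ, δ, hρ, hδ, hj⟩ := H.init_cont x0 ε hε
  refine ⟨ρ / 2, δ, by linarith, hδ, ?_⟩
  intro x hx t h0 h1 h2
  apply le_of_tendsto ((H.tv x t h0 h1).sub_const (U0 x0)).abs
  apply uf_le
  filter_upwards [hj, H.hsmall (ρ / 2) (by linarith)] with j hj hj1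
  apply hj _ _ t h0 h1 h2
  intro i
  have a := rd_close (h j) (H.hh j) x i
  have b := abs_add_le (h j * (rd (h j) x i : ℝ) - x i) (x i - x0 i)
  rw [sub_add_sub_cancel] at b
  linarith [hx i]

end FamS
end FW

namespace FW

section Fin
variable {n : ℕ}

theorem abs_coord_le (x : EuclideanSpace ℝ (Fin n)) (i : Fin n) : |x i| ≤ ‖x‖ := by
  have := PiLp.norm_apply_le x i
  rwa [Real.norm_eq_abs] at this

/-- The l1 distance. -/
noncomputable def l1 (x y : EuclideanSpace ℝ (Fin n)) : ℝ := ∑ i, |y i - x i|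

theorem l1_le (x y : EuclideanSpace ℝ (Fin n)) : l1 x y ≤ n * ‖y - x‖ := by
  have : l1 x y ≤ ∑ i : Fin n, ‖y - x‖ := Finset.sum_le_sum fun i _ => by
    have := abs_coord_le (y - x) i
    simpa using this
  simpa using this

theorem l1_nonneg (x y : EuclideanSpace ℝ (Fin n)) : 0 ≤ l1 x y := Finset.sum_nonneg fun i _ => abs_nonneg _

theorem l1_tendsto (x : EuclideanSpace ℝ (Fin n)) : Tendsto (fun y => l1 x y) (nhds x) (nhds 0) := by
  have hc : Continuous fun y : EuclideanSpace ℝ (Fin n) => l1 x y := by unfold l1; fun_prop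
  have := hc.tendsto x
  have e : l1 x x = 0 := by simp [l1]
  rwa [e] at this

/-- Linear functional with given coefficients. -/
noncomputable def lin (a : Fin n → ℝ) : EuclideanSpace ℝ (Fin n) →L[ℝ] ℝ := ∑ i, a i • EuclideanSpace.proj i

theorem lin_apply (a : Fin n → ℝ) (x : EuclideanSpace ℝ (Fin n)) : lin a x = ∑ i, a i * x i := by
  simp [lin]

theorem lin_single (a : Fin n → ℝ) (i : Fin n) : lin a (EuclideanSpace.single i 1) = a i := by
  rw [lin_apply, Finset.sum_eq_single i]
  · simp
  · intro l _ hl; simp [hl]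
  · simp

theorem hasF (f : EuclideanSpace ℝ (Fin n) → ℝ) (a : Fin n → ℝ) (x : EuclideanSpace ℝ (Fin n)) (ω : EuclideanSpace ℝ (Fin n) → ℝ)
    (hω : Tendsto ω (nhds x) (nhds 0))
    (H : ∀ᶠ y in nhds x, |f y - f x - ∑ i, a i * (y i - x i)| ≤ ω y * l1 x y) : HasFDerivAt f (lin a) x := by
  rw [hasFDerivAt_iff_isLittleO, Asymptotics.isLittleO_iff]
  intro ε hε
  have h1 : ∀ᶠ y in nhds x, ω y < ε / (n + 1) := hω.eventually (gt_mem_nhds (by positivity))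
  filter_upwards [H, h1] with y hy1 hy2
  have e : lin a (y - x) = ∑ i, a i * (y i - x i) := by rw [lin_apply]; simp
  rw [e, Real.norm_eq_abs]
  refine hy1.trans ?_
  have h2 := l1_le x y
  have h3 := l1_nonneg x y
  calc ω y * l1 x y ≤ ε / (n + 1) * l1 x y := by gcongr
    _ ≤ ε / (n + 1) * (n * ‖y - x‖) := by gcongr
    _ = ε * ‖y - x‖ * (n / (n + 1)) := by ring
    _ ≤ ε * ‖y - x‖ * 1 := by
        gcongr
        rw [div_le_one (by positivity)]; linarith
    _ = _ := by ring

variable {p M T : ℝ} {u₀ : EuclideanSpace ℝ (Fin n) → ℝ} {h : ℕ → ℝ} {S : ℕ → Finset (Fin n → ℤ)} {u w : ℕ → (Fin n → ℤ) → ℝ → ℝ}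

theorem near_cube (x : EuclideanSpace ℝ (Fin n)) : ∃ R : ℝ, 0 < R ∧ (∀ i, |x i| < R) ∧ ∀ᶠ y in nhds x, ∀ i, |y i| < R := by
  refine ⟨‖x‖ + 1, by positivity, fun i => by linarith [abs_coord_le x i], ?_⟩
  have : ∀ᶠ y in nhds x, ‖y‖ < ‖x‖ + 1 := continuous_norm.continuousAt.eventually (gt_mem_nhds (by linarith))
  filter_upwards [this] with y hy i
  exact (abs_coord_le y i).trans_lt hy

theorem Fam.isSolOn (H : Fam p M T (fun y : Fin n → ℝ => u₀ (WithLp.toLp 2 y)) h S u w) :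
    IsSolOn n p u₀ (fun x t => lv h u (fun i => x i) t) T := by
  have hv : ∀ t, 0 < t → t < T → ∀ x : EuclideanSpace ℝ (Fin n), HasFDerivAt (fun y : EuclideanSpace ℝ (Fin n) => lv h u (fun i => y i) t)
      (lin fun i => lG h u i (fun i => x i) t) x := by
    intro t h0 h1 x
    obtain ⟨R, hR, hx, hy⟩ := near_cube x
    obtain ⟨lo, K, hlo, hK, hL⟩ := H.lim R t hR h0
    apply hasF _ _ x (fun y => K * l1 x y)
    · simpa using (l1_tendsto x).const_mul K
    · filter_upwards [hy] with y hy
      exact ((hL t le_rfl h1.le (fun i => x i) hx).2.2 (fun i => y i) hy).2.1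
  have hG : ∀ t, 0 < t → t < T → ∀ (i : Fin n) (x : EuclideanSpace ℝ (Fin n)), HasFDerivAt (fun y : EuclideanSpace ℝ (Fin n) => lG h u i (fun i => y i) t)
      (lin fun l => lH h u l i (fun i => x i) t) x := by
    intro t h0 h1 i x
    obtain ⟨R, hR, hx, hy⟩ := near_cube x
    obtain ⟨lo, K, hlo, hK, hL⟩ := H.lim R t hR h0
    apply hasF _ _ x (fun y => K * √(l1 x y))
    · simpa using (l1_tendsto x).sqrt.const_mul K
    · filter_upwards [hy] with y hy
      exact ((hL t le_rfl h1.le (fun i => x i) hx).2.2 (fun i => y i) hy).2.2.1 i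
  have hH : ∀ t, 0 < t → t < T → ∀ l i : Fin n, Continuous (fun y : EuclideanSpace ℝ (Fin n) => lH h u l i (fun i => y i) t) := by
    intro t h0 h1 l i
    rw [continuous_iff_continuousAt]
    intro x
    obtain ⟨R, hR, hx, hy⟩ := near_cube x
    obtain ⟨lo, K, hlo, hK, hL⟩ := H.lim R t hR h0
    unfold ContinuousAt
    rw [tendsto_iff_norm_sub_tendsto_zero]
    apply squeeze_zero' (g := fun y => K * √(l1 x y))
    · filter_upwards with y using norm_nonneg _
    · filter_upwards [hy] with y hy
      exact ((hL t le_rfl h1.le (fun i => x i) hx).2.2 (fun i => y i) hy).2.2.2 l i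
    · simpa using (l1_tendsto x).sqrt.const_mul K
  have hlap : ∀ t, 0 < t → t < T → ∀ x : EuclideanSpace ℝ (Fin n), lap (fun y : EuclideanSpace ℝ (Fin n) => lv h u (fun i => y i) t) x =
      ∑ i, lH h u i i (fun i => x i) t := by
    intro t h0 h1 x
    unfold lap
    apply Finset.sum_congr rfl
    intro i _
    have e : (fun y : EuclideanSpace ℝ (Fin n) => fderiv ℝ (fun y : EuclideanSpace ℝ (Fin n) => lv h u (fun i => y i) t) y (EuclideanSpace.single i 1)) =
        fun y => lG h u i (fun i => y i) t := by
      funext y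
      rw [(hv t h0 h1 y).fderiv, lin_single]
    rw [e, (hG t h0 h1 i x).fderiv, lin_single]
  refine ⟨?_, ?_, ?_, ?_, ?_⟩
  · rintro ⟨x, t⟩ ⟨ht0, ht1⟩
    simp only at ht0 ht1
    rcases ht0.eq_or_lt with ht | ht
    · subst ht
      rw [Metric.continuousWithinAt_iff]
      intro ε hε
      obtain ⟨ρ, δ, hρ, hδ, hin⟩ := H.init_lim (fun i => x i) (ε / 2) (by linarith)
      refine ⟨min ρ δ, lt_min hρ hδ, ?_⟩
      rintro ⟨y, s⟩ ⟨hs0, hs1⟩ hd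
      simp only at hs0 hs1
      rw [Prod.dist_eq, max_lt_iff] at hd
      simp only at hd ⊢
      have h2 : s ≤ δ := by
        have := hd.2
        rw [Real.dist_eq, sub_zero] at this
        linarith [le_abs_self s, min_le_right ρ δ]
      have h3 := hin (fun i => y i) (by
        intro i
        have h4 := abs_coord_le (y - x) i
        rw [← dist_eq_norm] at h4
        have h5 : (y - x) i = y i - x i := rfl
        rw [h5] at h4
        linarith [hd.1, min_le_left ρ δ]) s hs0 hs1.le h2
      rw [Real.dist_eq, H.init (fun i => x i)]
      linarith
    · apply ContinuousAt.continuousWithinAt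
      obtain ⟨R, hR, hx, hy⟩ := near_cube x
      obtain ⟨lo, K, hlo, hK, hL⟩ := H.lim R (t / 2) hR (by linarith)
      unfold ContinuousAt
      rw [tendsto_iff_norm_sub_tendsto_zero]
      apply squeeze_zero' (g := fun z : EuclideanSpace ℝ (Fin n) × ℝ => K * l1 x z.1 + K * |z.2 - t|)
      · filter_upwards with y using norm_nonneg _
      · have h2 : ∀ᶠ z : EuclideanSpace ℝ (Fin n) × ℝ in nhds (x, t), ∀ i, |z.1 i| < R := (continuous_fst.tendsto (x, t)).eventually hy
        have h3 : ∀ᶠ z : EuclideanSpace ℝ (Fin n) × ℝ in nhds (x, t), z.2 ∈ Ioo (t / 2) T :=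
          (continuous_snd.tendsto (x, t)).eventually (Ioo_mem_nhds (by simp; linarith) ht1)
        filter_upwards [h2, h3] with z hz1 hz2
        have a := ((hL z.2 hz2.1.le hz2.2.le (fun i => x i) hx).2.2 (fun i => z.1 i) hz1).1
        have b := (hL t (by linarith) ht1.le (fun i => x i) hx).2.1 z.2 hz2.1.le hz2.2.le
        rw [Real.norm_eq_abs]
        have c := abs_sub_le (lv h u (fun i => z.1 i) z.2) (lv h u (fun i => x i) z.2) (lv h u (fun i => x i) t)
        refine c.trans (add_le_add a b)
      · have h2 : Tendsto (fun z : EuclideanSpace ℝ (Fin n) × ℝ => l1 x z.1) (nhds (x, t)) (nhds 0) :=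
          (l1_tendsto x).comp (continuous_fst.tendsto (x, t))
        have h3 : Tendsto (fun z : EuclideanSpace ℝ (Fin n) × ℝ => |z.2 - t|) (nhds (x, t)) (nhds 0) := by
          have hc : Continuous (fun z : EuclideanSpace ℝ (Fin n) × ℝ => |z.2 - t|) := by fun_prop
          simpa using hc.tendsto (x, t)
        simpa using (h2.const_mul K).add (h3.const_mul K)
  · intro x
    exact H.init _
  · intro x t h0 h1
    obtain ⟨R, hR, hx, hy⟩ := near_cube x
    obtain ⟨lo, K, hlo, hK, hL⟩ := H.lim R t hR h0
    exact hlo.trans_le (hL t le_rfl h1.le (fun i => x i) hx).1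
  · intro t h0 h1
    have c1 : ∀ i, ContDiff ℝ 1 (fun y : EuclideanSpace ℝ (Fin n) => lG h u i (fun i => y i) t) := by
      intro i
      rw [contDiff_one_iff_fderiv]
      refine ⟨fun x => (hG t h0 h1 i x).differentiableAt, ?_⟩
      have e : fderiv ℝ (fun y : EuclideanSpace ℝ (Fin n) => lG h u i (fun i => y i) t) = fun x => lin fun l => lH h u l i (fun i => x i) t := by
        funext x; exact (hG t h0 h1 i x).fderiv
      rw [e]
      unfold lin
      exact continuous_finsetSum _ fun l _ => (hH t h0 h1 l i).smul continuous_const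
    have e2 : (2 : WithTop ℕ∞) = 1 + 1 := by norm_num
    rw [e2, contDiff_succ_iff_fderiv]
    refine ⟨fun x => (hv t h0 h1 x).differentiableAt, by simp, ?_⟩
    have e : fderiv ℝ (fun y : EuclideanSpace ℝ (Fin n) => lv h u (fun i => y i) t) = fun x => lin fun i => lG h u i (fun i => x i) t := by
      funext x; exact (hv t h0 h1 x).fderiv
    rw [e]
    unfold lin
    exact ContDiff.sum fun i _ => (c1 i).smul contDiff_const
  · intro x t h0 h1
    rw [hlap t h0 h1 x]
    exact H.deriv (fun i => x i) t h0 h1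

end Fin
end FW

/-- Corollary 1.5 of Fila–Winkler.
If `p ≥ 1` and the positive continuous initial data satisfy
`u₀(x) ≤ c₀ exp(-α exp(β|x|^γ))`, then for every `δ > 0` there are `t₀ > e` and `C > 0`
such that the minimal solution satisfies
`‖u(·,t)‖_{L^∞} ≤ C t^{-1/p} (ln ln t)^{2/(pγ)+δ}` for all `t ≥ t₀`
(stated pointwise, which is equivalent for a continuous function). -/
theorem stmt_11 (n : ℕ) (hn : 1 ≤ n)
    (p c₀ α β γ : ℝ) (hp : 1 ≤ p) (hc₀ : 0 < c₀) (hα : 0 < α) (hβ : 0 < β) (hγ : 0 < γ)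
    (u₀ : EuclideanSpace ℝ (Fin n) → ℝ)
    (hu₀cont : Continuous u₀) (hu₀pos : ∀ x, 0 < u₀ x)
    (hu₀dec : ∀ x, u₀ x ≤ c₀ * Real.exp (-α * Real.exp (β * ‖x‖ ^ γ)))
    (u : EuclideanSpace ℝ (Fin n) → ℝ → ℝ)
    (hu : IsMinimalSol n p u₀ u) :
    ∀ δ > (0:ℝ), ∃ t₀ > Real.exp 1, ∃ C > (0:ℝ), ∀ t ≥ t₀, ∀ x,
      u x t ≤ C * t ^ (-(1:ℝ)/p) * Real.log (Real.log t) ^ (2/(p*γ) + δ) := by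
  intro δ hδ
  haveI : Nonempty (Fin n) := ⟨⟨0, by omega⟩⟩
  obtain ⟨t₀, ht₀, C, hC, hfin⟩ := FW.decay_fin (ι := Fin n) p c₀ α β γ δ hp hc₀ hα hβ hγ hδ
  refine ⟨t₀, ht₀, C, hC, ?_⟩
  intro t ht x
  have he : (0:ℝ) < Real.exp 1 := Real.exp_pos 1
  have htp : 0 < t := by linarith
  set U0 : (Fin n → ℝ) → ℝ := fun y => u₀ (WithLp.toLp 2 y) with hU0
  have hU0c : Continuous U0 := hu₀cont.comp (PiLp.continuous_toLp 2 _)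
  have hbd : ∀ x, u₀ x ≤ c₀ := by
    intro x
    refine (hu₀dec x).trans ?_
    have h1 : Real.exp (-α * Real.exp (β * ‖x‖ ^ γ)) ≤ 1 := by
      rw [Real.exp_le_one_iff]
      nlinarith [Real.exp_pos (β * ‖x‖ ^ γ)]
    nlinarith
  set h : ℕ → ℝ := fun j => 1 / ((j : ℝ) + 1) with hh
  have hhp : ∀ j, 0 < h j := fun j => by simp only [hh]; positivity
  have hh1 : ∀ j, h j ≤ 1 := fun j => by
    simp only [hh]; rw [div_le_one (by positivity)]
    have : (0:ℝ) ≤ j := Nat.cast_nonneg j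
    linarith
  set S : ℕ → Finset (Fin n → ℤ) := fun j => FW.box (Fin n) ((j + 1) ^ 2) with hS
  have hgb : ∀ (j : ℕ) (k : Fin n → ℤ), 0 < U0 (fun i => h j * (k i : ℝ)) ∧ U0 (fun i => h j * (k i : ℝ)) ≤ c₀ :=
    fun j k => ⟨hu₀pos _, hbd _⟩
  have hex := fun j => FW.DSol_exists (ι := Fin n) p c₀ (h j) (t ^ 2 + 1) hp hc₀ (hhp j) (by positivity) (S j)
    (fun k => U0 (fun i => h j * (k i : ℝ))) (hgb j)
  choose U W hsol using hex
  have HF : FW.Fam p c₀ (t ^ 2 + 1) U0 h S U W := by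
    refine ⟨hp, hc₀, by positivity, hU0c, fun y => hu₀pos _, fun y => hbd _, hhp, tendsto_one_div_add_atTop_nhds_zero_nat, ?_, hsol⟩
    intro R
    filter_upwards [eventually_ge_atTop ⌈R⌉₊] with j hj k hk
    rw [hS, FW.mem_box]
    intro i
    have h1 := hk i
    have hj2 : R ≤ j := (Nat.le_ceil R).trans (by exact_mod_cast hj)
    have hjp : (0:ℝ) < (j:ℝ) + 1 := by positivity
    simp only [hh] at h1
    rw [abs_mul, abs_of_pos (by positivity), div_mul_eq_mul_div, one_mul, div_lt_iff₀ hjp] at h1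
    have h2 : |((k i : ℤ) : ℝ)| ≤ ((j:ℝ) + 1) ^ 2 := by nlinarith
    exact_mod_cast h2
  have hsolv := HF.isSolOn
  have hmin := hu.2 (t ^ 2 + 1) (by positivity) _ hsolv x t htp.le (by nlinarith)
  refine hmin.trans ?_
  have htT : t ≤ t ^ 2 + 1 := by nlinarith
  apply le_of_tendsto (HF.tv (fun i => x i) t htp.le htT)
  apply FW.uf_le
  obtain ⟨R, hR, hx⟩ := FW.exists_R (fun i => x i)
  filter_upwards [HF.ex (R + 1)] with j hj
  apply hfin (h j) t (t ^ 2 + 1) (S j) _ (U j) (W j) (hhp j) (hh1 j) ht (by linarith) (hsol j) (hgb j) _ _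
    (hj _ (FW.rd_cube (h j) R (hhp j) (hh1 j) _ hx))
  intro k i
  refine (hu₀dec _).trans ?_
  have h1 : |h j * (k i : ℝ)| ≤ ‖(WithLp.toLp 2 (fun i => h j * (k i : ℝ)) : EuclideanSpace ℝ (Fin n))‖ :=
    FW.abs_coord_le (WithLp.toLp 2 (fun i => h j * (k i : ℝ)) : EuclideanSpace ℝ (Fin n)) i
  have h2 : |h j * (k i : ℝ)| ^ γ ≤ ‖(WithLp.toLp 2 (fun i => h j * (k i : ℝ)) : EuclideanSpace ℝ (Fin n))‖ ^ γ :=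
    Real.rpow_le_rpow (abs_nonneg _) h1 hγ.le
  have h3 : Real.exp (β * |h j * (k i : ℝ)| ^ γ) ≤ Real.exp (β * ‖(WithLp.toLp 2 (fun i => h j * (k i : ℝ)) : EuclideanSpace ℝ (Fin n))‖ ^ γ) := by
    gcongr
  apply mul_le_mul_of_nonneg_left _ hc₀.le
  apply Real.exp_le_exp.mpr
  nlinarith
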